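/- Let K be a finite dimensional compact metric space of exceptional type (i.e. dim K² = 2·dim K − 1) and let σ: K^ℤ → K^ℤ be the full shift on the alphabet K. Then the mean dimension of (K^ℤ, σ) equals dim K − 1. -/

import Mathlib

open Filter Set
open scoped ENNReal

namespace MeanDimPaper

variable {X : Type*} [TopologicalSpace X]

/-- `α` is an open cover of `X`. -/
def IsOpenCover (α : Set (Set X)) : Prop :=
  (∀ U ∈ α, IsOpen U) ∧ ⋃₀ α = Set.univ

/-- The order of a cover `α`: the maximum `n ≥ 0` such that there exist `n + 1`
pairwise distinct members of `α` with nonempty common intersection. -/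
noncomputable def ord (α : Set (Set X)) : ℕ∞ :=
  ⨆ n ∈ {n : ℕ | ∃ f : Fin (n + 1) → Set X,
      Function.Injective f ∧ (∀ i, f i ∈ α) ∧ (⋂ i, f i).Nonempty}, (n : ℕ∞)

/-- `β` refines `α`: every member of `β` is contained in some member of `α`. -/
def Refines (β α : Set (Set X)) : Prop := ∀ V ∈ β, ∃ U ∈ α, V ⊆ U

/-- `D(α)`: the minimum of `ord β` over open covers `β` refining `α`. -/
noncomputable def covD (α : Set (Set X)) : ℕ∞ :=
  ⨅ β ∈ {β : Set (Set X) | IsOpenCover β ∧ Refines β α}, ord β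

/-- Topological (covering) dimension: the supremum of `D(α)` over open covers `α`. -/
noncomputable def topDim (X : Type*) [TopologicalSpace X] : ℕ∞ :=
  ⨆ α ∈ {α : Set (Set X) | IsOpenCover α}, covD α

/-- Diameter of a set with respect to a distance function `d`. -/
noncomputable def diamD (d : X → X → ℝ) (U : Set X) : ℝ :=
  sSup {r | ∃ x ∈ U, ∃ y ∈ U, r = d x y}

/-- Mesh of a cover: the supremum of the diameters of its members. -/
noncomputable def mesh (d : X → X → ℝ) (α : Set (Set X)) : ℝ :=
  sSup (diamD d '' α)

/-- `widim_ε(X, d)`: the minimum of `D(α)` over open covers `α` with `mesh(α, d) < ε`. -/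
noncomputable def widim (ε : ℝ) (d : X → X → ℝ) : ℕ∞ :=
  ⨅ α ∈ {α : Set (Set X) | IsOpenCover α ∧ mesh d α < ε}, covD α

/-- `d` is a metric on `X` compatible with the topology of `X`. -/
structure IsCompatMetric {X : Type*} [TopologicalSpace X] (d : X → X → ℝ) : Prop where
  refl : ∀ x, d x x = 0
  eq_of : ∀ x y, d x y = 0 → x = y
  symm : ∀ x y, d x y = d y x
  triangle : ∀ x y z, d x z ≤ d x y + d y z
  isOpen_iff : ∀ U : Set X, IsOpen U ↔ ∀ x ∈ U, ∃ ε > 0, ∀ y, d x y < ε → y ∈ U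

/-- The dynamical distance `d_n(x, y) = max_{0 ≤ i < n} d(Tⁱ x, Tⁱ y)`. -/
noncomputable def dynDist (d : X → X → ℝ) (T : X → X) (n : ℕ) (x y : X) : ℝ :=
  sSup {r | ∃ i < n, r = d (T^[i] x) (T^[i] y)}

/-- Mean dimension `mdim(X, T)` computed with the metric `d`:
`lim_{ε → 0} lim_{n → ∞} widim_ε(X, d_n) / n`.  The inner limit exists (by
subadditivity of `n ↦ widim_ε(X, d_n)`) so it coincides with the liminf, and the inner
quantity is monotone as `ε` decreases, so the limit as `ε → 0` is the supremum over
`ε > 0`. -/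
noncomputable def mdim (T : X → X) (d : X → X → ℝ) : ℝ≥0∞ :=
  ⨆ (ε : ℝ) (_ : 0 < ε),
    Filter.liminf (fun n : ℕ => (widim ε (dynDist d T n) : ℝ≥0∞) / (n : ℝ≥0∞)) Filter.atTop

/-- The full shift `σ` on the alphabet `K`: `σ((xₙ)ₙ) = (xₙ₊₁)ₙ`. -/
def shift (K : Type*) : (ℤ → K) → ℤ → K := fun x n => x (n + 1)

end MeanDimPaper

set_option linter.unusedSectionVars false

namespace MDP

section chains
variable {R : Type*} [CommRing R] {X Y V M : Type*} [AddCommGroup M] [Module R M]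

/-- chains: formal combinations of lists -/
abbrev Ch (R : Type*) [CommRing R] (X : Type*) := List X →₀ R

/-- generator -/
noncomputable def e (R : Type*) [CommRing R] {X : Type*} (l : List X) : Ch R X := Finsupp.single l 1

/-- linear extension -/
noncomputable def ext (R : Type*) [CommRing R] {X M : Type*} [AddCommGroup M] [Module R M]
    (f : List X → M) : Ch R X →ₗ[R] M := Finsupp.linearCombination R f

@[simp] lemma ext_e (f : List X → M) (l : List X) : ext R f (e R l) = f l := by
  simp [ext, e]

lemma lin_ext {f g : Ch R X →ₗ[R] M} (h : ∀ l, f (e R l) = g (e R l)) : f = g := by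
  apply Finsupp.lhom_ext'
  intro l
  apply LinearMap.ext_ring
  exact h l

/-- supported chains -/
noncomputable abbrev Sp (R : Type*) [CommRing R] {X : Type*} (S : Set (List X)) :
    Submodule R (Ch R X) := Finsupp.supported R R S

lemma e_mem {S : Set (List X)} {l : List X} (h : l ∈ S) : e R l ∈ Sp R S :=
  Finsupp.single_mem_supported R 1 h

lemma Sp_mono {S T : Set (List X)} (h : S ⊆ T) : Sp R S ≤ Sp R T := Finsupp.supported_mono h

lemma ext_mem {S : Set (List X)} {f : List X → M} {N : Submodule R M} {c : Ch R X}
    (hc : c ∈ Sp R S) (h : ∀ l ∈ S, f l ∈ N) : ext R f c ∈ N := by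
  unfold ext
  rw [Finsupp.linearCombination_apply, Finsupp.sum]
  refine Submodule.sum_mem _ fun l hl => Submodule.smul_mem _ _ (h l ?_)
  exact (Finsupp.mem_supported R c).1 hc hl

lemma lin_congr {S : Set (List X)} {f g : Ch R X →ₗ[R] M} {c : Ch R X}
    (hc : c ∈ Sp R S) (h : ∀ l ∈ S, f (e R l) = g (e R l)) : f c = g c := by
  have hc' : c = ext R (e R) c := by
    have : (LinearMap.id : Ch R X →ₗ[R] Ch R X) = ext R (e R) := lin_ext (by simp)
    exact LinearMap.congr_fun this c
  rw [hc']
  unfold ext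
  rw [Finsupp.linearCombination_apply, Finsupp.sum, map_sum, map_sum]
  refine Finset.sum_congr rfl fun l hl => ?_
  rw [map_smul, map_smul, h l ((Finsupp.mem_supported R c).1 hc hl)]

lemma ext_congr {S : Set (List X)} {f g : List X → M} {c : Ch R X}
    (hc : c ∈ Sp R S) (h : ∀ l ∈ S, f l = g l) : ext R f c = ext R g c :=
  lin_congr hc (by simpa using h)

lemma ext_zero_of {S : Set (List X)} {f : List X → M} {c : Ch R X}
    (hc : c ∈ Sp R S) (h : ∀ l ∈ S, f l = 0) : ext R f c = 0 := by
  have := ext_mem (N := ⊥) hc (f := f) (by simpa using h)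
  simpa using this

lemma map_ext {M' : Type*} [AddCommGroup M'] [Module R M'] (g : M →ₗ[R] M') (f : List X → M)
    (c : Ch R X) : g (ext R f c) = ext R (fun l => g (f l)) c := by
  have : g ∘ₗ ext R f = ext R (fun l => g (f l)) := lin_ext (by simp)
  exact LinearMap.congr_fun this c

lemma ext_add (f g : List X → M) (c : Ch R X) :
    ext R (fun l => f l + g l) c = ext R f c + ext R g c := by
  have : ext R (fun l => f l + g l) = ext R f + ext R g := lin_ext (by simp)
  exact LinearMap.congr_fun this c

lemma ext_sub (f g : List X → M) (c : Ch R X) :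
    ext R (fun l => f l - g l) c = ext R f c - ext R g c := by
  have : ext R (fun l => f l - g l) = ext R f - ext R g := lin_ext (by simp)
  exact LinearMap.congr_fun this c

lemma ext_smul (r : R) (f : List X → M) (c : Ch R X) :
    ext R (fun l => r • f l) c = r • ext R f c := by
  have : ext R (fun l => r • f l) = r • ext R f := lin_ext (by simp)
  exact LinearMap.congr_fun this c

lemma ext_sum {ι : Type*} (s : Finset ι) (f : ι → List X → M) (c : Ch R X) :
    ext R (fun l => ∑ i ∈ s, f i l) c = ∑ i ∈ s, ext R (f i) c := by
  have : ext R (fun l => ∑ i ∈ s, f i l) = ∑ i ∈ s, ext R (f i) := lin_ext (by simp)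
  rw [this]; simp

lemma lin_eq_ext (g : Ch R X →ₗ[R] M) (c : Ch R X) : g c = ext R (fun l => g (e R l)) c := by
  have : g = ext R (fun l => g (e R l)) := lin_ext (by simp)
  exact LinearMap.congr_fun this c

lemma ext_id (c : Ch R X) : ext R (e R) c = c := by
  have : (LinearMap.id : Ch R X →ₗ[R] Ch R X) = ext R (e R) := lin_ext (by simp)
  exact (LinearMap.congr_fun this c).symm

/-- cone -/
noncomputable def cone (R : Type*) [CommRing R] {X : Type*} (a : X) : Ch R X →ₗ[R] Ch R X :=
  ext R (fun l => e R (a :: l))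

@[simp] lemma cone_e (a : X) (l : List X) : cone R a (e R l) = e R (a :: l) := by simp [cone]

/-- boundary of a list (augmented) -/
noncomputable def bdl (R : Type*) [CommRing R] {X : Type*} : List X → Ch R X
  | [] => 0
  | a :: l => e R l - cone R a (bdl R l)

/-- boundary -/
noncomputable def bd (R : Type*) [CommRing R] {X : Type*} : Ch R X →ₗ[R] Ch R X := ext R (bdl R)

@[simp] lemma bd_e (l : List X) : bd R (e R l) = bdl R l := by simp [bd]

@[simp] lemma bdl_nil : bdl R ([] : List X) = 0 := rfl
lemma bdl_cons (a : X) (l : List X) : bdl R (a :: l) = e R l - cone R a (bdl R l) := rfl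

lemma bd_cone (a : X) (c : Ch R X) : bd R (cone R a c) = c - cone R a (bd R c) := by
  have : bd R ∘ₗ cone R a = LinearMap.id - cone R a ∘ₗ bd R := lin_ext (by simp [bdl_cons])
  exact LinearMap.congr_fun this c

lemma bd_bdl (l : List X) : bd R (bdl R l) = 0 := by
  induction l with
  | nil => simp
  | cons a l ih => rw [bdl_cons, map_sub, bd_cone, ih]; simp

lemma bd_bd (c : Ch R X) : bd R (bd R c) = 0 := by
  have : bd R ∘ₗ bd R = (0 : Ch R X →ₗ[R] Ch R X) := lin_ext (by simp [bd_bdl])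
  exact LinearMap.congr_fun this c

/-- lists of given length in a set -/
def L (n : ℕ) (A : Set X) : Set (List X) := {l | l.length = n ∧ ∀ x ∈ l, x ∈ A}

lemma L_mono {n : ℕ} {A B : Set X} (h : A ⊆ B) : L n A ⊆ L n B := fun _ hl => ⟨hl.1, fun x hx => h (hl.2 x hx)⟩

lemma cone_mem {S T : Set (List X)} {a : X} {c : Ch R X} (hc : c ∈ Sp R S)
    (h : ∀ l ∈ S, a :: l ∈ T) : cone R a c ∈ Sp R T :=
  ext_mem hc fun l hl => e_mem (h l hl)

lemma cone_mem_L {n : ℕ} {A : Set X} {a : X} {c : Ch R X} (hc : c ∈ Sp R (L n A)) (ha : a ∈ A) :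
    cone R a c ∈ Sp R (L (n+1) A) :=
  cone_mem hc fun l hl => ⟨by simp [hl.1], by
    intro x hx
    rcases List.mem_cons.1 hx with rfl | hx
    · exact ha
    · exact hl.2 x hx⟩

lemma bdl_mem {n : ℕ} {A : Set X} {l : List X} (hl : l ∈ L (n+1) A) : bdl R l ∈ Sp R (L n A) := by
  induction l generalizing n with
  | nil => simp [L] at hl
  | cons a l ih =>
    obtain ⟨h1, h2⟩ := hl
    have hl' : ∀ x ∈ l, x ∈ A := fun x hx => h2 x (List.mem_cons_of_mem _ hx)
    have h1' : l.length = n := by simpa using h1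
    rw [bdl_cons]
    refine Submodule.sub_mem _ (e_mem ⟨h1', hl'⟩) ?_
    cases n with
    | zero =>
      have : l = [] := List.length_eq_zero_iff.1 h1'
      subst this; simp
    | succ n => exact cone_mem_L (ih ⟨h1', hl'⟩) (h2 a (by simp))

lemma bd_mem {n : ℕ} {A : Set X} {c : Ch R X} (hl : c ∈ Sp R (L (n+1) A)) : bd R c ∈ Sp R (L n A) :=
  ext_mem hl fun _ h => bdl_mem h

lemma bdl_mem' (l : List X) : bdl R l ∈ Sp R (L (l.length - 1) {x | x ∈ l}) := by
  cases l with
  | nil => simp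
  | cons a l => exact bdl_mem ⟨by simp, fun x hx => hx⟩

lemma e_mem_L (l : List X) : e R l ∈ Sp R (L l.length {x | x ∈ l}) := e_mem ⟨rfl, fun _ h => h⟩

/-- degenerate lists -/
def Deg (l : List X) : Prop := ∃ l₁ a l₂, l = l₁ ++ a :: a :: l₂

lemma Deg.cons {l : List X} (h : Deg l) (b : X) : Deg (b :: l) := by
  obtain ⟨l₁, a, l₂, rfl⟩ := h
  exact ⟨b :: l₁, a, l₂, rfl⟩

lemma Deg.map {l : List X} (h : Deg l) (f : X → Y) : Deg (l.map f) := by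
  obtain ⟨l₁, a, l₂, rfl⟩ := h
  exact ⟨l₁.map f, f a, l₂.map f, by simp⟩

lemma Deg.two (a : X) (l : List X) : Deg (a :: a :: l) := ⟨[], a, l, rfl⟩

/-! ### sorting -/
section sort
variable [LinearOrder V]

/-- signed insertion -/
noncomputable def ins (R : Type*) [CommRing R] {V : Type*} [LinearOrder V] (a : V) : List V → Ch R V
  | [] => e R [a]
  | b :: l => if a < b then e R (a :: b :: l) else if a = b then 0 else - cone R b (ins R a l)

/-- signed sorting -/
noncomputable def srt (R : Type*) [CommRing R] {V : Type*} [LinearOrder V] : List V → Ch R V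
  | [] => e R []
  | a :: l => ext R (ins R a) (srt R l)

lemma ins_of_lt {a : V} {l : List V} (h : ∀ x ∈ l, a < x) : ins R a l = e R (a :: l) := by
  cases l with
  | nil => rfl
  | cons b l => simp [ins, h b (by simp)]

/-- strictly sorted lists in a set, of given length -/
def SL (n : ℕ) (A : Set V) : Set (List V) := {l | l.Pairwise (· < ·) ∧ l ∈ L n A}

lemma ins_mem {a : V} {A : Set V} (ha : a ∈ A) {n : ℕ} {l : List V} (hl : l ∈ SL n A) :
    ins R a l ∈ Sp R (SL (n+1) A) := by
  induction l generalizing n A with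
  | nil =>
    refine e_mem ⟨by simp, ?_, by simpa using ha⟩
    have := hl.2.1; simp at this; simp [← this]
  | cons b l ih =>
    obtain ⟨h1, h2, h3⟩ := hl
    obtain ⟨h1a, h1b⟩ := List.pairwise_cons.1 h1
    simp only [ins]
    split_ifs with hab hab'
    · refine e_mem ⟨?_, by simp at h2 ⊢; omega, ?_⟩
      · refine List.pairwise_cons.2 ⟨?_, h1⟩
        intro x hx
        rcases List.mem_cons.1 hx with rfl | hx
        · exact hab
        · exact hab.trans (h1a x hx)
      · intro x hx
        rcases List.mem_cons.1 hx with rfl | hx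
        · exact ha
        · exact h3 x hx
    · simp
    · refine Submodule.neg_mem _ ?_
      have hba : b < a := lt_of_le_of_ne (not_lt.1 hab) (Ne.symm hab')
      cases n with
      | zero => simp at h2
      | succ n =>
      have := ih (A := A ∩ {x | b < x}) (n := n) ⟨ha, hba⟩ ⟨h1b, by simpa using h2,
        fun x hx => ⟨h3 x (List.mem_cons_of_mem _ hx), h1a x hx⟩⟩
      refine cone_mem this ?_
      rintro l' ⟨k1, k2, k3⟩
      refine ⟨List.pairwise_cons.2 ⟨fun x hx => (k3 x hx).2, k1⟩, by simp [k2], ?_⟩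
      intro x hx
      rcases List.mem_cons.1 hx with rfl | hx
      · exact h3 _ (by simp)
      · exact (k3 x hx).1

lemma ext_ins_cone_self (a : V) (c : Ch R V) : ext R (ins R a) (cone R a c) = 0 := by
  have : ext R (ins R a) ∘ₗ cone R a = 0 := lin_ext (by simp [ins])
  exact LinearMap.congr_fun this c

lemma ext_ins_cone_gt {a b : V} (h : b < a) (c : Ch R V) :
    ext R (ins R a) (cone R b c) = - cone R b (ext R (ins R a) c) := by
  have : ext R (ins R a) ∘ₗ cone R b = - (cone R b ∘ₗ ext R (ins R a)) :=
    lin_ext (by simp [ins, not_lt.2 h.le, h.ne'])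
  exact LinearMap.congr_fun this c

lemma ext_ins_cone_lt {a b : V} (h : a < b) (c : Ch R V) :
    ext R (ins R a) (cone R b c) = cone R a (cone R b c) := by
  have : ext R (ins R a) ∘ₗ cone R b = cone R a ∘ₗ cone R b :=
    lin_ext (by simp [ins, h])
  exact LinearMap.congr_fun this c

lemma bd_ins (a : V) {l : List V} (hl : l.Pairwise (· < ·)) :
    bd R (ins R a l) = e R l - ext R (ins R a) (bdl R l) := by
  induction l with
  | nil => simp [ins, bdl_cons]
  | cons b l ih =>
    obtain ⟨h1a, h1b⟩ := List.pairwise_cons.1 hl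
    rcases lt_trichotomy a b with hab | rfl | hab
    · simp only [ins, hab, if_true, bd_e]
      rw [bdl_cons, bdl_cons, map_sub (ext R _), ext_ins_cone_lt hab, ext_e,
        ins_of_lt (fun x hx => hab.trans (h1a x hx)), map_sub (cone R a), cone_e]
    · simp only [ins, lt_irrefl, if_false, if_true]
      rw [bdl_cons, map_sub, ext_ins_cone_self, ext_e, ins_of_lt h1a]; simp
    · simp only [ins, not_lt.2 hab.le, if_false, hab.ne']
      rw [map_neg, bd_cone, ih h1b, bdl_cons, map_sub (ext R _), ext_ins_cone_gt hab, ext_e]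
      simp; abel

lemma srt_mem {l : List V} : srt R l ∈ Sp R (SL l.length {x | x ∈ l}) := by
  induction l with
  | nil => exact e_mem ⟨by simp, by simp, by simp⟩
  | cons a l ih =>
    refine ext_mem ih ?_
    intro l' hl'
    refine ins_mem (by simp) ⟨hl'.1, hl'.2.1, fun x hx => ?_⟩
    exact List.mem_cons_of_mem _ (hl'.2.2 x hx)

lemma bd_srt (l : List V) : bd R (srt R l) = ext R (srt R) (bdl R l) := by
  induction l with
  | nil => simp [srt]
  | cons a l ih =>
    rw [srt, map_ext, ext_congr srt_mem (g := fun l => e R l - ext R (ins R a) (bdl R l))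
      (fun l' hl' => bd_ins a hl'.1), ext_sub, ext_id, bdl_cons, map_sub, ext_e]
    have h1 : ext R (fun l => ext R (ins R a) (bdl R l)) (srt R l)
        = ext R (ins R a) (bd R (srt R l)) := by rw [bd, map_ext]
    have h2 : ext R (srt R) (cone R a (bdl R l)) = ext R (ins R a) (ext R (srt R) (bdl R l)) := by
      have : ext R (srt R) ∘ₗ cone R a = ext R (ins R a) ∘ₗ ext R (srt R) := lin_ext (by simp [srt])
      exact LinearMap.congr_fun this _
    rw [h1, h2, ih]

lemma ins_ins (a : V) (l : List V) : ext R (ins R a) (ins R a l) = 0 := by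
  induction l with
  | nil => simp [ins]
  | cons b l ih =>
    rcases lt_trichotomy a b with hab | rfl | hab
    · simp [ins, hab]
    · simp [ins]
    · simp only [ins, not_lt.2 hab.le, if_false, hab.ne', map_neg]
      rw [ext_ins_cone_gt hab, ih]; simp

lemma srt_deg {l : List V} (h : Deg l) : srt R l = 0 := by
  obtain ⟨l₁, a, l₂, rfl⟩ := h
  induction l₁ with
  | nil =>
    simp only [List.nil_append, srt]
    rw [map_ext]
    exact ext_zero_of (S := univ) (by simp) (fun l _ => ins_ins a l)
  | cons b l₁ ih => simp only [List.cons_append, srt]; rw [ih]; simp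

lemma srt_sorted {l : List V} (h : l.Pairwise (· < ·)) : srt R l = e R l := by
  induction l with
  | nil => rfl
  | cons a l ih =>
    obtain ⟨h1a, h1b⟩ := List.pairwise_cons.1 h
    rw [srt, ih h1b, ext_e, ins_of_lt h1a]

end sort

/-! ### homotopy -/
theorem exists_htpy (f : List X → Ch R X) (Car : List X → Set X) (hf0 : f [] = e R [])
    (hchain : ∀ l, bd R (f l) = ext R f (bdl R l))
    (hcar : ∀ l, f l ∈ Sp R (L l.length (Car l)))
    (hself : ∀ l, ∀ x ∈ l, x ∈ Car l)
    (hmono : ∀ l l' : List X, (∀ x ∈ l', x ∈ l) → Car l' ⊆ Car l) :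
    ∃ h : List X → Ch R X, (∀ l, bd R (h l) + ext R h (bdl R l) = e R l - f l) ∧
      ∀ l, h l ∈ Sp R (L (l.length + 1) (Car l)) := by
  classical
  let st : (Ch R X →ₗ[R] Ch R X) → List X → Ch R X := fun g l =>
    match l with
    | [] => 0
    | a :: l => cone R a (e R (a :: l) - f (a :: l) - g (bdl R (a :: l)))
  let H : ℕ → (Ch R X →ₗ[R] Ch R X) := fun n => Nat.rec 0 (fun _ g => ext R (st g)) n
  have Hs : ∀ n l, H (n+1) (e R l) = st (H n) l := fun n l => by simp [H]
  let h : List X → Ch R X := fun l => H (l.length + 1) (e R l)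
  have hbd : ∀ l : List X, ext R h (bdl R l) = H l.length (bdl R l) := by
    intro l
    rcases l with _ | ⟨a, l⟩
    · simp
    refine lin_congr (bdl_mem' (a :: l)) ?_
    intro l' hl'
    simp only [ext_e, h]
    rw [hl'.1]; simp
  have hcons : ∀ a l, h (a :: l)
      = cone R a (e R (a :: l) - f (a :: l) - ext R h (bdl R (a :: l))) := by
    intro a l
    rw [hbd]
    simp only [h]
    rw [Hs]
  have hnil : h [] = 0 := by simp only [h]; rw [Hs]
  have key : ∀ n, ∀ l : List X, l.length = n → bd R (h l) + ext R h (bdl R l) = e R l - f l := by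
    intro n
    induction n with
    | zero =>
      intro l hl
      obtain rfl := List.length_eq_zero_iff.1 hl
      simp [hnil, hf0]
    | succ n ih =>
      intro l hl
      rcases l with _ | ⟨a, l⟩
      · simp at hl
      have hz : bd R (e R (a :: l) - f (a :: l) - ext R h (bdl R (a :: l))) = 0 := by
        have h1 : bd R (ext R h (bdl R (a :: l))) + ext R h (bd R (bdl R (a :: l)))
            = bdl R (a :: l) - ext R f (bdl R (a :: l)) := by
          have := lin_congr (f := bd R ∘ₗ ext R h + ext R h ∘ₗ bd R)
            (g := LinearMap.id - ext R f) (bdl_mem' (R := R) (a :: l)) (by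
              intro l' hl'
              have := ih l' (by rw [hl'.1, hl]; simp)
              simpa using this)
          simpa using this
        rw [bd_bdl, map_zero, add_zero] at h1
        rw [map_sub, map_sub, h1, hchain, bd_e]; abel
      rw [hcons, bd_cone, hz]
      simp
  refine ⟨h, fun l => key _ l rfl, ?_⟩
  have key2 : ∀ n, ∀ l : List X, l.length = n → h l ∈ Sp R (L (l.length + 1) (Car l)) := by
    intro n
    induction n with
    | zero =>
      intro l hl
      obtain rfl := List.length_eq_zero_iff.1 hl
      simp [hnil]
    | succ n ih =>
      intro l hl
      rcases l with _ | ⟨a, l⟩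
      · simp at hl
      rw [hcons]
      refine cone_mem_L ?_ (hself _ a (by simp))
      refine Submodule.sub_mem _ (Submodule.sub_mem _ ?_ (hcar _)) ?_
      · exact e_mem ⟨rfl, hself _⟩
      · refine ext_mem (bdl_mem' (a :: l)) ?_
        intro l' hl'
        have h1 : l'.length + 1 = (a :: l).length := by rw [hl'.1]; simp
        have := ih l' (by omega)
        rw [h1] at this
        exact Sp_mono (L_mono (hmono _ _ hl'.2)) this
  exact fun l => key2 _ l rfl

end chains
end MDP

namespace MDP

section prod
variable {R : Type*} [CommRing R] {X Y V M : Type*} [AddCommGroup M] [Module R M]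

/-- bilinear extension -/
noncomputable def ext2 (R : Type*) [CommRing R] {X Y M : Type*} [AddCommGroup M] [Module R M]
    (b : List X → List Y → M) : Ch R X →ₗ[R] Ch R Y →ₗ[R] M := ext R (fun s => ext R (b s))

@[simp] lemma ext2_e_left (b : List X → List Y → M) (s : List X) :
    ext2 R b (e R s) = ext R (b s) := by simp [ext2]

lemma ext2_e_right (b : List X → List Y → M) (c : Ch R X) (t : List Y) :
    ext2 R b c (e R t) = ext R (fun s => b s t) c := by
  have : (ext2 R b).flip (e R t) = ext R (fun s => b s t) := lin_ext (by simp)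
  exact LinearMap.congr_fun this c

lemma ext2_comm (b : List X → List Y → M) (c : Ch R X) (d : Ch R Y) :
    ext2 R b c d = ext R (fun t => ext R (fun s => b s t) c) d := by
  have : ext2 R b c = ext R (fun t => ext R (fun s => b s t) c) :=
    lin_ext (by intro t; rw [ext2_e_right]; simp)
  rw [this]

lemma ext2_eq (b : List X → List Y → M) (c : Ch R X) (d : Ch R Y) :
    ext2 R b c d = ext R (fun s => ext R (b s) d) c := by
  have : (ext2 R b).flip d = ext R (fun s => ext R (b s) d) := lin_ext (by simp)
  exact LinearMap.congr_fun this c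

lemma ext2_congr {S : Set (List X)} {T : Set (List Y)} {b b' : List X → List Y → M} {c : Ch R X}
    {d : Ch R Y} (hc : c ∈ Sp R S) (hd : d ∈ Sp R T) (h : ∀ s ∈ S, ∀ t ∈ T, b s t = b' s t) :
    ext2 R b c d = ext2 R b' c d := by
  rw [ext2_eq, ext2_eq]
  exact ext_congr hc fun s hs => ext_congr hd fun t ht => h s hs t ht

lemma ext2_mem {S : Set (List X)} {T : Set (List Y)} {b : List X → List Y → M} {c : Ch R X}
    {d : Ch R Y} {N : Submodule R M}
    (hc : c ∈ Sp R S) (hd : d ∈ Sp R T) (h : ∀ s ∈ S, ∀ t ∈ T, b s t ∈ N) :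
    ext2 R b c d ∈ N := by
  rw [ext2_eq]
  exact ext_mem hc fun s hs => ext_mem hd fun t ht => h s hs t ht

lemma map_ext2 {M' : Type*} [AddCommGroup M'] [Module R M'] (g : M →ₗ[R] M')
    (b : List X → List Y → M) (c : Ch R X) (d : Ch R Y) :
    g (ext2 R b c d) = ext2 R (fun s t => g (b s t)) c d := by
  rw [ext2_eq, ext2_eq, map_ext]
  congr 2; ext s; rw [map_ext]

/-- shuffle product -/
noncomputable def D (R : Type*) [CommRing R] {X Y : Type*} : List X → List Y → Ch R (X × Y)
  | [], [_] => e R []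
  | [], [] => 0
  | [], _ :: _ :: _ => 0
  | _ :: _, [] => 0
  | a :: s, b :: t => cone R (a, b) (D R s (b :: t) + (-1 : R) ^ s.length • D R (a :: s) t)
termination_by s t => s.length + t.length

lemma D_cons (a : X) (s : List X) (b : Y) (t : List Y) :
    D R (a :: s) (b :: t) = cone R (a, b) (D R s (b :: t) + (-1 : R) ^ s.length • D R (a :: s) t) := by
  rw [D]

@[simp] lemma D_nil_right (s : List X) : D R s ([] : List Y) = 0 := by
  cases s <;> rw [D]

lemma D_nil_left (t : List Y) : D R ([] : List X) t = if t.length = 1 then e R [] else 0 := by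
  rcases t with _ | ⟨a, _ | ⟨b, t⟩⟩ <;> rw [D] <;> simp

lemma D_cone_left {n : ℕ} (a : X) {c : Ch R X} (hc : c ∈ Sp R (L n univ)) (b : Y) (t : List Y) :
    ext2 R (D R) (cone R a c) (e R (b :: t)) =
      cone R (a, b) (ext2 R (D R) c (e R (b :: t)) + (-1 : R) ^ n • ext2 R (D R) (cone R a c) (e R t)) := by
  have := lin_congr (f := (ext2 R (D R)).flip (e R (b :: t)) ∘ₗ cone R a)
    (g := cone R (a, b) ∘ₗ ((ext2 R (D R)).flip (e R (b :: t)) +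
      (-1 : R) ^ n • (ext2 R (D R)).flip (e R t) ∘ₗ cone R a)) hc (by
        intro l hl
        simp [D_cons, hl.1])
  simpa using this

lemma D_cone_right (a : X) (s : List X) (b : Y) (c : Ch R Y) :
    ext2 R (D R) (e R (a :: s)) (cone R b c) =
      cone R (a, b) (ext2 R (D R) (e R s) (cone R b c) + (-1 : R) ^ s.length • ext2 R (D R) (e R (a :: s)) c) := by
  have := LinearMap.congr_fun (lin_ext (f := (ext2 R (D R)) (e R (a :: s)) ∘ₗ cone R b)
    (g := cone R (a, b) ∘ₗ ((ext2 R (D R)) (e R s) ∘ₗ cone R b +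
      (-1 : R) ^ s.length • (ext2 R (D R)) (e R (a :: s)))) (by
        intro l
        simp [D_cons])) c
  simpa using this

lemma ext2_D_nil_bdl (t : List Y) : ext R (D R ([] : List X)) (bdl R t) = 0 := by
  rcases t with _ | ⟨a, _ | ⟨b, _ | ⟨c, t⟩⟩⟩
  · simp
  · simp [bdl_cons, D_nil_left]
  · simp [bdl_cons, D_nil_left]
  · refine ext_zero_of (bdl_mem' _) ?_
    intro l hl
    rw [D_nil_left, if_neg]
    rw [hl.1]; simp

lemma bdl_mem_univ (l : List X) : bdl R l ∈ Sp R (L (l.length - 1) univ) :=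
  Sp_mono (L_mono (subset_univ _)) (bdl_mem' l)

lemma neg_one_pow_aux (n : ℕ) (hn : n ≠ 0) : (-1 : R) ^ (n - 1) = - (-1 : R) ^ n := by
  obtain ⟨m, rfl⟩ := Nat.exists_eq_succ_of_ne_zero hn
  simp [pow_succ]

lemma neg_one_sq (n : ℕ) : (-1 : R) ^ n * (-1 : R) ^ n = 1 := by
  rw [← mul_pow]; simp

theorem bd_D : ∀ (s : List X) (t : List Y), bd R (D R s t) =
    ext2 R (D R) (bdl R s) (e R t) + (-1 : R) ^ (s.length + 1) • ext2 R (D R) (e R s) (bdl R t)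
  | [], t => by
    simp only [bdl_nil, map_zero, LinearMap.zero_apply, zero_add, ext2_e_left]
    rw [ext2_D_nil_bdl, D_nil_left]; split_ifs <;> simp
  | a :: s, [] => by
    simp only [ext2_e_right, bdl_nil, map_zero, D_nil_right]
    simp
    exact (ext_zero_of (S := univ) (by simp) (by simp)).symm
  | a :: s, b :: t => by
    rw [D_cons, bd_cone, map_add, map_smul, bd_D s (b :: t), bd_D (a :: s) t]
    have e1 : ext2 R (D R) (bdl R (a :: s)) (e R (b :: t)) =
        D R s (b :: t) - cone R (a, b) (ext2 R (D R) (bdl R s) (e R (b :: t)) -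
          (-1 : R) ^ s.length • ext2 R (D R) (cone R a (bdl R s)) (e R t)) := by
      rw [bdl_cons, map_sub, LinearMap.sub_apply, D_cone_left a (bdl_mem_univ s) b t]
      simp only [ext2_e_left, ext_e]
      congr 1
      rcases s with _ | ⟨x, s⟩
      · simp
      · rw [neg_one_pow_aux _ (by simp)]; simp [sub_eq_add_neg]
    have e2 : ext2 R (D R) (e R (a :: s)) (bdl R (b :: t)) = D R (a :: s) t
        - cone R (a, b) (ext2 R (D R) (e R s) (cone R b (bdl R t)) +
          (-1 : R) ^ s.length • ext2 R (D R) (e R (a :: s)) (bdl R t)) := by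
      rw [bdl_cons, map_sub, D_cone_right]
      simp only [ext2_e_left, ext_e]
    have e3 : ext2 R (D R) (e R s) (bdl R (b :: t)) = D R s t - ext2 R (D R) (e R s) (cone R b (bdl R t)) := by
      rw [bdl_cons, map_sub]
      simp only [ext2_e_left, ext_e]
    have e4 : ext2 R (D R) (bdl R (a :: s)) (e R t) = D R s t - ext2 R (D R) (cone R a (bdl R s)) (e R t) := by
      rw [bdl_cons, map_sub, LinearMap.sub_apply]
      simp only [ext2_e_left, ext_e]
    rw [e1, e2, e3, e4]
    simp only [List.length_cons, pow_succ, map_add, map_sub, map_smul, smul_add, smul_sub, smul_smul,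
      mul_neg, mul_one, neg_mul, neg_smul, neg_one_sq, one_smul, neg_neg, map_neg, smul_neg]
    abel
termination_by s t => s.length + t.length

lemma D_mem {A : Set X} {B : Set Y} : ∀ (s : List X) (t : List Y), (∀ x ∈ s, x ∈ A) → (∀ x ∈ t, x ∈ B) →
    D R s t ∈ Sp R (L (s.length + t.length - 1) (A ×ˢ B))
  | [], t => by
    intro _ _
    rw [D_nil_left]; split_ifs with h
    · exact e_mem ⟨by simp [h], by simp⟩
    · simp
  | a :: s, [] => by simp
  | a :: s, b :: t => by
    intro hs ht
    rw [D_cons]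
    have h1 := D_mem s (b :: t) (fun x hx => hs x (List.mem_cons_of_mem _ hx)) ht
    have h2 := D_mem (a :: s) t hs (fun x hx => ht x (List.mem_cons_of_mem _ hx))
    have e0 : (a :: s).length + (b :: t).length - 1 = (s.length + t.length) + 1 := by simp only [List.length_cons]; omega
    have e1 : s.length + (b :: t).length - 1 = s.length + t.length := by simp; 
    have e2 : (a :: s).length + t.length - 1 = s.length + t.length := by simp [Nat.add_right_comm]
    rw [e0]; rw [e1] at h1; rw [e2] at h2
    exact cone_mem_L (Submodule.add_mem _ h1 (Submodule.smul_mem _ _ h2)) ⟨hs a (by simp), ht b (by simp)⟩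
termination_by s t => s.length + t.length

/-- Alexander-Whitney -/
def AW (b : List X → List Y → M) : List (X × Y) → M
  | [] => 0
  | a :: l => b [a.1] (a.2 :: l.map Prod.snd) + AW (fun s t => b (a.1 :: s) t) l

/-- boundary of a bifunction -/
noncomputable def pbd (R : Type*) [CommRing R] {X Y M : Type*} [AddCommGroup M] [Module R M]
    (b : List X → List Y → M) (s : List X) (t : List Y) : M :=
  ext2 R b (bdl R s) (e R t) + (-1 : R) ^ (s.length + 1) • ext2 R b (e R s) (bdl R t)

lemma AW_congr (l : List (X × Y)) : ∀ {b b' : List X → List Y → M},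
    (∀ s t, s ≠ [] → t ≠ [] → s.length + t.length = l.length + 1 →
      (∀ x ∈ s, x ∈ l.map Prod.fst) → (∀ x ∈ t, x ∈ l.map Prod.snd) → b s t = b' s t) →
    AW b l = AW b' l := by
  induction l with
  | nil => intros; rfl
  | cons a l ih =>
    intro b b' h
    simp only [AW]
    rw [h [a.1] (a.2 :: l.map Prod.snd) (by simp) (by simp) (by simp; omega) (by simp) (by simp)]
    congr 1
    refine ih ?_
    intro s t hs ht hst hs' ht'
    refine h _ _ (by simp) ht (by simp; omega) ?_ ?_
    · intro x hx
      rcases List.mem_cons.1 hx with rfl | hx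
      · simp
      · rw [List.map_cons]; exact List.mem_cons_of_mem _ (hs' x hx)
    · intro x hx
      rw [List.map_cons]; exact List.mem_cons_of_mem _ (ht' x hx)

lemma AW_add (l : List (X × Y)) : ∀ (b b' : List X → List Y → M),
    AW (fun s t => b s t + b' s t) l = AW b l + AW b' l := by
  induction l with
  | nil => intros; simp [AW]
  | cons a l ih => intro b b'; simp only [AW]; rw [ih]; abel

lemma AW_map {M' : Type*} [AddCommGroup M'] (g : M →+ M') (l : List (X × Y)) :
    ∀ (b : List X → List Y → M), AW (fun s t => g (b s t)) l = g (AW b l) := by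
  induction l with
  | nil => intros; simp [AW]
  | cons a l ih => intro b; simp only [AW]; rw [ih]; simp

lemma AW_mem {M : Type*} [AddCommGroup M] [Module R M] {N : Submodule R M} (l : List (X × Y)) :
    ∀ {b : List X → List Y → M},
    (∀ s t, s ≠ [] → t ≠ [] → s.length + t.length = l.length + 1 →
      (∀ x ∈ s, x ∈ l.map Prod.fst) → (∀ x ∈ t, x ∈ l.map Prod.snd) → b s t ∈ N) →
    AW b l ∈ N := by
  induction l with
  | nil => intros; simp [AW]
  | cons a l ih =>
    intro b h
    simp only [AW]
    refine Submodule.add_mem _ (h [a.1] (a.2 :: l.map Prod.snd) (by simp) (by simp) (by simp; omega) (by simp) (by simp)) ?_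
    refine ih ?_
    intro s t hs ht hst hs' ht'
    refine h _ _ (by simp) ht (by simp; omega) ?_ ?_
    · intro x hx
      rcases List.mem_cons.1 hx with rfl | hx
      · simp
      · rw [List.map_cons]; exact List.mem_cons_of_mem _ (hs' x hx)
    · intro x hx
      rw [List.map_cons]; exact List.mem_cons_of_mem _ (ht' x hx)

lemma AW_zero (l : List (X × Y)) : AW (fun _ _ => (0 : M)) l = 0 := by
  have := AW_map (0 : M →+ M) l (fun _ _ => (0 : M))
  simpa using this

lemma AW_zero_of (l : List (X × Y)) {b : List X → List Y → M}
    (h : ∀ s t, s ≠ [] → t ≠ [] → s.length + t.length = l.length + 1 →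
      (∀ x ∈ s, x ∈ l.map Prod.fst) → (∀ x ∈ t, x ∈ l.map Prod.snd) → b s t = 0) :
    AW b l = 0 := by
  rw [AW_congr l h, AW_zero]

lemma AW_sub (l : List (X × Y)) (b b' : List X → List Y → M) :
    AW (fun s t => b s t - b' s t) l = AW b l - AW b' l := by
  rw [eq_sub_iff_add_eq, ← AW_add]; simp

lemma bdl_map (f : X → Y) (l : List X) :
    ext R (fun l => e R (l.map f)) (bdl R l) = bdl R (l.map f) := by
  induction l with
  | nil => simp
  | cons a l ih =>
    rw [bdl_cons, map_sub, ext_e, List.map_cons, bdl_cons, ← ih]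
    congr 1
    have : ext R (fun l => e R (l.map f)) ∘ₗ cone R a = cone R (f a) ∘ₗ ext R (fun l => e R (l.map f)) :=
      lin_ext (by simp)
    exact LinearMap.congr_fun this _

theorem AW_bd (l : List (X × Y)) : ∀ (b : List X → List Y → M), (∀ s, b s [] = 0) →
    ext R (AW b) (bdl R l) = AW (pbd R b) l - b [] (l.map Prod.snd) := by
  induction l with
  | nil => intro b hb; simp [AW, hb]
  | cons a l ih =>
    intro b hb
    have h1 : ext R (AW b) (cone R a (bdl R l)) =
        ext R (b [a.1]) (cone R a.2 (bdl R (l.map Prod.snd))) +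
          ext R (AW (fun s t => b (a.1 :: s) t)) (bdl R l) := by
      rw [← bdl_map]
      have : ext R (AW b) ∘ₗ cone R a = ext R (b [a.1]) ∘ₗ cone R a.2 ∘ₗ
          ext R (fun l => e R (l.map Prod.snd)) + ext R (AW (fun s t => b (a.1 :: s) t)) :=
        lin_ext (by simp [AW])
      exact LinearMap.congr_fun this _
    have h2 : ext R (b [a.1]) (cone R a.2 (bdl R (l.map Prod.snd))) =
        b [a.1] (l.map Prod.snd) - ext R (b [a.1]) (bdl R (a.2 :: l.map Prod.snd)) := by
      rw [bdl_cons, map_sub]; simp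
    have h3 := ih (fun s t => b (a.1 :: s) t) (fun s => hb _)
    have h4 : AW (fun s t => pbd R b (a.1 :: s) t) l =
        AW b l - AW (pbd R (fun s t => b (a.1 :: s) t)) l := by
      rw [← AW_sub]
      congr 1
      ext s t
      simp only [pbd]
      have : ext2 R b (cone R a.1 (bdl R s)) (e R t) = ext2 R (fun s t => b (a.1 :: s) t) (bdl R s) (e R t) := by
        have : (ext2 R b).flip (e R t) ∘ₗ cone R a.1 = (ext2 R (fun s t => b (a.1 :: s) t)).flip (e R t) :=
          lin_ext (by simp)
        exact LinearMap.congr_fun this _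
      rw [bdl_cons, map_sub, LinearMap.sub_apply, this]
      simp [pow_succ]; abel
    rw [bdl_cons, map_sub, h1, h2, h3, ext_e]
    simp only [AW, h4, List.map_cons]
    have h5 : pbd R b [a.1] (a.2 :: l.map Prod.snd) = b [] (a.2 :: l.map Prod.snd) +
        ext R (b [a.1]) (bdl R (a.2 :: l.map Prod.snd)) := by
      simp [pbd, bdl_cons]
    rw [h5]
    abel

lemma AW_deg : ∀ {l : List (X × Y)}, Deg l → ∀ {b : List X → List Y → M},
    (∀ s t, Deg s → b s t = 0) → (∀ s t, Deg t → b s t = 0) → AW b l = 0 := by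
  rintro l ⟨l₁, a, l₂, rfl⟩
  induction l₁ with
  | nil =>
    intro b h1 h2
    simp only [List.nil_append, AW]
    rw [h2 _ _ (by simpa using Deg.two _ _), h1 _ _ (Deg.two _ _), AW_zero_of]
    · simp
    · intros; exact h1 _ _ (Deg.two _ _)
  | cons x l₁ ih =>
    intro b h1 h2
    simp only [List.cons_append, AW]
    rw [ih (fun s t hs => h1 _ _ (hs.cons _)) (fun s t ht => h2 _ _ ht), add_zero]
    refine h2 _ _ ?_
    exact Deg.cons (Deg.map ⟨l₁, a, l₂, rfl⟩ _) _

/-- second projection of chains -/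
noncomputable def psnd (R : Type*) [CommRing R] {X Y : Type*} : Ch R (X × Y) →ₗ[R] Ch R Y :=
  ext R (fun l => e R (l.map Prod.snd))

lemma psnd_cone (a : X × Y) (c : Ch R (X × Y)) : psnd R (cone R a c) = cone R a.2 (psnd R c) := by
  have : psnd R ∘ₗ cone R a = cone R a.2 ∘ₗ (psnd R : Ch R (X × Y) →ₗ[R] Ch R Y) := lin_ext (by simp [psnd])
  exact LinearMap.congr_fun this c

lemma psnd_D_one (a : X) : ∀ (t : List Y), t ≠ [] → psnd R (D R [a] t) = e R t
  | [b], _ => by rw [D_cons, psnd_cone]; simp [D_nil_left, psnd]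
  | b :: c :: t, _ => by
    rw [D_cons, psnd_cone, map_add, map_smul, psnd_D_one a (c :: t) (by simp)]
    simp [D_nil_left]

lemma psnd_D_head (s : List X) (hs : s ≠ []) (b : Y) (t : List Y) :
    psnd R (D R s (b :: t)) ∈ Sp R {l | ∃ l', l = b :: l'} := by
  obtain ⟨a, s, rfl⟩ := List.exists_cons_of_ne_nil hs
  rw [D_cons, psnd_cone]
  exact cone_mem (S := univ) (by simp) (by simp)

lemma psnd_D_deg (a a' : X) (s : List X) : ∀ (t : List Y),
    psnd R (D R (a :: a' :: s) t) ∈ Sp R {l | Deg l}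
  | [] => by simp
  | b :: t => by
    rw [D_cons, psnd_cone, map_add, map_add, map_smul, map_smul]
    refine Submodule.add_mem _ ?_ (Submodule.smul_mem _ _ ?_)
    · refine cone_mem (psnd_D_head (a' :: s) (by simp) b t) ?_
      rintro _ ⟨l, rfl⟩
      exact Deg.two _ _
    · exact cone_mem (psnd_D_deg a a' s t) (fun l hl => hl.cons _)

theorem AW_D_aux (n : ℕ) : ∀ (s : List X) (t : List Y), s.length + t.length = n →
    s ≠ [] → t ≠ [] → ∀ (b : List X → List Y → M),
    (∀ s t, Deg s → b s t = 0) → (∀ s t, Deg t → b s t = 0) →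
    ext R (AW b) (D R s t) = b s t := by
  induction n with
  | zero => intro s t hn hs; exfalso; apply hs; exact List.length_eq_zero_iff.1 (by omega)
  | succ n ih =>
    intro s0 t0 hn hs0 ht0 b h1 h2
    obtain ⟨a, s, rfl⟩ := List.exists_cons_of_ne_nil hs0
    obtain ⟨b', t, rfl⟩ := List.exists_cons_of_ne_nil ht0
    have hn1 : s.length + (b' :: t).length = n := by simp at hn ⊢; omega
    have hn2 : (a :: s).length + t.length = n := by simp at hn ⊢; omega
    have key : ∀ E : Ch R (X × Y), ext R (AW b) (cone R (a, b') E) =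
        ext R (b [a]) (cone R b' (psnd R E)) + ext R (AW (fun s t => b (a :: s) t)) E := by
      intro E
      have : ext R (AW b) ∘ₗ cone R (a, b') = ext R (b [a]) ∘ₗ cone R b' ∘ₗ
          psnd R + ext R (AW (fun s t => b (a :: s) t)) :=
        lin_ext (by simp [AW, psnd])
      exact LinearMap.congr_fun this E
    rw [D_cons, key]
    have hz : ext R (AW (fun s t => b (a :: s) t)) (D R (a :: s) t) = 0 := by
      rcases t with _ | ⟨b'', t⟩
      · simp
      · rw [ih (a :: s) (b'' :: t) hn2 (by simp) (by simp) _ (fun s t hs => h1 _ _ (hs.cons _))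
          (fun s t ht => h2 _ _ ht)]
        exact h1 _ _ (Deg.two _ _)
    rcases s with _ | ⟨a', s⟩
    · simp only [map_add, map_smul, hz]
      rcases t with _ | ⟨b'', t⟩
      · simp [D_nil_left, psnd, AW]
      · rw [psnd_D_one _ _ (by simp)]
        simp [D_nil_left]
    · rw [map_add (ext R (AW _)), map_smul, hz, smul_zero, add_zero,
        ih (a' :: s) (b' :: t) hn1 (by simp) (by simp) _ (fun s t hs => h1 _ _ (hs.cons _))
          (fun s t ht => h2 _ _ ht)]
      convert zero_add _
      rw [map_add, map_smul]
      refine ext_zero_of (S := {l | Deg l}) ?_ (fun l hl => h2 _ _ hl)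
      rw [map_add, map_smul]
      refine Submodule.add_mem _ ?_ (Submodule.smul_mem _ _ ?_)
      · refine cone_mem (psnd_D_head (a' :: s) (by simp) b' t) ?_
        rintro _ ⟨l, rfl⟩
        exact Deg.two _ _
      · exact cone_mem (psnd_D_deg a a' s t) (fun l hl => hl.cons _)

theorem AW_D (s : List X) (t : List Y) (hs : s ≠ []) (ht : t ≠ []) (b : List X → List Y → M)
    (h1 : ∀ s t, Deg s → b s t = 0) (h2 : ∀ s t, Deg t → b s t = 0) :
    ext R (AW b) (D R s t) = b s t := AW_D_aux _ s t rfl hs ht b h1 h2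

end prod
end MDP

namespace MDP

section chainmaps
variable {R : Type*} [CommRing R] {X Y V M : Type*} [AddCommGroup M] [Module R M]

/-- augmentation preserving chain maps -/
structure CM (R : Type*) [CommRing R] {X Y : Type*} (f : List X → Ch R Y) : Prop where
  nil : f [] = e R []
  chain : ∀ l, bd R (f l) = ext R f (bdl R l)
  len : ∀ l, f l ∈ Sp R (L l.length univ)

lemma ext_bd (u : List X → M) (c : Ch R X) : ext R u (bd R c) = ext R (fun l => ext R u (bdl R l)) c := by
  unfold bd; rw [map_ext]

lemma bd_ext2_D {n : ℕ} {c : Ch R X} (hc : c ∈ Sp R (L n univ)) (d : Ch R Y) :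
    bd R (ext2 R (D R) c d) = ext2 R (D R) (bd R c) d +
      (-1 : R) ^ (n + 1) • ext2 R (D R) c (bd R d) := by
  have h1 : ∀ t : List Y, bd R (ext2 R (D R) c (e R t)) = ext2 R (D R) (bd R c) (e R t) +
      (-1 : R) ^ (n + 1) • ext2 R (D R) c (bd R (e R t)) := by
    intro t
    have := lin_congr (f := bd R ∘ₗ (ext2 R (D R)).flip (e R t))
      (g := (ext2 R (D R)).flip (e R t) ∘ₗ bd R + (-1 : R) ^ (n + 1) •
        (ext2 R (D R)).flip (bd R (e R t))) hc (by
        intro s hs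
        have := bd_D (R := R) s t
        rw [hs.1] at this
        simpa using this)
    simpa using this
  have := LinearMap.congr_fun (lin_ext (f := bd R ∘ₗ (ext2 R (D R) c))
    (g := (ext2 R (D R)) (bd R c) + (-1 : R) ^ (n + 1) •
        (ext2 R (D R)) c ∘ₗ bd R) (fun t => by simpa using h1 t)) d
  simpa using this

/-- product of chain maps -/
noncomputable def TT {X' Y' : Type*} (r : List X → Ch R X') (r' : List Y → Ch R Y') :
    List (X × Y) → Ch R (X' × Y')
  | [] => e R []
  | a :: l => AW (fun s t => ext2 R (D R) (r s) (r' t)) (a :: l)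

lemma TT_cm {X' Y' : Type*} {r : List X → Ch R X'} {r' : List Y → Ch R Y'} (hr : CM R r) (hr' : CM R r') :
    CM R (TT r r') := by
  have hpbd : ∀ s t, pbd R (fun s t => ext2 R (D R) (r s) (r' t)) s t =
      bd R (ext2 R (D R) (r s) (r' t)) := by
    intro s t
    rw [bd_ext2_D (hr.len s), hr.chain, hr'.chain, pbd]
    congr 1
    · rw [ext2_e_right]
      exact (map_ext ((ext2 R (D R)).flip (r' t)) r (bdl R s)).symm
    · rw [ext2_e_left, map_ext]
  have hnil : ∀ s, ext2 R (D R) (r s) (r' []) = 0 := by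
    intro s
    rw [hr'.nil, ext2_e_right]
    exact ext_zero_of (S := univ) (by simp) (by simp)
  refine ⟨rfl, ?_, ?_⟩
  · intro l
    rcases l with _ | ⟨a, l⟩
    · simp [TT]
    have h1 := AW_bd (R := R) (a :: l) (fun s t => ext2 R (D R) (r s) (r' t)) hnil
    have h2 : bd R (TT r r' (a :: l)) = AW (pbd R (fun s t => ext2 R (D R) (r s) (r' t))) (a :: l) := by
      simp only [TT]
      rw [← LinearMap.toAddMonoidHom_coe, ← AW_map]
      congr 1
      ext1 s; ext1 t
      rw [hpbd]; rfl
    rw [h2, sub_eq_iff_eq_add.1 h1.symm]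
    rw [hr.nil, ext2_e_left]
    rcases l with _ | ⟨a', l⟩
    · simp only [bdl_cons, bdl_nil, map_zero, sub_zero, ext_e, AW, zero_add, TT, List.map_cons, List.map_nil]
      have : ext R (D R ([] : List X')) (r' [a.2]) =
          ext R (fun l => if l = [] then e R ([] : List (X' × Y')) else 0) (bd R (r' [a.2])) := by
        rw [ext_bd]
        refine ext_congr (hr'.len _) ?_
        rintro t ⟨ht, -⟩
        obtain ⟨y, rfl⟩ := List.length_eq_one_iff.1 ht
        rw [D_nil_left]; simp [bdl_cons]
      rw [this, hr'.chain]
      simp [bdl_cons, hr'.nil]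
    · have : ext R (D R ([] : List X')) (r' (List.map Prod.snd (a :: a' :: l))) = 0 := by
        refine ext_zero_of (hr'.len _) ?_
        rintro t ⟨ht, -⟩
        rw [D_nil_left, if_neg]
        rw [ht]; simp
      rw [this, add_zero]
      refine ext_congr (bdl_mem' _) ?_
      rintro l' ⟨hl', -⟩
      rcases l' with _ | ⟨b, l'⟩
      · simp at hl'
      · rfl
  · intro l
    rcases l with _ | ⟨a, l⟩
    · exact e_mem ⟨rfl, by simp⟩
    refine AW_mem _ ?_
    intro s t hs ht hst _ _
    refine ext2_mem (hr.len s) (hr'.len t) ?_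
    intro s' hs' t' ht'
    have := D_mem (R := R) (A := univ) (B := univ) s' t' (by simp) (by simp)
    rw [hs'.1, ht'.1, hst] at this
    simpa using this

lemma TT_mem {X' Y' : Type*} {r : List X → Ch R X'} {r' : List Y → Ch R Y'} {C : List X → Set X'} {C' : List Y → Set Y'}
    (hr : ∀ l, r l ∈ Sp R (L l.length (C l))) (hr' : ∀ l, r' l ∈ Sp R (L l.length (C' l)))
    (hC : ∀ l l' : List X, (∀ x ∈ l', x ∈ l) → C l' ⊆ C l)
    (hC' : ∀ l l' : List Y, (∀ x ∈ l', x ∈ l) → C' l' ⊆ C' l) (l : List (X × Y)) :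
    TT r r' l ∈ Sp R (L l.length (C (l.map Prod.fst) ×ˢ C' (l.map Prod.snd))) := by
  rcases l with _ | ⟨a, l⟩
  · exact e_mem ⟨rfl, by simp⟩
  refine AW_mem _ ?_
  intro s t hs ht hst h1 h2
  refine ext2_mem (hr s) (hr' t) ?_
  intro s' hs' t' ht'
  have := D_mem (R := R) s' t' (fun x hx => hC _ _ h1 (hs'.2 x hx)) (fun x hx => hC' _ _ h2 (ht'.2 x hx))
  rw [hs'.1, ht'.1, hst] at this
  simpa using this

/-- simplicial approximation chain map -/
noncomputable def rr (R : Type*) [CommRing R] {X V : Type*} [LinearOrder V] (v : X → V) (p : V → X)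
    (l : List X) : Ch R X := ext R (fun s => e R (s.map p)) (srt R (l.map v))

variable [LinearOrder V] (v : X → V) (p : V → X)

lemma bd_map (f : X → Y) (c : Ch R X) :
    bd R (ext R (fun l => e R (l.map f)) c) = ext R (fun l => e R (l.map f)) (bd R c) := by
  have : bd R ∘ₗ (ext R (fun l => e R (l.map f))) = ext R (fun l => e R (l.map f)) ∘ₗ bd R :=
    lin_ext (by intro l; simp [bdl_map])
  exact LinearMap.congr_fun this c

lemma srt_map_bd (l : List X) : bd R (srt R (l.map v)) = ext R (fun l => srt R (l.map v)) (bdl R l) := by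
  rw [bd_srt, ← bdl_map, map_ext]; simp

lemma srt_map_mem (l : List X) : srt R (l.map v) ∈ Sp R (SL l.length {x | x ∈ l.map v}) := by
  have := srt_mem (R := R) (l := l.map v)
  simpa using this

lemma rr_mem (l : List X) : rr R v p l ∈ Sp R (L l.length {x | ∃ y ∈ l, x = p (v y)}) := by
  refine ext_mem (srt_map_mem v l) ?_
  rintro s ⟨-, hs1, hs2⟩
  refine e_mem ⟨by simp [hs1], ?_⟩
  intro x hx
  obtain ⟨i, hi, rfl⟩ := List.mem_map.1 hx
  obtain ⟨y, hy, rfl⟩ := List.mem_map.1 (hs2 i hi)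
  exact ⟨y, hy, rfl⟩

lemma rr_cm : CM R (rr R v p) := by
  refine ⟨by simp [rr, srt], ?_, fun l => Sp_mono (L_mono (subset_univ _)) (rr_mem v p l)⟩
  intro l
  unfold rr
  rw [bd_map, srt_map_bd, map_ext]

lemma rr_deg {l : List X} (h : Deg l) : rr R v p l = 0 := by
  rw [rr, srt_deg (h.map v)]; simp

/-- carrier -/
def Car (v : X → V) (p : V → X) (l : List X) : Set X := {x | x ∈ l ∨ ∃ y ∈ l, x = p (v y)}

lemma Car_mono (l l' : List X) (h : ∀ x ∈ l', x ∈ l) : Car v p l' ⊆ Car v p l := by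
  rintro x (hx | ⟨y, hy, rfl⟩)
  · exact Or.inl (h x hx)
  · exact Or.inr ⟨y, h y hy, rfl⟩

lemma rr_htpy : ∃ h : List X → Ch R X,
    (∀ l, bd R (h l) + ext R h (bdl R l) = e R l - rr R v p l) ∧
      ∀ l, h l ∈ Sp R (L (l.length + 1) (Car v p l)) := by
  refine exists_htpy _ (Car v p) (rr_cm v p).nil (rr_cm v p).chain ?_ ?_ (Car_mono v p)
  · exact fun l => Sp_mono (L_mono (fun x hx => Or.inr hx)) (rr_mem v p l)
  · exact fun l x hx => Or.inl hx

/-- cocycle comparison -/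
lemma cocycle_htpy (u : List X → M) {f h : List X → Ch R X} {l : List X}
    (hh : bd R (h l) + ext R h (bdl R l) = e R l - f l) {S : Set (List X)}
    (hS : h l ∈ Sp R S) (hu : ∀ l ∈ S, ext R u (bdl R l) = 0) :
    u l = ext R u (f l) + ext R (fun l => ext R u (h l)) (bdl R l) := by
  have := congrArg (ext R u) hh
  rw [map_add, map_sub, ext_bd, ext_zero_of hS hu, map_ext, ext_e, zero_add] at this
  rw [this]; abel

end chainmaps

section metric
variable {X Y : Type*} [MetricSpace X] [MetricSpace Y]

/-- small lists -/
def Small (ε : ℝ) (l : List X) : Prop := ∀ x ∈ l, ∀ y ∈ l, dist x y < ε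

/-- lists near a point of `A` -/
def NearAll (ε : ℝ) (A : Set X) (l : List X) : Prop := ∃ a ∈ A, ∀ y ∈ l, dist a y < ε

/-- finite open covers of small mesh and bounded multiplicity -/
def Cov (X : Type*) [MetricSpace X] (k : ℕ) (δ : ℝ) : Prop :=
  ∃ (N : ℕ) (U : Fin N → Set X), (∀ i, IsOpen (U i)) ∧ (∀ x, ∃ i, x ∈ U i) ∧
    (∀ i, ∀ x ∈ U i, ∀ y ∈ U i, dist x y < δ) ∧
    ∀ s : Finset (Fin N), (∃ x, ∀ i ∈ s, x ∈ U i) → s.card ≤ k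

/-- dimension bound -/
def DimLE (X : Type*) [MetricSpace X] (q : ℕ) : Prop := ∀ δ > 0, Cov X (q + 1) δ

lemma Small.mono {ε ε' : ℝ} (h : ε ≤ ε') {l : List X} (hl : Small ε l) : Small ε' l :=
  fun x hx y hy => (hl x hx y hy).trans_le h

lemma Small.sub {ε : ℝ} {l l' : List X} (hl : Small ε l) (h : ∀ x ∈ l', x ∈ l) : Small ε l' :=
  fun x hx y hy => hl x (h x hx) y (h y hy)

lemma NearAll.mono {ε ε' : ℝ} (h : ε ≤ ε') {A : Set X} {l : List X} (hl : NearAll ε A l) : NearAll ε' A l := by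
  obtain ⟨a, ha, h'⟩ := hl
  exact ⟨a, ha, fun y hy => (h' y hy).trans_le h⟩

lemma NearAll.sub {ε : ℝ} {A : Set X} {l l' : List X} (hl : NearAll ε A l) (h : ∀ x ∈ l', x ∈ l) : NearAll ε A l' := by
  obtain ⟨a, ha, h'⟩ := hl
  exact ⟨a, ha, fun y hy => h' y (h y hy)⟩

lemma exists_Cov [CompactSpace X] {δ : ℝ} (hδ : 0 < δ) : ∃ k, Cov X k δ := by
  classical
  obtain ⟨t, ht⟩ := CompactSpace.elim_nhds_subcover (X := X) (fun x => Metric.ball x (δ/2))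
    (fun x => Metric.ball_mem_nhds x (by positivity))
  have eqv := t.equivFin
  refine ⟨t.card, t.card, fun i => Metric.ball ((eqv.symm i : t) : X) (δ/2), fun i => Metric.isOpen_ball, ?_, ?_, ?_⟩
  · intro x
    have : x ∈ ⋃ y ∈ t, Metric.ball y (δ/2) := by
      have h := mem_univ x
      rw [← Set.top_eq_univ, ← ht] at h
      exact h
    simp only [mem_iUnion] at this
    obtain ⟨y, hy, hxy⟩ := this
    exact ⟨eqv ⟨y, hy⟩, by simpa using hxy⟩
  · intro i x hx y hy
    have := dist_triangle_right x y ((eqv.symm i : t) : X)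
    rw [Metric.mem_ball] at hx hy
    linarith
  · intro s _
    simpa using Finset.card_le_univ s

lemma exists_approx [CompactSpace X] [Nonempty X] {k : ℕ} {δ : ℝ} (h : Cov X k δ) (B : Set X) :
    ∃ (N : ℕ) (v : X → Fin N) (p : Fin N → X) (ε' : ℝ), 0 < ε' ∧ (∀ x, dist x (p (v x)) < δ) ∧
      (∀ x ∈ B, p (v x) ∈ B) ∧ ∀ l : List X, l ≠ [] → Small ε' l → ∀ s : List (Fin N),
        s.Pairwise (· < ·) → (∀ i ∈ s, i ∈ l.map v) → s.length ≤ k := by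
  classical
  obtain ⟨N, U, hU, hc, hm, ho⟩ := h
  obtain ⟨ε', hε', hL⟩ := lebesgue_number_lemma_of_metric (s := (univ : Set X)) isCompact_univ hU
    (fun x _ => mem_iUnion.2 (hc x))
  choose v hv using fun x => hL x (mem_univ x)
  have hvx : ∀ x, x ∈ U (v x) := fun x => hv x (Metric.mem_ball_self hε')
  have hp : ∀ i, ∃ y, ((U i ∩ B).Nonempty → y ∈ U i ∩ B) ∧ ((U i).Nonempty → y ∈ U i) := by
    intro i
    by_cases h1 : (U i ∩ B).Nonempty
    · obtain ⟨y, hy⟩ := h1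
      exact ⟨y, fun _ => hy, fun _ => hy.1⟩
    · by_cases h2 : (U i).Nonempty
      · obtain ⟨y, hy⟩ := h2
        exact ⟨y, fun h => absurd h h1, fun _ => hy⟩
      · exact ⟨Classical.arbitrary X, fun h => absurd h h1, fun h => absurd h h2⟩
  choose p hp1 hp2 using hp
  refine ⟨N, v, p, ε', hε', ?_, ?_, ?_⟩
  · exact fun x => hm (v x) x (hvx x) _ (hp2 _ ⟨x, hvx x⟩)
  · exact fun x hx => (hp1 (v x) ⟨x, hvx x, hx⟩).2
  · intro l hl hs s hs1 hs2
    obtain ⟨x0, l', rfl⟩ := List.exists_cons_of_ne_nil hl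
    have hnd : s.Nodup := hs1.imp (fun h => ne_of_lt h)
    rw [← List.toFinset_card_of_nodup hnd]
    refine ho _ ⟨x0, ?_⟩
    intro i hi
    obtain ⟨y, hy, rfl⟩ := List.mem_map.1 (hs2 i (List.mem_toFinset.1 hi))
    exact hv y (by rw [Metric.mem_ball]; exact hs x0 (by simp) y hy)

lemma Car_small {N : ℕ} {v : X → Fin N} {p : Fin N → X} {δ ε ε₁ : ℝ} (hp : ∀ x, dist x (p (v x)) < δ)
    {l : List X} (hl : Small ε l) (h : ε + 2 * δ ≤ ε₁) (hδ : 0 < δ) {l' : List X} (hl' : ∀ x ∈ l', x ∈ Car v p l) :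
    Small ε₁ l' := by
  have key : ∀ x ∈ l', ∃ y ∈ l, dist x y < δ := by
    intro x hx
    rcases hl' x hx with hx | ⟨y, hy, rfl⟩
    · exact ⟨x, hx, by simpa using hδ⟩
    · exact ⟨y, hy, by rw [dist_comm]; exact hp y⟩
  intro x hx y hy
  obtain ⟨x', hx', h1⟩ := key x hx
  obtain ⟨y', hy', h2⟩ := key y hy
  have h3 := hl x' hx' y' hy'
  have h4 := dist_triangle4 x x' y' y
  rw [dist_comm y' y] at h4
  linarith

lemma Car_near {N : ℕ} {v : X → Fin N} {p : Fin N → X} {δ ε ε₁ : ℝ} (hp : ∀ x, dist x (p (v x)) < δ)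
    {l : List X} {A : Set X} (hl : NearAll ε A l) (h : ε + δ ≤ ε₁) (hδ : 0 < δ) {l' : List X} (hl' : ∀ x ∈ l', x ∈ Car v p l) :
    NearAll ε₁ A l' := by
  obtain ⟨a, ha, hl⟩ := hl
  refine ⟨a, ha, ?_⟩
  intro x hx
  rcases hl' x hx with hx | ⟨y, hy, rfl⟩
  · have := hl x hx; linarith
  · have := hl y hy
    have := hp y
    have := dist_triangle a y (p (v y))
    linarith

variable {R : Type*} [CommRing R]

lemma rr_zero {N : ℕ} {v : X → Fin N} {l : List X} {k : ℕ}
    (h : ∀ s : List (Fin N), s.Pairwise (· < ·) → (∀ i ∈ s, i ∈ l.map v) → s.length ≤ k) (hk : k < l.length) :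
    srt R (l.map v) = 0 := by
  have h1 := srt_map_mem (R := R) v l
  have : SL l.length {x | x ∈ l.map v} = ∅ := by
    ext s
    simp only [mem_empty_iff_false, iff_false]
    rintro ⟨h1, h2, h3⟩
    have := h s h1 h3
    omega
  rw [this] at h1
  simpa using h1

/-- (a) -/
theorem vanish_of_cov [CompactSpace X] [Nonempty X] {m k : ℕ} {ε δ : ℝ} (hε : 0 < ε) (hδ : 0 < δ) (hδε : 3 * δ ≤ ε) (hk : k < m)
    (hC : Cov X k δ) (u : List X → R) (B : Set X)
    (hu : ∀ l, Small ε l → l.length = m + 1 → ext R u (bdl R l) = 0)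
    (huB : ∀ l, Small ε l → l.length = m → (∀ x ∈ l, x ∈ B) → u l = 0) :
    ∃ ε' > 0, ∃ c : List X → R, (∀ l, Small ε' l → l.length = m → ext R c (bdl R l) = u l) ∧
      ∀ l, Small ε' l → l.length + 1 = m → (∀ x ∈ l, x ∈ B) → c l = 0 := by
  obtain ⟨N, v, p, ε₁, hε₁, hp, hB, hs⟩ := exists_approx hC B
  obtain ⟨h, h1, h2⟩ := rr_htpy (R := R) v p
  refine ⟨min ε₁ δ, by positivity, fun l => ext R u (h l), ?_, ?_⟩
  · intro l hl hlen
    have hne : l ≠ [] := by rintro rfl; simp at hlen; omega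
    have := cocycle_htpy u (h1 l) (h2 l) (by
      rintro l' ⟨hl', hl''⟩
      refine hu l' (Car_small hp hl ?_ hδ hl'') (by omega)
      have := min_le_right ε₁ δ
      linarith)
    rw [rr, rr_zero (hs l hne (hl.mono (min_le_left _ _))) (by omega), map_zero, map_zero, zero_add] at this
    exact this.symm
  · intro l hl hlen hlB
    refine ext_zero_of (h2 l) ?_
    rintro l' ⟨hl', hl''⟩
    refine huB l' (Car_small hp hl ?_ hδ hl'') (by omega) ?_
    · have := min_le_right ε₁ δ
      linarith
    · intro x hx
      rcases hl'' x hx with hx | ⟨y, hy, rfl⟩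
      · exact hlB x hx
      · exact hB _ (hlB y hy)

/-- vanishing of relative cohomology in degree `q` for all closed pairs -/
def Van (X : Type*) [MetricSpace X] (R : Type*) [CommRing R] (q : ℕ) : Prop :=
  ∀ (A : Set X) (u : List X → R) (ε : ℝ), 0 < ε →
    (∀ l, Small ε l → l.length = q + 2 → ext R u (bdl R l) = 0) →
    (∀ l, Small ε l → l.length = q + 1 → NearAll ε A l → u l = 0) →
    ∃ ε' > 0, ∃ c : List X → R, (∀ l, Small ε' l → l.length = q + 1 → ext R c (bdl R l) = u l) ∧
      ∀ l, Small ε' l → l.length = q → NearAll ε' A l → c l = 0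

lemma exists_factor {F V W : Type*} [Field F] [AddCommGroup V] [Module F V] [AddCommGroup W] [Module F W]
    (f : V →ₗ[F] W) (φ : V →ₗ[F] F) (h : LinearMap.ker f ≤ LinearMap.ker φ) : ∃ g : W →ₗ[F] F, g ∘ₗ f = φ := by
  have : φ ∈ LinearMap.range f.dualMap := by
    rw [LinearMap.range_dualMap_eq_dualAnnihilator_ker f, Submodule.mem_dualAnnihilator]
    exact fun w hw => h hw
  exact this

lemma dual_alt_abs {F V : Type*} [Field F] [AddCommGroup V] [Module F V]
    (S Z : Submodule F V) (b : V →ₗ[F] V) (φ : V →ₗ[F] F) :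
    (∃ z ∈ S, φ z = 1 ∧ b z ∈ Z) ∨ ∃ g : V →ₗ[F] F, (∀ x ∈ Z, g x = 0) ∧ ∀ x ∈ S, g (b x) = φ x := by
  by_cases hker : LinearMap.ker (Z.mkQ ∘ₗ b ∘ₗ S.subtype) ≤ LinearMap.ker (φ ∘ₗ S.subtype)
  · right
    obtain ⟨g, hg⟩ := exists_factor _ _ hker
    refine ⟨g ∘ₗ Z.mkQ, ?_, ?_⟩
    · intro x hx
      have : Z.mkQ x = 0 := by
        rw [Submodule.mkQ_apply, Submodule.Quotient.mk_eq_zero]; exact hx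
      rw [LinearMap.comp_apply, this, map_zero]
    · intro x hx
      exact LinearMap.congr_fun hg ⟨x, hx⟩
  · left
    rw [SetLike.not_le_iff_exists] at hker
    obtain ⟨⟨z, hz⟩, h1, h2⟩ := hker
    have h1' : b z ∈ Z := by
      have : Z.mkQ (b z) = 0 := h1
      rwa [Submodule.mkQ_apply, Submodule.Quotient.mk_eq_zero] at this
    have h2' : φ z ≠ 0 := h2
    refine ⟨(φ z)⁻¹ • z, Submodule.smul_mem _ _ hz, ?_, ?_⟩
    · rw [map_smul, smul_eq_mul, inv_mul_cancel₀ h2']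
    · rw [map_smul]; exact Submodule.smul_mem _ _ h1'

theorem dual_alt {F : Type*} [Field F] {X : Type*} (S Z : Set (List X)) (u : List X → F) :
    (∃ z ∈ Sp F S, ext F u z = 1 ∧ bd F z ∈ Sp F Z) ∨
      ∃ c : List X → F, (∀ l ∈ Z, c l = 0) ∧ ∀ l ∈ S, ext F c (bdl F l) = u l := by
  rcases dual_alt_abs (Sp F S) (Sp F Z) (bd F) (ext F u) with h | ⟨g, hg1, hg2⟩
  · exact Or.inl h
  · right
    refine ⟨fun l => g (e F l), fun l hl => hg1 _ (e_mem hl), ?_⟩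
    intro l hl
    rw [← lin_eq_ext]
    have := hg2 _ (e_mem hl)
    simpa using this

/-- essential cocycles over a field -/
structure Coc (F : Type*) [Field F] {X : Type*} [MetricSpace X] (m : ℕ) (ε : ℝ) (u : List X → F)
    (B : Set X) : Prop where
  pos : 0 < ε
  cocy : ∀ l, Small ε l → ext F u (bdl F l) = 0
  rel : ∀ l, Small ε l → NearAll ε B l → u l = 0
  deg : ∀ l, Deg l → u l = 0
  len : ∀ l, l.length ≠ m + 1 → u l = 0
  per : ∀ ε' > 0, ∃ z ∈ Sp F {l : List X | Small ε' l ∧ l.length = m + 1}, ext F u z = 1 ∧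
    bd F z ∈ Sp F {l : List X | ∀ x ∈ l, x ∈ B}

variable {F : Type*} [Field F]

lemma Small.fst {ε : ℝ} {l : List (X × Y)} (h : Small ε l) : Small ε (l.map Prod.fst) := by
  intro x' hx' y' hy'
  obtain ⟨x, hx, rfl⟩ := List.mem_map.1 hx'
  obtain ⟨y, hy, rfl⟩ := List.mem_map.1 hy'
  exact (le_max_left _ _).trans_lt (h x hx y hy)

lemma Small.snd {ε : ℝ} {l : List (X × Y)} (h : Small ε l) : Small ε (l.map Prod.snd) := by
  intro x' hx' y' hy'
  obtain ⟨x, hx, rfl⟩ := List.mem_map.1 hx'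
  obtain ⟨y, hy, rfl⟩ := List.mem_map.1 hy'
  exact (le_max_right _ _).trans_lt (h x hx y hy)

lemma Small.prod {ε : ℝ} {s : List X} {t : List Y} (hs : Small ε s) (ht : Small ε t) {l : List (X × Y)}
    (h : ∀ x ∈ l, x ∈ {x | x ∈ s} ×ˢ {x | x ∈ t}) : Small ε l := by
  intro x hx y hy
  exact max_lt (hs _ (h x hx).1 _ (h y hy).1) (ht _ (h x hx).2 _ (h y hy).2)

lemma pbd_mul (u : List X → R) (v : List Y → R) (s : List X) (t : List Y) :
    pbd R (fun s t => u s * v t) s t = ext R u (bdl R s) * v t +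
      (-1 : R) ^ (s.length + 1) * (u s * ext R v (bdl R t)) := by
  rw [pbd, ext2_e_right, ext2_e_left]
  congr 1
  · have := map_ext (LinearMap.mulRight R (v t)) u (bdl R s)
    simpa using this.symm
  · have := map_ext (LinearMap.mulLeft R (u s)) v (bdl R t)
    rw [smul_eq_mul]
    congr 1
    simpa using this.symm

theorem Coc.prod {m m' : ℕ} {ε : ℝ} {u : List X → F} {u' : List Y → F} {B : Set X} {B' : Set Y}
    (h : Coc F m ε u B) (h' : Coc F m' ε u' B') :
    Coc F (m + m') ε (AW fun s t => u s * u' t) {x : X × Y | x.1 ∈ B ∨ x.2 ∈ B'} where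
  pos := h.pos
  cocy := by
    intro l hl
    rw [AW_bd _ _ (by intro s; rw [h'.len _ (by simp), mul_zero])]
    rw [h.len [] (by simp), zero_mul, sub_zero]
    refine AW_zero_of _ ?_
    intro s t _ _ _ hs ht
    rw [pbd_mul, h.cocy s (hl.fst.sub hs), h'.cocy t (hl.snd.sub ht)]
    simp
  rel := by
    rintro l hl ⟨a, ha, hal⟩
    refine AW_zero_of _ ?_
    intro s t _ _ _ hs ht
    rcases ha with ha | ha
    · rw [h.rel s (hl.fst.sub hs) ⟨a.1, ha, ?_⟩, zero_mul]
      intro y hy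
      obtain ⟨y, hy', rfl⟩ := List.mem_map.1 (hs y hy)
      exact (le_max_left _ _).trans_lt (hal y hy')
    · rw [h'.rel t (hl.snd.sub ht) ⟨a.2, ha, ?_⟩, mul_zero]
      intro y hy
      obtain ⟨y, hy', rfl⟩ := List.mem_map.1 (ht y hy)
      exact (le_max_right _ _).trans_lt (hal y hy')
  deg := by
    intro l hl
    refine AW_deg hl ?_ ?_
    · intro s t hs; rw [h.deg s hs, zero_mul]
    · intro s t hs; rw [h'.deg t hs, mul_zero]
  len := by
    intro l hl
    refine AW_zero_of _ ?_
    intro s t _ _ hst _ _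
    by_cases h1 : s.length = m + 1
    · rw [h'.len t (by omega), mul_zero]
    · rw [h.len s h1, zero_mul]
  per := by
    intro ε' hε'
    obtain ⟨z, hz1, hz2, hz3⟩ := h.per ε' hε'
    obtain ⟨z', hz1', hz2', hz3'⟩ := h'.per ε' hε'
    refine ⟨ext2 F (D F) z z', ?_, ?_, ?_⟩
    · refine ext2_mem hz1 hz1' ?_
      intro s hs t ht
      refine Sp_mono ?_ (D_mem (A := {x | x ∈ s}) (B := {x | x ∈ t}) s t (fun _ h => h) (fun _ h => h))
      rintro l ⟨hl1, hl2⟩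
      refine ⟨hs.1.prod ht.1 hl2, ?_⟩
      rw [hl1, hs.2, ht.2]; omega
    · rw [map_ext2, ext2_congr (b' := fun s t => u s * u' t) hz1 hz1']
      · rw [ext2_eq]
        have e1 : ∀ s, ext F (fun t => u s * u' t) z' = u s := by
          intro s
          have := map_ext (LinearMap.mulLeft F (u s)) u' z'
          simp only [LinearMap.mulLeft_apply] at this
          rw [← this, hz2', mul_one]
        simp only [e1]
        exact hz2
      · intro s hs t ht
        refine AW_D s t ?_ ?_ _ ?_ ?_
        · rintro rfl; have := hs.2; simp at this
        · rintro rfl; have := ht.2; simp at this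
        · intro s t hs; rw [h.deg s hs, zero_mul]
        · intro s t hs; rw [h'.deg t hs, mul_zero]
    · have hz0 : z ∈ Sp F (L (m + 1) univ) := by
        refine Sp_mono ?_ hz1
        exact fun l hl => ⟨hl.2, by simp⟩
      rw [bd_ext2_D hz0]
      refine Submodule.add_mem _ ?_ (Submodule.smul_mem _ _ ?_)
      · refine ext2_mem hz3 (d := z') (T := univ) (by simp) ?_
        intro s hs t _
        refine Sp_mono ?_ (D_mem (A := B) (B := univ) s t hs (by simp))
        exact fun l hl x hx => Or.inl (hl.2 x hx).1
      · refine ext2_mem (S := univ) (by simp) hz3' ?_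
        intro s _ t ht
        refine Sp_mono ?_ (D_mem (A := univ) (B := B') s t (by simp) ht)
        exact fun l hl x hx => Or.inr (hl.2 x hx).2

theorem Coc.not_cov [CompactSpace X] [Nonempty X] {m k : ℕ} {ε δ : ℝ} {u : List X → F} {B : Set X} (h : Coc F m ε u B)
    (hδ : 0 < δ) (hδε : 3 * δ ≤ ε) (hk : k ≤ m) : ¬ Cov X k δ := by
  intro hC
  obtain ⟨ε', hε', c, hc1, hc2⟩ := vanish_of_cov (m := m + 1) h.pos hδ hδε (by omega) hC u B
    (fun l hl _ => h.cocy l hl) (by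
      intro l hl hlen hB
      refine h.rel l hl ?_
      rcases l with _ | ⟨a, l⟩
      · simp at hlen
      · exact ⟨a, hB a (by simp), fun y hy => hl a (by simp) y hy⟩)
  obtain ⟨z, hz1, hz2, hz3⟩ := h.per ε' hε'
  have h1 : ext F u z = ext F c (bd F z) := by
    rw [ext_bd]
    exact ext_congr hz1 fun l hl => (hc1 l hl.1 hl.2).symm
  have h2 : bd F z ∈ Sp F {l : List X | Small ε' l ∧ l.length = m} := by
    refine ext_mem hz1 ?_
    intro l hl
    refine Sp_mono ?_ (bdl_mem' l)
    rintro l' ⟨h1, h2⟩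
    refine ⟨hl.1.sub h2, ?_⟩
    rw [h1, hl.2]; simp
  have h3 : bd F z ∈ Sp F ({l : List X | Small ε' l ∧ l.length = m} ∩ {l : List X | ∀ x ∈ l, x ∈ B}) := by
    rw [Sp, Finsupp.supported_inter]
    exact ⟨h2, hz3⟩
  rw [ext_zero_of h3 (fun l hl => hc2 l hl.1.1 (by rw [hl.1.2]) hl.2)] at h1
  rw [hz2] at h1
  exact one_ne_zero h1

theorem exists_Coc [CompactSpace X] [Nonempty X] {q : ℕ} (h : ¬ Van X F q) : ∃ ε u B, Coc F (X := X) q ε u B := by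
  unfold Van at h
  push Not at h
  obtain ⟨A, u, ε, hε, h1, h2, h3⟩ := h
  obtain ⟨k, hk⟩ := exists_Cov (X := X) (δ := ε/8) (by positivity)
  obtain ⟨N, v, p, ε₁, hε₁, hp, -, -⟩ := exists_approx hk ∅
  obtain ⟨h, hh1, hh2⟩ := rr_htpy (R := F) v p
  have hrC : ∀ l, rr F v p l ∈ Sp F (L l.length (Car v p l)) := fun l =>
    Sp_mono (L_mono (fun x hx => Or.inr hx)) (rr_mem v p l)
  set B : Set X := {x | ∃ a ∈ A, dist a x < ε/8} with hB
  set w : List X → F := fun l => if l.length = q + 1 then ext F u (rr F v p l) else 0 with hw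
  refine ⟨ε/8, w, B, by positivity, ?_, ?_, ?_, ?_, ?_⟩
  · intro l hl
    rcases l with _ | ⟨a, l⟩
    · simp
    by_cases hlen : (a :: l).length = q + 2
    · rw [ext_congr (g := fun l => ext F u (rr F v p l)) (bdl_mem' (a :: l))]
      · rw [← map_ext, ← (rr_cm v p).chain, ext_bd]
        refine ext_zero_of (hrC _) ?_
        intro l' hl'
        exact h1 l' (Car_small hp hl (by linarith) (by positivity) hl'.2) (by rw [hl'.1, hlen])
      · intro l' hl'
        simp only [hw]
        rw [if_pos]
        rw [hl'.1, hlen]; rfl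
    · refine ext_zero_of (bdl_mem' (a :: l)) ?_
      intro l' hl'
      simp only [hw]
      rw [if_neg]
      rw [hl'.1]; simp at hlen ⊢; omega
  · rintro l hl ⟨b, ⟨a, ha, hab⟩, hb⟩
    simp only [hw]
    split_ifs with hlen
    swap; · rfl
    refine ext_zero_of (hrC _) ?_
    intro l' hl'
    refine h2 l' (Car_small hp hl (by linarith) (by positivity) hl'.2) (by rw [hl'.1, hlen]) ?_
    refine Car_near hp (ε := ε/4) (l := l) ⟨a, ha, ?_⟩ (by linarith) (by positivity) hl'.2
    intro y hy
    have := hb y hy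
    have := dist_triangle a b y
    linarith
  · intro l hl
    simp only [hw]
    rw [rr_deg v p hl]; simp
  · intro l hl
    simp only [hw]
    rw [if_neg hl]
  · intro ε' hε'
    have hε₂ : 0 < min ε' (ε/8) := by positivity
    rcases dual_alt {l : List X | Small (min ε' (ε/8)) l ∧ l.length = q + 1} {l : List X | ∀ x ∈ l, x ∈ B} w with
      ⟨z, hz1, hz2⟩ | ⟨c, hc1, hc2⟩
    · refine ⟨z, Sp_mono ?_ hz1, hz2⟩
      exact fun l hl => ⟨hl.1.mono (min_le_left _ _), hl.2⟩
    exfalso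
    obtain ⟨l, hl1, hl2, hl3, hl4⟩ := h3 (min ε' (ε/8)) hε₂ (fun l => c l + ext F u (h l)) (by
      intro l hl hlen
      rw [ext_add, hc2 l ⟨hl, hlen⟩]
      simp only [hw, if_pos hlen]
      refine (cocycle_htpy u (hh1 l) (hh2 l) ?_).symm
      intro l' hl'
      refine h1 l' (Car_small hp hl ?_ (by positivity) hl'.2) (by rw [hl'.1, hlen])
      have := min_le_right ε' (ε/8)
      linarith)
    apply hl4
    obtain ⟨a, ha, hl3⟩ := hl3
    have hm := min_le_right ε' (ε/8)
    rw [hc1 l (fun x hx => ⟨a, ha, (hl3 x hx).trans_le hm⟩), zero_add]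
    refine ext_zero_of (hh2 l) ?_
    intro l' hl'
    refine h2 l' (Car_small hp hl1 (by linarith) (by positivity) hl'.2) (by rw [hl'.1, hl2]) ?_
    exact Car_near hp (l := l) ⟨a, ha, hl3⟩ (by linarith) (by positivity) hl'.2

theorem van_of_sq [CompactSpace X] [Nonempty X] {q : ℕ} (hq : 1 ≤ q) (h : DimLE (X × X) (2 * q - 1)) (F : Type*) [Field F] : Van X F q := by
  by_contra hV
  obtain ⟨ε, u, B, hu⟩ := exists_Coc hV
  have := hu.pos
  exact (hu.prod hu).not_cov (δ := ε/3) (by positivity) (by linarith) (by omega) (h (ε/3) (by positivity))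

end metric
end MDP

namespace MDP

section alg
variable {R : Type*} [CommRing R] {X Y M : Type*} [AddCommGroup M] [Module R M]

lemma expand {V : Type*} [Fintype V] {n : ℕ} {c : Ch R V} (hc : c ∈ Sp R (L n univ)) :
    c = ∑ f : Fin n → V, c (List.ofFn f) • e R (List.ofFn f) := by
  classical
  ext l
  rw [Finsupp.finsetSum_apply]
  simp only [e, Finsupp.smul_apply, Finsupp.single_apply, smul_eq_mul, mul_ite, mul_one, mul_zero]
  by_cases hl : l.length = n
  · subst hl
    rw [Finset.sum_eq_single l.get]
    · simp
    · intro f _ hf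
      rw [if_neg]
      intro h
      apply hf
      apply List.ofFn_injective
      rw [h]; simp
    · simp
  · rw [Finset.sum_eq_zero]
    · by_contra h
      exact hl ((Finsupp.mem_supported R c).1 hc (Finsupp.mem_support_iff.2 h)).1
    · intro f _
      rw [if_neg]
      rintro rfl
      simp at hl

lemma ext_off {q : ℕ} {g : List X → M} (hg : ∀ l, l.length ≠ q → g l = 0) {s : List X} (hs : s.length ≠ q + 1) :
    ext R g (bdl R s) = 0 := by
  rcases s with _ | ⟨a, s⟩
  · simp
  refine ext_zero_of (bdl_mem' _) ?_
  intro l hl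
  apply hg
  rw [hl.1]; simp at hs ⊢; exact hs

lemma pbd_sum {ι : Type*} (S : Finset ι) (b : ι → List X → List Y → M) (s : List X) (t : List Y) :
    pbd R (fun s t => ∑ i ∈ S, b i s t) s t = ∑ i ∈ S, pbd R (b i) s t := by
  simp only [pbd, ext2_e_right, ext2_e_left, ext_sum, Finset.smul_sum, Finset.sum_add_distrib]

lemma ext_bdl_bdl (u : List X → M) (l : List X) :
    ext R (fun l => ext R u (bdl R l)) (bdl R l) = 0 := by
  rw [← ext_bd, bd_bdl, map_zero]

lemma ext_bdl_congr {u u' : List X → M} {l : List X} (h : ∀ l', l'.length + 1 = l.length → (∀ x ∈ l', x ∈ l) → u l' = u' l') :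
    ext R u (bdl R l) = ext R u' (bdl R l) := by
  rcases l with _ | ⟨a, l⟩
  · simp
  refine ext_congr (bdl_mem' _) ?_
  intro l' hl'
  exact h l' (by rw [hl'.1]; simp) hl'.2

lemma bridge {S M : Type*} [CommRing S] [AddCommGroup M] [Module S M] (c : List X → M) (l : List X) :
    ext S c (bdl S l) = ext ℤ c (bdl ℤ l) := by
  have h1 : ∀ z : Ch ℤ X, ext S c (ext ℤ (e S) z) = ext ℤ c z := by
    intro z
    have : (ext S c).toAddMonoidHom.toIntLinearMap ∘ₗ ext ℤ (e S) = ext ℤ c := lin_ext (by simp)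
    exact LinearMap.congr_fun this z
  have h2 : ∀ l : List X, ext ℤ (e S) (bdl ℤ l) = bdl S l := by
    intro l
    induction l with
    | nil => simp
    | cons a l ih =>
      rw [bdl_cons, bdl_cons, map_sub, ext_e, ← ih]
      congr 1
      have : ext ℤ (e S) ∘ₗ cone ℤ a = (cone S a).toAddMonoidHom.toIntLinearMap ∘ₗ ext ℤ (e S) := lin_ext (by simp)
      exact LinearMap.congr_fun this _
  rw [← h2, h1]

lemma ext_cast {S : Type*} [Ring S] (u : List X → ℤ) (z : Ch ℤ X) :
    ext ℤ (fun l => (u l : S)) z = ((ext ℤ u z : ℤ) : S) := by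
  have := map_ext (Int.castAddHom S).toIntLinearMap u z
  simpa using this.symm

end alg

section metric
variable {X Y : Type*} [MetricSpace X] [MetricSpace Y] {R : Type*} [CommRing R]

lemma exists_unif {ι : Type*} [Finite ι] {P : ι → ℝ → Prop} (h : ∀ i, ∃ ε > 0, P i ε)
    (hm : ∀ i ε ε', ε' ≤ ε → P i ε → P i ε') : ∃ ε > 0, ∀ i, P i ε := by
  classical
  have := Fintype.ofFinite ι
  choose f hf1 hf2 using h
  have key : ∀ S : Finset ι, ∃ ε > 0, ∀ i ∈ S, P i ε := by
    intro S
    induction S using Finset.induction with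
    | empty => exact ⟨1, one_pos, by simp⟩
    | insert a S _ ih =>
      obtain ⟨ε, hε, h⟩ := ih
      refine ⟨min ε (f a), lt_min hε (hf1 a), ?_⟩
      intro i hi
      rcases Finset.mem_insert.1 hi with rfl | hi
      · exact hm _ _ _ (min_le_right _ _) (hf2 _)
      · exact hm _ _ _ (min_le_left _ _) (h i hi)
  obtain ⟨ε, hε, h⟩ := key Finset.univ
  exact ⟨ε, hε, fun i => h i (Finset.mem_univ i)⟩

/-- far set -/
def Far {N n : ℕ} (p : Fin N → X) (δ : ℝ) (f : Fin n → Fin N) : Set X := {x | ∃ i, 2 * δ ≤ dist x (p (f i))}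

/-- coefficient cochains -/
noncomputable def om (R : Type*) [CommRing R] {X : Type*} {N n : ℕ} (v : X → Fin N) (f : Fin n → Fin N) (l : List X) : R :=
  srt R (l.map v) (List.ofFn f)

lemma om_cocycle {N q : ℕ} {v : X → Fin N} {p : Fin N → X} {ε : ℝ}
    (hs : ∀ l : List X, l ≠ [] → Small ε l → ∀ s : List (Fin N),
        s.Pairwise (· < ·) → (∀ i ∈ s, i ∈ l.map v) → s.length ≤ q + 1) (f : Fin (q + 1) → Fin N)
    (l : List X) (hl : Small ε l) (hlen : l.length = q + 2) : ext R (om R v f) (bdl R l) = 0 := by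
  have hne : l ≠ [] := by rintro rfl; simp at hlen
  have h1 := srt_map_bd (R := R) v l
  rw [rr_zero (hs l hne hl) (by omega), map_zero] at h1
  have h2 := congrArg (Finsupp.lapply (R := R) (List.ofFn f)) h1
  rw [map_ext] at h2
  simp only [map_zero] at h2
  exact h2.symm

lemma om_mem {N n : ℕ} {v : X → Fin N} {f : Fin n → Fin N} {l : List X} (h : om R v f l ≠ 0) :
    l.length = n ∧ ∀ i, ∃ y ∈ l, v y = f i := by
  have h1 := (Finsupp.mem_supported R _).1 (srt_map_mem (R := R) v l) (Finsupp.mem_support_iff.2 h)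
  refine ⟨by have := h1.2.1; simpa using this.symm, ?_⟩
  intro i
  have := h1.2.2 (f i) (by simp [List.mem_ofFn])
  simpa using this

lemma om_far {N n : ℕ} {v : X → Fin N} {p : Fin N → X} {ε δ : ℝ} (hε : ε ≤ δ) (hp : ∀ x, dist x (p (v x)) < δ)
    (f : Fin n → Fin N) (l : List X) (hl : NearAll ε (Far p δ f) l) : om R v f l = 0 := by
  by_contra h
  obtain ⟨a, ⟨i, hi⟩, ha⟩ := hl
  obtain ⟨y, hy, hyf⟩ := (om_mem h).2 i
  have h1 := hp y
  rw [hyf] at h1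
  have h2 := ha y hy
  have h3 := dist_triangle a y (p (f i))
  linarith

lemma near_of_not_far {N n : ℕ} {p : Fin N → X} {ε δ : ℝ} {f : Fin n → Fin N} {l : List X} (hl : Small ε l)
    (h : ¬ NearAll ε (Far p δ f) l) : ∀ x ∈ l, ∀ i, dist x (p (f i)) < 2 * δ := by
  intro x hx i
  by_contra h'
  exact h ⟨x, ⟨i, not_lt.1 h'⟩, fun y hy => hl x hx y hy⟩

lemma rr_expand {N n : ℕ} (v : X → Fin N) (p : Fin N → X) {l : List X} (hl : l.length = n) :
    rr R v p l = ∑ f : Fin n → Fin N, om R v f l • e R ((List.ofFn f).map p) := by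
  have h : srt R (l.map v) ∈ Sp R (L n univ) := by
    refine Sp_mono ?_ (srt_map_mem v l)
    rintro s ⟨-, h1, -⟩
    exact ⟨by rw [h1, hl], by simp⟩
  rw [rr, expand h, map_sum]
  refine Finset.sum_congr rfl fun f _ => ?_
  rw [map_smul, ext_e]; rfl

lemma TT_htpy {N : ℕ} (v : X → Fin N) (p : Fin N → X) : ∃ h : List (X × X) → Ch R (X × X),
    (∀ l, bd R (h l) + ext R h (bdl R l) = e R l - TT (rr R v p) (rr R v p) l) ∧
      ∀ l, h l ∈ Sp R (L (l.length + 1) (Car v p (l.map Prod.fst) ×ˢ Car v p (l.map Prod.snd))) := by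
  have hc := TT_cm (rr_cm (R := R) v p) (rr_cm (R := R) v p)
  have hr : ∀ l, rr R v p l ∈ Sp R (L l.length (Car v p l)) := fun l =>
    Sp_mono (L_mono (fun x hx => Or.inr hx)) (rr_mem v p l)
  refine exists_htpy _ (fun l => Car v p (l.map Prod.fst) ×ˢ Car v p (l.map Prod.snd)) hc.nil hc.chain ?_ ?_ ?_
  · exact TT_mem hr hr (Car_mono v p) (Car_mono v p)
  · exact fun l x hx => ⟨Or.inl (List.mem_map_of_mem hx), Or.inl (List.mem_map_of_mem hx)⟩
  · intro l l' h
    refine Set.prod_mono (Car_mono v p _ _ ?_) (Car_mono v p _ _ ?_)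
    · intro x hx
      obtain ⟨y, hy, rfl⟩ := List.mem_map.1 hx
      exact List.mem_map_of_mem (h y hy)
    · intro x hx
      obtain ⟨y, hy, rfl⟩ := List.mem_map.1 hx
      exact List.mem_map_of_mem (h y hy)

/-- points within `2δ` of a list -/
def Bl (δ : ℝ) (l : List X) : Set X := {x | ∃ y ∈ l, dist x y < 2 * δ}

lemma Bl_mono {δ : ℝ} {l l' : List X} (h : ∀ x ∈ l', x ∈ l) : Bl δ l' ⊆ Bl δ l := by
  rintro x ⟨y, hy, h'⟩
  exact ⟨y, h y hy, h'⟩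

lemma Car_Bl {N : ℕ} {v : X → Fin N} {p : Fin N → X} {δ : ℝ} (hδ : 0 < δ) (hp : ∀ x, dist x (p (v x)) < δ)
    (l : List X) : Car v p l ⊆ Bl δ l := by
  rintro x (hx | ⟨y, hy, rfl⟩)
  · exact ⟨x, hx, by simpa using hδ⟩
  · refine ⟨y, hy, ?_⟩
    have := hp y
    rw [dist_comm]; linarith

lemma Bl_small {δ ε ε₁ : ℝ} {l : List (X × Y)} (hl : Small ε l) (h : ε + 4 * δ ≤ ε₁) {l' : List (X × Y)}
    (h' : ∀ x ∈ l', x ∈ Bl δ (l.map Prod.fst) ×ˢ Bl δ (l.map Prod.snd)) : Small ε₁ l' := by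
  intro x hx y hy
  refine max_lt ?_ ?_
  · obtain ⟨a, ha, h1⟩ := (h' x hx).1
    obtain ⟨b, hb, h2⟩ := (h' y hy).1
    have h3 := hl.fst a ha b hb
    have h4 := dist_triangle4 x.1 a b y.1
    rw [dist_comm b] at h4
    linarith
  · obtain ⟨a, ha, h1⟩ := (h' x hx).2
    obtain ⟨b, hb, h2⟩ := (h' y hy).2
    have h3 := hl.snd a ha b hb
    have h4 := dist_triangle4 x.2 a b y.2
    rw [dist_comm b] at h4
    linarith

lemma Bl_near {δ ε ε₁ : ℝ} {A : Set (X × Y)} {l : List (X × Y)} (hl : NearAll ε A l) (h : ε + 2 * δ ≤ ε₁) {l' : List (X × Y)}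
    (h' : ∀ x ∈ l', x ∈ Bl δ (l.map Prod.fst) ×ˢ Bl δ (l.map Prod.snd)) : NearAll ε₁ A l' := by
  obtain ⟨c, hc, hl⟩ := hl
  refine ⟨c, hc, fun x hx => max_lt ?_ ?_⟩
  · obtain ⟨a, ha, h1⟩ := (h' x hx).1
    obtain ⟨a, ha', rfl⟩ := List.mem_map.1 ha
    have h3 := (le_max_left _ _).trans_lt (hl a ha')
    have h4 := dist_triangle c.1 a.1 x.1
    rw [dist_comm a.1] at h4
    linarith
  · obtain ⟨a, ha, h1⟩ := (h' x hx).2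
    obtain ⟨a, ha', rfl⟩ := List.mem_map.1 ha
    have h3 := (le_max_right _ _).trans_lt (hl a ha')
    have h4 := dist_triangle c.2 a.2 x.2
    rw [dist_comm a.2] at h4
    linarith

lemma ext_TT {N : ℕ} (v : X → Fin N) (p : Fin N → X) (u : List (X × X) → R) {l : List (X × X)} (hl : l ≠ []) :
    ext R u (TT (rr R v p) (rr R v p) l) =
      AW (fun s t => ext2 R (fun s t => ext R u (D R s t)) (rr R v p s) (rr R v p t)) l := by
  obtain ⟨a, l, rfl⟩ := List.exists_cons_of_ne_nil hl
  simp only [TT]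
  refine (AW_map (M' := R) ((ext R u : Ch R (X × X) →ₗ[R] R).toAddMonoidHom) _ _).symm.trans ?_
  congr 1
  ext1 s; ext1 t
  exact map_ext2 (ext R u) _ _ _

/-- localized primitives -/
lemma loc_prim {q : ℕ} (hV : Van X R q) {N : ℕ} {v : X → Fin N} {p : Fin N → X} {δ ε : ℝ} (hδ : 0 < δ) (hε : 0 < ε)
    (hp : ∀ x, dist x (p (v x)) < δ) (hs : ∀ l : List X, l ≠ [] → Small ε l → ∀ s : List (Fin N),
        s.Pairwise (· < ·) → (∀ i ∈ s, i ∈ l.map v) → s.length ≤ q + 1) :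
    ∃ ε' > 0, ∃ c : (Fin (q + 1) → Fin N) → List X → R,
      (∀ f l, Small ε' l → l.length = q + 1 → ext R (c f) (bdl R l) = om R v f l) ∧
      (∀ f l, l.length ≠ q → c f l = 0) ∧
      (∀ f l, Small ε' l → c f l ≠ 0 → ∀ x ∈ l, ∀ i, dist x (p (f i)) < 2 * δ) := by
  have key : ∀ f : Fin (q + 1) → Fin N, ∃ ε' > 0, ∃ c : List X → R,
      (∀ l, Small ε' l → l.length = q + 1 → ext R c (bdl R l) = om R v f l) ∧
      (∀ l, l.length ≠ q → c l = 0) ∧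
      (∀ l, Small ε' l → c l ≠ 0 → ∀ x ∈ l, ∀ i, dist x (p (f i)) < 2 * δ) := by
    intro f
    obtain ⟨ε', hε', c, h1, h2⟩ := hV (Far p δ f) (om R v f) (min ε δ) (by positivity)
      (fun l hl hlen => om_cocycle (p := p) hs f l (hl.mono (min_le_left _ _)) hlen)
      (fun l _ _ hn => om_far (min_le_right _ _) hp f l hn)
    refine ⟨ε', hε', fun l => if l.length = q then c l else 0, ?_, ?_, ?_⟩
    · intro l hl hlen
      rw [← h1 l hl hlen]
      refine ext_bdl_congr ?_
      intro l' hl' _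
      rw [if_pos (by omega)]
    · intro l hl
      simp [hl]
    · intro l hl hc
      refine near_of_not_far hl ?_
      intro hn
      apply hc
      beta_reduce
      split_ifs with hlen
      · exact h2 l hl hlen hn
      · rfl
  obtain ⟨ε', hε', h⟩ := exists_unif key (by
    rintro f ε₁ ε₂ h12 ⟨c, h1, h2, h3⟩
    exact ⟨c, fun l hl => h1 l (hl.mono h12), h2, fun l hl => h3 l (hl.mono h12)⟩)
  choose c h1 h2 h3 using h
  exact ⟨ε', hε', c, h1, h2, h3⟩

end metric
end MDP

namespace MDP
section sq
variable {X Y : Type*} [MetricSpace X] [MetricSpace Y] {R : Type*} [CommRing R]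

/-- evaluation of a cochain on cross products -/
noncomputable def UU (u : List (X × Y) → R) : Ch R X →ₗ[R] Ch R Y →ₗ[R] R :=
  ext2 R (fun s t => ext R u (D R s t))

lemma UU_eq (u : List (X × Y) → R) (c : Ch R X) (d : Ch R Y) : UU u c d = ext R u (ext2 R (D R) c d) :=
  (map_ext2 (ext R u) _ _ _).symm

lemma UU_zero {u : List (X × Y) → R} {m n : ℕ} {A : Set X} {B : Set Y} {c : Ch R X} {d : Ch R Y}
    (hc : c ∈ Sp R (L m A)) (hd : d ∈ Sp R (L n B)) (h : ∀ l ∈ L (m + n - 1) (A ×ˢ B), u l = 0) : UU u c d = 0 := by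
  have := ext2_mem (N := (⊥ : Submodule R R)) hc hd (b := fun s t => ext R u (D R s t)) ?_
  · exact (Submodule.mem_bot R).1 this
  · intro s hs t ht
    rw [Submodule.mem_bot]
    refine ext_zero_of (D_mem (R := R) s t hs.2 ht.2) ?_
    rw [hs.1, ht.1]; exact h

lemma UU_bd {u : List (X × Y) → R} {m n : ℕ} {A : Set X} {B : Set Y} {c : Ch R X} {d : Ch R Y}
    (hc : c ∈ Sp R (L m A)) (hd : d ∈ Sp R (L n B)) (h : ∀ l ∈ L (m + n - 1) (A ×ˢ B), ext R u (bdl R l) = 0) :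
    UU u (bd R c) d + (-1 : R) ^ (m + 1) * UU u c (bd R d) = 0 := by
  have h1 := bd_ext2_D (Sp_mono (L_mono (subset_univ A)) hc) d
  rw [UU_eq, UU_eq, ← smul_eq_mul, ← map_smul, ← map_add, ← h1, ext_bd, ← UU_eq]
  exact UU_zero hc hd h

lemma rr_Bl {N : ℕ} {v : X → Fin N} {p : Fin N → X} {δ : ℝ} (hδ : 0 < δ) (hp : ∀ x, dist x (p (v x)) < δ)
    {s s' : List X} (hs : ∀ x ∈ s, x ∈ s') : rr R v p s ∈ Sp R (L s.length (Bl δ s')) := by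
  refine Sp_mono (L_mono ?_) (rr_mem v p s)
  rintro x ⟨y, hy, rfl⟩
  refine ⟨y, hs y hy, ?_⟩
  have := hp y
  rw [dist_comm]; linarith

lemma P_Bl {N n : ℕ} {p : Fin N → X} {δ : ℝ} {f : Fin n → Fin N} {s s' : List X} (hne : s ≠ [])
    (h : ∀ x ∈ s, ∀ i, dist x (p (f i)) < 2 * δ) (hs : ∀ x ∈ s, x ∈ s') :
    (List.ofFn f).map p ∈ L n (Bl δ s') := by
  refine ⟨by simp, ?_⟩
  intro x hx
  obtain ⟨y, hy, rfl⟩ := List.mem_map.1 hx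
  obtain ⟨i, rfl⟩ := (List.mem_ofFn' _ _).1 hy
  obtain ⟨a, s, rfl⟩ := List.exists_cons_of_ne_nil hne
  refine ⟨a, hs a (by simp), ?_⟩
  rw [dist_comm]
  exact h a (by simp) i

lemma ext_rr {N : ℕ} (v : X → Fin N) (p : Fin N → X) {M : Type*} [AddCommGroup M] [Module R M]
    (g : Ch R X →ₗ[R] M) (l : List X) : ext R (fun l => g (rr R v p l)) (bdl R l) = g (bd R (rr R v p l)) := by
  rw [← map_ext, (rr_cm v p).chain]

theorem van_sq [CompactSpace X] [Nonempty X] {q : ℕ} (hq : 1 ≤ q) (hD : DimLE X q) (hV : Van X R q) :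
    Van (X × X) R (2 * q - 1) := by
  intro A u ε hε hu hA
  have hδ : 0 < ε / 8 := by positivity
  set δ := ε / 8 with hδe
  obtain ⟨N, v, p, ε₁, hε₁, hp, -, hs⟩ := exists_approx (hD δ hδ) univ
  obtain ⟨h, hh1, hh2⟩ := TT_htpy (R := R) v p
  obtain ⟨ε₂, hε₂, c, hc1, hc2, hc3⟩ := loc_prim hV hδ hε₁ hp hs
  set P : (Fin (q + 1) → Fin N) → List X := fun f => (List.ofFn f).map p with hP
  have hPl : ∀ f, (P f).length = q + 1 := by simp [hP]
  set β : (Fin (q + 1) → Fin N) → List X → R := fun f t => if t.length = q then UU u (e R (P f)) (rr R v p t) else 0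
    with hβ
  set b' : (Fin (q + 1) → Fin N) → List X → R := fun f s => if s.length = q then UU u (rr R v p s) (e R (P f)) -
      (-1 : R) ^ (q + 1) * ∑ g, c g s * UU u (e R (P g)) (bdl R (P f)) else 0 with hb'
  set b₁ : List X → List X → R := fun s t => ∑ f, c f s * β f t with hb₁
  set b₂ : List X → List X → R := fun s t => ∑ f, b' f s * c f t with hb₂
  have hrr0 : ∀ s, Small ε₁ s → q + 1 < s.length → rr R v p s = 0 := by
    intro s h1 h2
    have hne : s ≠ [] := by rintro rfl; simp at h2
    rw [rr, rr_zero (hs s hne h1) h2, map_zero]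
  refine ⟨min (min ε₁ ε₂) δ, by positivity, fun l => ext R u (h l) + AW b₁ l + (-1 : R) ^ (q + 1) * AW b₂ l, ?_, ?_⟩
  · intro l hl hlen
    have hlen' : l.length = 2 * q := by omega
    have hl1 : Small ε₁ l := hl.mono ((min_le_left _ _).trans (min_le_left _ _))
    have hl2 : Small ε₂ l := hl.mono ((min_le_left _ _).trans (min_le_right _ _))
    have hl3 : Small δ l := hl.mono (min_le_right _ _)
    have hne : l ≠ [] := by rintro rfl; simp at hlen'; omega
    have hcarB : Car v p (l.map Prod.fst) ×ˢ Car v p (l.map Prod.snd) ⊆ Bl δ (l.map Prod.fst) ×ˢ Bl δ (l.map Prod.snd) :=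
      Set.prod_mono (Car_Bl hδ hp _) (Car_Bl hδ hp _)
    have hsm : ∀ l' : List (X × X), (∀ x ∈ l', x ∈ Bl δ (l.map Prod.fst) ×ˢ Bl δ (l.map Prod.snd)) → Small ε l' :=
      fun l' h' => Bl_small hl3 (by linarith) h'
    have key := cocycle_htpy u (hh1 l) (hh2 l) (by
      intro l' hl'
      refine hu l' (hsm l' fun x hx => hcarB (hl'.2 x hx)) ?_
      rw [hl'.1]; omega)
    rw [key, ext_TT v p u hne, ext_add, ext_add, AW_bd l b₁ (by
      intro s; simp only [hb₁, hβ]; simp; intro h; omega)]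
    have e2 : ext R (fun l => (-1 : R) ^ (q + 1) * AW b₂ l) (bdl R l) = (-1 : R) ^ (q + 1) * ext R (AW b₂) (bdl R l) := by
      have := ext_smul ((-1 : R) ^ (q + 1)) (AW b₂) (bdl R l)
      simpa [smul_eq_mul] using this
    rw [e2, AW_bd l b₂ (by
      intro s; simp only [hb₂]
      exact Finset.sum_eq_zero fun f _ => by rw [hc2 f [] (by simp; omega), mul_zero])]
    have z1 : b₁ [] (l.map Prod.snd) = 0 :=
      Finset.sum_eq_zero fun f _ => by rw [hc2 f [] (by simp; omega), zero_mul]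
    have z2 : b₂ [] (l.map Prod.snd) = 0 :=
      Finset.sum_eq_zero fun f _ => by simp only [hb']; rw [if_neg (by simp; omega), zero_mul]
    rw [z1, z2, sub_zero, sub_zero]
    have z3 : (-1 : R) ^ (q + 1) * AW (pbd R b₂) l = AW (fun s t => (-1 : R) ^ (q + 1) * pbd R b₂ s t) l :=
      (AW_map (AddMonoidHom.mulLeft ((-1 : R) ^ (q + 1))) l (pbd R b₂)).symm
    rw [z3, add_assoc, ← AW_add, add_comm]
    congr 1
    refine AW_congr l ?_
    intro s t hs0 ht0 hst hsl htl
    have hs1 : Small ε₁ s := hl1.fst.sub hsl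
    have ht1 : Small ε₁ t := hl1.snd.sub htl
    have hs2 : Small ε₂ s := hl2.fst.sub hsl
    have ht2 : Small ε₂ t := hl2.snd.sub htl
    simp only [hb₁, hb₂]
    rw [pbd_sum, pbd_sum]
    simp only [pbd_mul]
    have hb'off : ∀ f, ∀ l : List X, l.length ≠ q → b' f l = 0 := by
      intro f l hl; simp only [hb']; rw [if_neg hl]
    have hβoff : ∀ f, ∀ l : List X, l.length ≠ q → β f l = 0 := by
      intro f l hl; simp only [hβ]; rw [if_neg hl]
    change _ = UU u (rr R v p s) (rr R v p t)
    by_cases c1 : s.length = q + 1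
    · have ht : t.length = q := by omega
      have hBl := hrr0
      rw [Finset.sum_congr rfl (g := fun f => om R v f s * β f t) (fun f _ => by
        rw [hc1 f s hs2 c1, hc2 f s (by omega), zero_mul, mul_zero, add_zero])]
      rw [Finset.sum_eq_zero (s := Finset.univ) (f := fun f => ext R (b' f) (bdl R s) * c f t + _)]
      · rw [mul_zero, add_zero, rr_expand v p c1, map_sum, LinearMap.sum_apply]
        refine Finset.sum_congr rfl fun f _ => ?_
        simp only [hβ, if_pos ht, map_smul, LinearMap.smul_apply, smul_eq_mul]; rfl
      · intro f _
        rw [hb'off f s (by omega), zero_mul, mul_zero, add_zero]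
        by_cases h0 : c f t = 0
        · rw [h0, mul_zero]
        have hPB := P_Bl ht0 (hc3 f t ht2 h0) htl
        have E1 : ext R (b' f) (bdl R s) = ext R (fun s => UU u (rr R v p s) (e R (P f)) -
            (-1 : R) ^ (q + 1) * ∑ g, c g s * UU u (e R (P g)) (bdl R (P f))) (bdl R s) := by
          refine ext_bdl_congr fun l' hl' _ => ?_
          simp only [hb']; rw [if_pos (by omega)]
        have E2 : ext R (fun s => (-1 : R) ^ (q + 1) * ∑ g, c g s * UU u (e R (P g)) (bdl R (P f))) (bdl R s)
            = (-1 : R) ^ (q + 1) * UU u (rr R v p s) (bdl R (P f)) := by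
          have := ext_smul ((-1 : R) ^ (q + 1)) (fun s => ∑ g, c g s * UU u (e R (P g)) (bdl R (P f))) (bdl R s)
          simp only [smul_eq_mul] at this
          rw [this, ext_sum, rr_expand v p c1, map_sum, LinearMap.sum_apply]
          congr 1
          refine Finset.sum_congr rfl fun g _ => ?_
          have := ext_smul (UU u (e R (P g)) (bdl R (P f))) (c g) (bdl R s)
          simp only [smul_eq_mul, hc1 g s hs2 c1] at this
          rw [map_smul, LinearMap.smul_apply, smul_eq_mul, mul_comm, ← this]
          simp only [mul_comm]
        have E3 := ext_rr (R := R) v p ((UU u).flip (e R (P f))) s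
        simp only [LinearMap.flip_apply] at E3
        rw [E1, ext_sub, E2, E3]
        have E4 := UU_bd (u := u) (rr_Bl (R := R) hδ hp hsl) (e_mem (R := R) hPB) (by
          intro l' hl'
          refine hu l' (hsm l' hl'.2) ?_
          rw [hl'.1]; omega)
        rw [c1, bd_e] at E4
        have E5 : (-1 : R) ^ (q + 1 + 1) = - (-1 : R) ^ (q + 1) := by rw [pow_succ]; ring
        rw [E5] at E4
        have E6 : UU u (bd R (rr R v p s)) (e R (P f)) - (-1 : R) ^ (q + 1) * UU u (rr R v p s) (bdl R (P f)) = 0 := by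
          rw [← E4]; ring
        rw [E6, zero_mul]
    by_cases c2 : s.length = q
    · have ht : t.length = q + 1 := by omega
      have S2 : ∀ f, ext R (b' f) (bdl R s) * c f t + (-1 : R) ^ (s.length + 1) * (b' f s * ext R (c f) (bdl R t))
          = (-1 : R) ^ (q + 1) * (b' f s * om R v f t) := by
        intro f
        rw [hc2 f t (by omega), mul_zero, zero_add, hc1 f t ht2 ht, c2]
      have S1 : ∀ f, ext R (c f) (bdl R s) * β f t + (-1 : R) ^ (s.length + 1) * (c f s * ext R (β f) (bdl R t))
          = (-1 : R) ^ (q + 1) * (c f s * UU u (e R (P f)) (bd R (rr R v p t))) := by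
        intro f
        rw [hβoff f t (by omega), mul_zero, zero_add, c2, ← ext_rr v p (UU u (e R (P f))) t]
        congr 2
        refine ext_bdl_congr fun l' hl' _ => ?_
        simp only [hβ]; rw [if_pos (by omega)]
      simp only [S1, S2]
      have hsq : ∀ x : R, (-1 : R) ^ (q + 1) * ((-1 : R) ^ (q + 1) * x) = x := by
        intro x; rw [← mul_assoc, ← pow_add, ← two_mul, pow_mul]; simp
      rw [Finset.mul_sum, ← Finset.sum_add_distrib]
      simp only [hsq]
      rw [Finset.sum_add_distrib]
      have T1 : ∑ f, b' f s * om R v f t = UU u (rr R v p s) (rr R v p t) -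
          ∑ f, (-1 : R) ^ (q + 1) * (c f s * UU u (e R (P f)) (bd R (rr R v p t))) := by
        rw [rr_expand v p ht]
        simp only [map_sum, map_smul, bd_e, smul_eq_mul, Finset.mul_sum]
        rw [Finset.sum_comm, ← Finset.sum_sub_distrib]
        refine Finset.sum_congr rfl fun f _ => ?_
        simp only [hb', if_pos c2]
        rw [Finset.mul_sum, sub_mul, Finset.sum_mul, mul_comm]
        congr 1
        refine Finset.sum_congr rfl fun g _ => ?_
        simp only [hP]; ring
      rw [T1]; ring
    · have hz : UU u (rr R v p s) (rr R v p t) = 0 := by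
        rcases lt_or_gt_of_ne c1 with h1 | h1
        · rw [hrr0 t ht1 (by omega), map_zero]
        · rw [hrr0 s hs1 h1, map_zero, LinearMap.zero_apply]
      rw [hz, Finset.sum_eq_zero, Finset.sum_eq_zero, mul_zero, add_zero]
      · intro f _
        rw [hb'off f s c2, zero_mul, mul_zero, add_zero, ext_off (hb'off f) c1, zero_mul]
      · intro f _
        rw [hc2 f s c2, zero_mul, mul_zero, add_zero, ext_off (hc2 f) c1, zero_mul]
  · intro l hl hlen hnear
    have hl2 : Small ε₂ l := hl.mono ((min_le_left _ _).trans (min_le_right _ _))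
    have hl3 : Small δ l := hl.mono (min_le_right _ _)
    have hn3 : NearAll δ A l := hnear.mono (min_le_right _ _)
    have hcarB : Car v p (l.map Prod.fst) ×ˢ Car v p (l.map Prod.snd) ⊆ Bl δ (l.map Prod.fst) ×ˢ Bl δ (l.map Prod.snd) :=
      Set.prod_mono (Car_Bl hδ hp _) (Car_Bl hδ hp _)
    have hz : ∀ l' : List (X × X), (∀ x ∈ l', x ∈ Bl δ (l.map Prod.fst) ×ˢ Bl δ (l.map Prod.snd)) →
        l'.length = 2 * q → u l' = 0 := by
      intro l' h1 h2
      exact hA l' (Bl_small hl3 (by linarith) h1) (by omega) (Bl_near hn3 (by linarith) h1)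
    beta_reduce
    rw [ext_zero_of (hh2 l) (fun l' hl' => hz l' (fun x hx => hcarB (hl'.2 x hx)) (by rw [hl'.1]; omega)),
      AW_zero_of l, AW_zero_of l, mul_zero, add_zero, add_zero]
    · intro s t hs0 ht0 hst hsl htl
      simp only [hb₂]
      refine Finset.sum_eq_zero fun f _ => ?_
      by_cases h0 : c f t = 0
      · rw [h0, mul_zero]
      have hPB := P_Bl ht0 (hc3 f t (hl2.snd.sub htl) h0) htl
      simp only [hb']
      split_ifs with c2
      · rw [UU_zero (rr_Bl (R := R) hδ hp hsl) (e_mem (R := R) hPB), Finset.sum_eq_zero]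
        · simp
        · intro g _
          by_cases h0 : c g s = 0
          · rw [h0, zero_mul]
          have hPB' := P_Bl hs0 (hc3 g s (hl2.fst.sub hsl) h0) hsl
          rw [UU_zero (e_mem (R := R) hPB') (bdl_mem (R := R) hPB), mul_zero]
          intro l' hl'
          exact hz l' hl'.2 (by rw [hl'.1]; omega)
        · intro l' hl'
          exact hz l' hl'.2 (by rw [hl'.1]; omega)
      · rw [zero_mul]
    · intro s t hs0 ht0 hst hsl htl
      simp only [hb₁]
      refine Finset.sum_eq_zero fun f _ => ?_
      by_cases h0 : c f s = 0
      · rw [h0, zero_mul]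
      have hPB := P_Bl hs0 (hc3 f s (hl2.fst.sub hsl) h0) hsl
      simp only [hβ]
      split_ifs with c2
      · rw [UU_zero (e_mem (R := R) hPB) (rr_Bl (R := R) hδ hp htl), mul_zero]
        intro l' hl'
        exact hz l' hl'.2 (by rw [hl'.1]; omega)
      · rw [mul_zero]

end sq
end MDP

namespace MDP
section uct
variable {X : Type*} [MetricSpace X]

lemma ext_mul_left {R : Type*} [CommRing R] (r : R) (f : List X → R) (c : Ch R X) :
    ext R (fun l => r * f l) c = r * ext R f c := by
  have := ext_smul r f c
  simpa only [smul_eq_mul] using this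

lemma qfin [CompactSpace X] [Nonempty X] {q : ℕ} (hV : Van X ℚ q) (A : Set X) (u : List X → ℤ) {ε : ℝ} (hε : 0 < ε)
    (hu : ∀ l, Small ε l → l.length = q + 2 → ext ℤ u (bdl ℤ l) = 0)
    (hA : ∀ l, Small ε l → l.length = q + 1 → NearAll ε A l → u l = 0) :
    ∃ m : ℕ, m ≠ 0 ∧ ∃ ε' > 0, ∃ c : List X → ℤ,
      (∀ l, Small ε' l → l.length = q + 1 → ext ℤ c (bdl ℤ l) = m * u l) ∧
      ∀ l, Small ε' l → l.length = q → NearAll ε' A l → c l = 0 := by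
  obtain ⟨ε₁, hε₁, c, hc1, hc2⟩ := hV A (fun l => (u l : ℚ)) ε hε
    (fun l h1 h2 => by rw [bridge, ext_cast, hu l h1 h2]; simp)
    (fun l h1 h2 h3 => by simp [hA l h1 h2 h3])
  have hδ : 0 < min ε ε₁ / 8 := by positivity
  set δ := min ε ε₁ / 8 with hδe
  have hδ1 : 8 * δ ≤ ε := by rw [hδe]; have := min_le_left ε ε₁; linarith
  have hδ2 : 8 * δ ≤ ε₁ := by rw [hδe]; have := min_le_right ε ε₁; linarith
  obtain ⟨k, hk⟩ := exists_Cov (X := X) hδ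
  obtain ⟨N, v, p, ε₂, hε₂, hp, -, hs⟩ := exists_approx hk univ
  obtain ⟨h, hh1, hh2⟩ := rr_htpy (R := ℤ) v p
  set P : (Fin q → Fin N) → List X := fun f => (List.ofFn f).map p with hP
  set m : ℕ := ∏ f, (c (P f)).den with hm
  have hm0 : m ≠ 0 := Finset.prod_ne_zero_iff.2 fun f _ => (c (P f)).den_nz
  have h_int : ∀ f, ∃ z : ℤ, (z : ℚ) = m * c (P f) := by
    intro f
    obtain ⟨k, hk⟩ := Finset.dvd_prod_of_mem (fun f => (c (P f)).den) (Finset.mem_univ f)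
    refine ⟨k * (c (P f)).num, ?_⟩
    rw [hm, hk]
    push_cast
    rw [mul_comm ((c (P f)).den : ℚ), mul_assoc, Rat.den_mul_eq_num]
  choose z hz using h_int
  set C : List X → ℤ := fun l => if l.length = q then ∑ f, om ℤ v f l * z f else 0 with hC
  have hCc : ∀ l, l.length = q → (C l : ℚ) = m * ext ℤ c (rr ℤ v p l) := by
    intro l hl
    simp only [hC, if_pos hl]
    rw [rr_expand v p hl, map_sum, Finset.mul_sum]
    push_cast
    refine Finset.sum_congr rfl fun f _ => ?_
    rw [map_smul, ext_e, hz, zsmul_eq_mul]; ring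
  have hrC : ∀ l : List X, rr ℤ v p l ∈ Sp ℤ (L l.length (Car v p l)) := fun l =>
    Sp_mono (L_mono (fun x hx => Or.inr hx)) (rr_mem v p l)
  refine ⟨m, hm0, δ, hδ, fun l => C l + m * ext ℤ u (h l), ?_, ?_⟩
  · intro l hl hlen
    have key := cocycle_htpy u (hh1 l) (hh2 l) (by
      intro l' hl'
      exact hu l' (Car_small hp hl (by linarith) hδ hl'.2) (by rw [hl'.1, hlen]))
    rw [ext_add, ext_mul_left, key, mul_add]
    congr 1
    have h1 : ((ext ℤ C (bdl ℤ l) : ℤ) : ℚ) = ((m * ext ℤ u (rr ℤ v p l) : ℤ) : ℚ) := by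
      rw [← ext_cast]
      rw [ext_bdl_congr (u' := fun l => (m : ℤ) • ext ℤ c (rr ℤ v p l)) (fun l' hl' _ => by
        rw [hCc l' (by omega)]; simp)]
      have h2 := ext_smul (R := ℤ) (m : ℤ) (fun l => ext ℤ c (rr ℤ v p l)) (bdl ℤ l)
      rw [h2, ← map_ext, ← (rr_cm (R := ℤ) v p).chain, ext_bd]
      push_cast
      rw [← ext_cast, zsmul_eq_mul]
      push_cast
      congr 1
      refine ext_congr (hrC l) fun l' hl' => ?_
      rw [← hc1 l' (Car_small hp hl (by linarith) hδ hl'.2) (by rw [hl'.1, hlen]), bridge (S := ℚ)]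
    exact_mod_cast h1
  · intro l hl hlen hn
    have h1 : (C l : ℚ) = 0 := by
      rw [hCc l hlen, ext_zero_of (hrC l), mul_zero]
      intro l' hl'
      exact hc2 l' (Car_small hp hl (by linarith) hδ hl'.2) (by rw [hl'.1, hlen]) (Car_near hp hn (by linarith) hδ hl'.2)
    have h2 : C l = 0 := by exact_mod_cast h1
    beta_reduce
    rw [h2, ext_zero_of (hh2 l), mul_zero, add_zero]
    intro l' hl'
    exact hA l' (Car_small hp hl (by linarith) hδ hl'.2) (by rw [hl'.1, hlen]) (Car_near hp hn (by linarith) hδ hl'.2)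

lemma pstep {q p : ℕ} (hp : p.Prime) (hV : Van X (ZMod p) q) (A : Set X) (u : List X → ℤ) {ε : ℝ} (hε : 0 < ε)
    (hu : ∀ l, Small ε l → l.length = q + 2 → (p : ℤ) ∣ ext ℤ u (bdl ℤ l))
    (hA : ∀ l, Small ε l → l.length = q + 1 → NearAll ε A l → u l = 0) :
    ∃ ε' > 0, ∃ c g : List X → ℤ,
      (∀ l, Small ε' l → l.length = q + 1 → u l = ext ℤ c (bdl ℤ l) + p * g l) ∧
      (∀ l, Small ε' l → l.length = q → NearAll ε' A l → c l = 0) ∧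
      ∀ l, Small ε' l → l.length = q + 1 → NearAll ε' A l → g l = 0 := by
  have : Fact p.Prime := ⟨hp⟩
  obtain ⟨ε₁, hε₁, c, hc1, hc2⟩ := hV A (fun l => (u l : ZMod p)) ε hε
    (fun l h1 h2 => by
      rw [bridge, ext_cast]
      exact (ZMod.intCast_zmod_eq_zero_iff_dvd _ p).2 (hu l h1 h2))
    (fun l h1 h2 h3 => by simp [hA l h1 h2 h3])
  set c' : List X → ℤ := fun l => (c l).val with hc'
  have hdv : ∀ l, Small ε₁ l → l.length = q + 1 → (p : ℤ) ∣ u l - ext ℤ c' (bdl ℤ l) := by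
    intro l h1 h2
    rw [← ZMod.intCast_zmod_eq_zero_iff_dvd]
    push_cast
    rw [← ext_cast, ← hc1 l h1 h2, bridge, sub_eq_zero]
    simp only [hc']
    simp
  have hp0 : (p : ℤ) ≠ 0 := by exact_mod_cast hp.ne_zero
  refine ⟨min ε ε₁, by positivity, c', fun l => (u l - ext ℤ c' (bdl ℤ l)) / p, ?_, ?_, ?_⟩
  · intro l h1 h2
    beta_reduce
    rw [Int.mul_ediv_cancel' (hdv l (h1.mono (min_le_right _ _)) h2)]; ring
  · intro l h1 h2 h3
    simp only [hc']
    rw [hc2 l (h1.mono (min_le_right _ _)) h2 (h3.mono (min_le_right _ _))]; simp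
  · intro l h1 h2 h3
    beta_reduce
    rw [hA l (h1.mono (min_le_left _ _)) h2 (h3.mono (min_le_left _ _))]
    rw [ext_bdl_congr (u' := fun _ => 0), ext_zero_of (S := univ) (by simp [Sp]) (by simp)]
    · simp
    · intro l' hl' hs
      simp only [hc']
      rw [hc2 l' ((h1.mono (min_le_right _ _)).sub hs) (by omega) ((h3.mono (min_le_right _ _)).sub hs)]; simp

lemma modm {q : ℕ} (hV : ∀ p : ℕ, p.Prime → Van X (ZMod p) q) (A : Set X) (u : List X → ℤ) {ε : ℝ} (hε : 0 < ε)
    (hu : ∀ l, Small ε l → l.length = q + 2 → ext ℤ u (bdl ℤ l) = 0)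
    (hA : ∀ l, Small ε l → l.length = q + 1 → NearAll ε A l → u l = 0) (m : ℕ) (hm : m ≠ 0) :
    ∃ ε' > 0, ∃ c g : List X → ℤ,
      (∀ l, Small ε' l → l.length = q + 1 → u l = ext ℤ c (bdl ℤ l) + m * g l) ∧
      (∀ l, Small ε' l → l.length = q → NearAll ε' A l → c l = 0) ∧
      (∀ l, Small ε' l → l.length = q + 1 → NearAll ε' A l → g l = 0) ∧
      (∀ l, Small ε' l → l.length = q + 2 → ext ℤ g (bdl ℤ l) = 0) := by
  have hcoc : ∀ (m : ℕ), m ≠ 0 → ∀ (ε' : ℝ) (c g : List X → ℤ), ε' ≤ ε →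
      (∀ l, Small ε' l → l.length = q + 1 → u l = ext ℤ c (bdl ℤ l) + m * g l) →
      (∀ l, Small ε' l → l.length = q + 2 → ext ℤ g (bdl ℤ l) = 0) := by
    intro m hm ε' c g hε' h l h1 h2
    have h3 := hu l (h1.mono hε') h2
    rw [ext_bdl_congr (u' := fun l => ext ℤ c (bdl ℤ l) + m * g l) (fun l' hl' hs => h l' (h1.sub hs) (by omega)),
      ext_add, ext_bdl_bdl, zero_add, ext_mul_left] at h3
    rcases mul_eq_zero.1 h3 with h4 | h4
    · exact absurd (by exact_mod_cast h4) hm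
    · exact h4
  suffices H : ∃ ε' > 0, ε' ≤ ε ∧ ∃ c g : List X → ℤ,
      (∀ l, Small ε' l → l.length = q + 1 → u l = ext ℤ c (bdl ℤ l) + m * g l) ∧
      (∀ l, Small ε' l → l.length = q → NearAll ε' A l → c l = 0) ∧
      (∀ l, Small ε' l → l.length = q + 1 → NearAll ε' A l → g l = 0) by
    obtain ⟨ε', h1, h2, c, g, h3, h4, h5⟩ := H
    exact ⟨ε', h1, c, g, h3, h4, h5, hcoc m hm ε' c g h2 h3⟩
  induction m using induction_on_primes with
  | zero => exact absurd rfl hm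
  | one =>
    exact ⟨ε, hε, le_rfl, fun _ => 0, u, fun l h1 h2 => by
      rw [ext_zero_of (S := univ) (by simp [Sp]) (by simp)]; simp, fun _ _ _ _ => rfl, hA⟩
  | prime_mul p a hp ih =>
    have ha : a ≠ 0 := by rintro rfl; simp at hm
    obtain ⟨ε₁, hε₁, hle, c₁, g₁, h1, h2, h3⟩ := ih ha
    obtain ⟨ε₂, hε₂, c₂, g₂, k1, k2, k3⟩ := pstep hp (hV p hp) A g₁ hε₁
      (fun l h1' h2' => by rw [hcoc a ha ε₁ c₁ g₁ hle h1 l h1' h2']; simp) h3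
    refine ⟨min ε₁ ε₂, by positivity, (min_le_left _ _).trans hle, fun l => c₁ l + a * c₂ l, g₂, ?_, ?_, ?_⟩
    · intro l hl hlen
      rw [ext_add, ext_mul_left, h1 l (hl.mono (min_le_left _ _)) hlen, k1 l (hl.mono (min_le_right _ _)) hlen]
      push_cast; ring
    · intro l hl hlen hn
      beta_reduce
      rw [h2 l (hl.mono (min_le_left _ _)) hlen (hn.mono (min_le_left _ _)),
        k2 l (hl.mono (min_le_right _ _)) hlen (hn.mono (min_le_right _ _))]; simp
    · intro l hl hlen hn
      exact k3 l (hl.mono (min_le_right _ _)) hlen (hn.mono (min_le_right _ _))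

/-- integral vanishing from field coefficients -/
theorem van_int [CompactSpace X] [Nonempty X] {q : ℕ} (hQ : Van X ℚ (q + 1))
    (hV : ∀ p : ℕ, p.Prime → Van X (ZMod p) q) : Van X ℤ (q + 1) := by
  intro A u ε hε hu hA
  obtain ⟨m, hm, H⟩ := qfin hQ A u hε hu hA
  induction m using induction_on_primes with
  | zero => exact absurd rfl hm
  | one =>
    obtain ⟨ε', hε', c, h1, h2⟩ := H
    exact ⟨ε', hε', c, fun l hl hlen => by rw [h1 l hl hlen]; simp, h2⟩
  | prime_mul p a hp ih =>
    refine ih (by rintro rfl; simp at hm) ?_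
    obtain ⟨ε₁, hε₁, c, h1, h2⟩ := H
    obtain ⟨ε₂, hε₂, c₂, g₂, k1, k2, k3⟩ := pstep hp (hV p hp) A c hε₁
      (fun l h1' h2' => by rw [h1 l h1' h2', Nat.cast_mul, mul_assoc]; exact dvd_mul_right _ _) h2
    refine ⟨min ε₁ ε₂, by positivity, g₂, ?_, ?_⟩
    · intro l hl hlen
      have h3 := h1 l (hl.mono (min_le_left _ _)) hlen
      rw [ext_bdl_congr (u' := fun l => ext ℤ c₂ (bdl ℤ l) + p * g₂ l) (fun l' hl' hs =>
        k1 l' ((hl.mono (min_le_right _ _)).sub hs) (by omega)), ext_add, ext_bdl_bdl, zero_add, ext_mul_left,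
        Nat.cast_mul, mul_assoc] at h3
      exact mul_left_cancel₀ (by exact_mod_cast hp.ne_zero) h3
    · intro l hl hlen hn
      exact k3 l (hl.mono (min_le_right _ _)) hlen (hn.mono (min_le_right _ _))

theorem van_sq_int [CompactSpace X] [Nonempty X] {q : ℕ} (hq : 1 ≤ q) (hD : DimLE X q) (hQ : Van X ℚ q)
    (hV : ∀ p : ℕ, p.Prime → Van X (ZMod p) q) : Van (X × X) ℤ (2 * q) := by
  intro A u ε hε hu hA
  have hδ : 0 < ε / 8 := by positivity
  set δ := ε / 8 with hδe
  obtain ⟨N, v, p, ε₁, hε₁, hp, -, hs⟩ := exists_approx (hD δ hδ) univ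
  obtain ⟨h, hh1, hh2⟩ := TT_htpy (R := ℤ) v p
  have hom1 : ∀ f : Fin (q + 1) → Fin N, ∀ l, Small (min ε₁ δ) l → l.length = q + 2 →
      ext ℤ (om ℤ v f) (bdl ℤ l) = 0 :=
    fun f l hl hlen => om_cocycle (p := p) hs f l (hl.mono (min_le_left _ _)) hlen
  have hom2 : ∀ f : Fin (q + 1) → Fin N, ∀ l, Small (min ε₁ δ) l → l.length = q + 1 →
      NearAll (min ε₁ δ) (Far p δ f) l → om ℤ v f l = 0 :=
    fun f l _ _ hn => om_far (min_le_right _ _) hp f l hn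
  have key1 : ∀ f : Fin (q + 1) → Fin N, ∃ m : ℕ, m ≠ 0 ∧ ∃ ε' > 0, ∃ c : List X → ℤ,
      (∀ l, Small ε' l → l.length = q + 1 → ext ℤ c (bdl ℤ l) = m * om ℤ v f l) ∧
      ∀ l, Small ε' l → l.length = q → NearAll ε' (Far p δ f) l → c l = 0 := fun f =>
    qfin hQ (Far p δ f) (om ℤ v f) (ε := min ε₁ δ) (by positivity) (hom1 f) (hom2 f)
  choose m hm0 key1 using key1
  obtain ⟨ε₂, hε₂, key1⟩ := exists_unif key1 (by
    rintro f ε₁ ε₂ h12 ⟨c, h1, h2⟩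
    exact ⟨c, fun l hl => h1 l (hl.mono h12), fun l hl hlen hn => h2 l (hl.mono h12) hlen (hn.mono h12)⟩)
  choose E₀ hE1 hE2 using key1
  have key2 : ∀ fg : (Fin (q + 1) → Fin N) × (Fin (q + 1) → Fin N), ∃ ε' > 0, ∃ c g : List X → ℤ,
      (∀ l, Small ε' l → l.length = q + 1 → om ℤ v fg.2 l = ext ℤ c (bdl ℤ l) + m fg.1 * g l) ∧
      (∀ l, Small ε' l → l.length = q → NearAll ε' (Far p δ fg.2) l → c l = 0) ∧
      (∀ l, Small ε' l → l.length = q + 1 → NearAll ε' (Far p δ fg.2) l → g l = 0) ∧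
      (∀ l, Small ε' l → l.length = q + 2 → ext ℤ g (bdl ℤ l) = 0) := fun fg =>
    modm hV (Far p δ fg.2) (om ℤ v fg.2) (ε := min ε₁ δ) (by positivity) (hom1 _) (hom2 _) (m fg.1) (hm0 _)
  obtain ⟨ε₃, hε₃, key2⟩ := exists_unif key2 (by
    rintro f ε₁ ε₂ h12 ⟨c, g, h1, h2, h3, h4⟩
    exact ⟨c, g, fun l hl => h1 l (hl.mono h12), fun l hl hlen hn => h2 l (hl.mono h12) hlen (hn.mono h12),
      fun l hl hlen hn => h3 l (hl.mono h12) hlen (hn.mono h12), fun l hl => h4 l (hl.mono h12)⟩)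
  choose c₀ g₀ hc1 hc2 hg2 hg1 using key2
  -- truncate
  set E : (Fin (q + 1) → Fin N) → List X → ℤ := fun f l => if l.length = q then E₀ f l else 0 with hE
  set C : (Fin (q + 1) → Fin N) × (Fin (q + 1) → Fin N) → List X → ℤ := fun f l => if l.length = q then c₀ f l else 0 with hC
  set G : (Fin (q + 1) → Fin N) × (Fin (q + 1) → Fin N) → List X → ℤ := fun f l => if l.length = q + 1 then g₀ f l else 0 with hG
  have hEoff : ∀ f, ∀ l : List X, l.length ≠ q → E f l = 0 := fun f l hl => by simp only [hE]; rw [if_neg hl]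
  have hCoff : ∀ f, ∀ l : List X, l.length ≠ q → C f l = 0 := fun f l hl => by simp only [hC]; rw [if_neg hl]
  have hGoff : ∀ f, ∀ l : List X, l.length ≠ q + 1 → G f l = 0 := fun f l hl => by simp only [hG]; rw [if_neg hl]
  have homoff : ∀ f : Fin (q + 1) → Fin N, ∀ l : List X, l.length ≠ q + 1 → om ℤ v f l = 0 := by
    intro f l hl
    by_contra h
    exact hl (om_mem h).1
  have hE1' : ∀ f l, Small ε₂ l → l.length = q + 1 → ext ℤ (E f) (bdl ℤ l) = m f * om ℤ v f l := by
    intro f l hl hlen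
    rw [← hE1 f l hl hlen]
    exact ext_bdl_congr fun l' hl' _ => by simp only [hE]; rw [if_pos (by omega)]
  have hC1' : ∀ f l, Small ε₃ l → l.length = q + 1 → om ℤ v f.2 l = ext ℤ (C f) (bdl ℤ l) + m f.1 * G f l := by
    intro f l hl hlen
    rw [hc1 f l hl hlen]
    congr 1
    · exact ext_bdl_congr fun l' hl' _ => by simp only [hC]; rw [if_pos (by omega)]
    · simp only [hG]; rw [if_pos hlen]
  have hG1' : ∀ f l, Small ε₃ l → l.length = q + 2 → ext ℤ (G f) (bdl ℤ l) = 0 := by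
    intro f l hl hlen
    rw [← hg1 f l hl hlen]
    exact ext_bdl_congr fun l' hl' _ => by simp only [hG]; rw [if_pos (by omega)]
  have hE3 : ∀ f l, Small ε₂ l → E f l ≠ 0 → ∀ x ∈ l, ∀ i, dist x (p (f i)) < 2 * δ := by
    intro f l hl h0
    refine near_of_not_far hl fun hn => h0 ?_
    simp only [hE]
    split_ifs with hlen
    · exact hE2 f l hl hlen hn
    · rfl
  have hC3 : ∀ f l, Small ε₃ l → C f l ≠ 0 → ∀ x ∈ l, ∀ i, dist x (p (f.2 i)) < 2 * δ := by
    intro f l hl h0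
    refine near_of_not_far hl fun hn => h0 ?_
    simp only [hC]
    split_ifs with hlen
    · exact hc2 f l hl hlen hn
    · rfl
  have hG3 : ∀ f l, Small ε₃ l → G f l ≠ 0 → ∀ x ∈ l, ∀ i, dist x (p (f.2 i)) < 2 * δ := by
    intro f l hl h0
    refine near_of_not_far hl fun hn => h0 ?_
    simp only [hG]
    split_ifs with hlen
    · exact hg2 f l hl hlen hn
    · rfl
  have hom3 : ∀ (f : Fin (q + 1) → Fin N) l, Small δ l → om ℤ v f l ≠ 0 → ∀ x ∈ l, ∀ i, dist x (p (f i)) < 2 * δ := by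
    intro f l hl h0
    refine near_of_not_far hl fun hn => h0 (om_far le_rfl hp f l hn)
  set P : (Fin (q + 1) → Fin N) → List X := fun f => (List.ofFn f).map p with hP
  set W : (Fin (q + 1) → Fin N) × (Fin (q + 1) → Fin N) → ℤ := fun f => UU u (e ℤ (P f.1)) (e ℤ (P f.2)) with hW
  set b : List X → List X → ℤ := fun s t => ∑ f, (((-1 : ℤ) ^ q * W f * om ℤ v f.1 s) * C f t + (W f * E f.1 s) * G f t) with hb
  refine ⟨min (min ε₂ ε₃) (min ε₁ δ), by positivity, fun l => ext ℤ u (h l) + AW b l, ?_, ?_⟩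
  · intro l hl hlen
    have hl1 : Small ε₁ l := hl.mono ((min_le_right _ _).trans (min_le_left _ _))
    have hl2 : Small ε₂ l := hl.mono ((min_le_left _ _).trans (min_le_left _ _))
    have hl3 : Small ε₃ l := hl.mono ((min_le_left _ _).trans (min_le_right _ _))
    have hlm : Small (min ε₁ δ) l := hl.mono (min_le_right _ _)
    have hl4 : Small δ l := hl.mono ((min_le_right _ _).trans (min_le_right _ _))
    have hne : l ≠ [] := by rintro rfl; simp at hlen
    have hcarB : Car v p (l.map Prod.fst) ×ˢ Car v p (l.map Prod.snd) ⊆ Bl δ (l.map Prod.fst) ×ˢ Bl δ (l.map Prod.snd) :=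
      Set.prod_mono (Car_Bl hδ hp _) (Car_Bl hδ hp _)
    have key := cocycle_htpy u (hh1 l) (hh2 l) (by
      intro l' hl'
      refine hu l' (Bl_small hl4 (by linarith) fun x hx => hcarB (hl'.2 x hx)) ?_
      rw [hl'.1, hlen])
    rw [key, ext_TT v p u hne, ext_add, AW_bd l b (by
      intro s; simp only [hb]
      refine Finset.sum_eq_zero fun f _ => ?_
      rw [hCoff f [] (by simp; omega), hGoff f [] (by simp)]; simp)]
    have z1 : b [] (l.map Prod.snd) = 0 := by
      simp only [hb]
      refine Finset.sum_eq_zero fun f _ => ?_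
      rw [hEoff f.1 [] (by simp; omega), homoff f.1 [] (by simp)]; simp
    rw [z1, sub_zero, add_comm]
    congr 1
    refine AW_congr l ?_
    intro s t hs0 ht0 hst hsl htl
    have hs2 : Small ε₂ s := hl2.fst.sub hsl
    have ht3 : Small ε₃ t := hl3.snd.sub htl
    simp only [hb]
    rw [pbd_sum]
    have hpadd : ∀ f : (Fin (q + 1) → Fin N) × (Fin (q + 1) → Fin N),
        pbd ℤ (fun s t => ((-1 : ℤ) ^ q * W f * om ℤ v f.1 s) * C f t + (W f * E f.1 s) * G f t) s t =
        ((-1 : ℤ) ^ q * W f * ext ℤ (om ℤ v f.1) (bdl ℤ s) * C f t +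
          (-1) ^ (s.length + 1) * (((-1 : ℤ) ^ q * W f * om ℤ v f.1 s) * ext ℤ (C f) (bdl ℤ t))) +
        (W f * ext ℤ (E f.1) (bdl ℤ s) * G f t +
          (-1) ^ (s.length + 1) * ((W f * E f.1 s) * ext ℤ (G f) (bdl ℤ t))) := by
      intro f
      have h1 := pbd_mul (fun s => (-1 : ℤ) ^ q * W f * om ℤ v f.1 s) (C f) s t
      have h2 := pbd_mul (fun s => W f * E f.1 s) (G f) s t
      rw [ext_mul_left] at h1 h2
      rw [← h1, ← h2]
      simp only [pbd, ext2_e_left, ext2_e_right, ext_add, smul_add]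
      abel
    simp only [hpadd]
    change _ = UU u (rr ℤ v p s) (rr ℤ v p t)
    by_cases c1 : s.length = q + 1
    · have ht : t.length = q + 1 := by omega
      rw [rr_expand v p c1, rr_expand v p ht]
      simp only [map_sum, LinearMap.sum_apply, map_smul, LinearMap.smul_apply, smul_eq_mul, Finset.mul_sum]
      rw [Finset.sum_comm, ← Fintype.sum_prod_type']
      refine Finset.sum_congr rfl fun f _ => ?_
      rw [hCoff f t (by omega), hEoff f.1 s (by omega), hE1' f.1 s hs2 c1, c1, hC1' f t ht3 ht]
      have hsq : (-1 : ℤ) ^ (q + 1 + 1) * (-1) ^ q = 1 := by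
        rw [← pow_add, show q + 1 + 1 + q = 2 * (q + 1) by ring, pow_mul]; simp
      have hWf : W f = UU u (e ℤ (List.map p (List.ofFn f.1))) (e ℤ (List.map p (List.ofFn f.2))) := rfl
      rw [← hWf]
      linear_combination (W f * om ℤ v f.1 s * ext ℤ (C f) (bdl ℤ t)) * hsq
    · have hz : UU u (rr ℤ v p s) (rr ℤ v p t) = 0 := by
        have hrr0 : ∀ s, Small ε₁ s → q + 1 < s.length → rr ℤ v p s = 0 := by
          intro s h1 h2
          have hne : s ≠ [] := by rintro rfl; simp at h2
          rw [rr, rr_zero (hs s hne h1) h2, map_zero]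
        rcases lt_or_gt_of_ne c1 with h1 | h1
        · rw [hrr0 t (hl1.snd.sub htl) (by omega), map_zero]
        · rw [hrr0 s (hl1.fst.sub hsl) h1, map_zero, LinearMap.zero_apply]
      rw [hz]
      refine Finset.sum_eq_zero fun f _ => ?_
      rw [homoff f.1 s c1, ext_off (hEoff f.1) c1]
      have a1 : ext ℤ (om ℤ v f.1) (bdl ℤ s) * C f t = 0 := by
        by_cases c3 : s.length = q + 2
        · rw [hom1 f.1 s (hlm.fst.sub hsl) c3, zero_mul]
        · rw [ext_off (homoff f.1) c3, zero_mul]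
      have a2 : E f.1 s * ext ℤ (G f) (bdl ℤ t) = 0 := by
        by_cases c3 : t.length = q + 2
        · rw [hG1' f t ht3 c3, mul_zero]
        · rw [ext_off (hGoff f) c3, mul_zero]
      linear_combination (-1 : ℤ) ^ q * W f * a1 + (-1 : ℤ) ^ (s.length + 1) * W f * a2
  · intro l hl hlen hnear
    have hl2 : Small ε₂ l := hl.mono ((min_le_left _ _).trans (min_le_left _ _))
    have hl3 : Small ε₃ l := hl.mono ((min_le_left _ _).trans (min_le_right _ _))
    have hl4 : Small δ l := hl.mono ((min_le_right _ _).trans (min_le_right _ _))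
    have hn4 : NearAll δ A l := hnear.mono ((min_le_right _ _).trans (min_le_right _ _))
    have hcarB : Car v p (l.map Prod.fst) ×ˢ Car v p (l.map Prod.snd) ⊆ Bl δ (l.map Prod.fst) ×ˢ Bl δ (l.map Prod.snd) :=
      Set.prod_mono (Car_Bl hδ hp _) (Car_Bl hδ hp _)
    have hz : ∀ l' : List (X × X), (∀ x ∈ l', x ∈ Bl δ (l.map Prod.fst) ×ˢ Bl δ (l.map Prod.snd)) →
        l'.length = 2 * q + 1 → u l' = 0 := by
      intro l' h1 h2
      exact hA l' (Bl_small hl4 (by linarith) h1) (by omega) (Bl_near hn4 (by linarith) h1)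
    beta_reduce
    rw [ext_zero_of (hh2 l) (fun l' hl' => hz l' (fun x hx => hcarB (hl'.2 x hx)) (by rw [hl'.1]; omega)),
      AW_zero_of l, add_zero]
    intro s t hs0 ht0 hst hsl htl
    simp only [hb]
    refine Finset.sum_eq_zero fun f _ => ?_
    have hWz : (P f.1 ∈ L (q + 1) (Bl δ (l.map Prod.fst))) → (P f.2 ∈ L (q + 1) (Bl δ (l.map Prod.snd))) → W f = 0 := by
      intro h1 h2
      exact UU_zero (e_mem h1) (e_mem h2) fun l' hl' => hz l' hl'.2 (by rw [hl'.1]; omega)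
    have a1 : W f * om ℤ v f.1 s * C f t = 0 := by
      by_cases h1 : om ℤ v f.1 s = 0
      · simp [h1]
      by_cases h2 : C f t = 0
      · simp [h2]
      rw [hWz (P_Bl hs0 (hom3 f.1 s (hl4.fst.sub hsl) h1) hsl) (P_Bl ht0 (hC3 f t (hl3.snd.sub htl) h2) htl)]; simp
    have a2 : W f * E f.1 s * G f t = 0 := by
      by_cases h1 : E f.1 s = 0
      · simp [h1]
      by_cases h2 : G f t = 0
      · simp [h2]
      rw [hWz (P_Bl hs0 (hE3 f.1 s (hl2.fst.sub hsl) h1) hsl) (P_Bl ht0 (hG3 f t (hl3.snd.sub htl) h2) htl)]; simp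
    linear_combination (-1 : ℤ) ^ q * a1 + a2

end uct
end MDP

namespace MDP
section geo

/-- gluing over finite closed covers -/
lemma glue {X Y ι : Type*} [TopologicalSpace X] [TopologicalSpace Y] [Finite ι] (C : ι → Set X) (f : ι → X → Y)
    (hC : ∀ i, IsClosed (C i)) (hcov : ∀ x, ∃ i, x ∈ C i) (hf : ∀ i, ContinuousOn (f i) (C i))
    (hag : ∀ i j x, x ∈ C i → x ∈ C j → f i x = f j x) :
    ∃ g : X → Y, Continuous g ∧ ∀ i, ∀ x ∈ C i, g x = f i x := by
  choose i hi using hcov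
  have h1 : ∀ j, ∀ x ∈ C j, f (i x) x = f j x := fun j x hx => hag _ _ x (hi x) hx
  refine ⟨fun x => f (i x) x, ?_, h1⟩
  refine (locallyFinite_of_finite C).continuous (iUnion_eq_univ_iff.2 fun x => ⟨i x, hi x⟩) hC fun j => ?_
  exact (hf j).congr (h1 j)

/-- nonconstant vectors -/
def NC {n : ℕ} (v : Fin n → ℝ) : Prop := ∃ i j, v i ≠ v j

/-- clamp to the unit interval -/
noncomputable def clamp (x : ℝ) : ℝ := max 0 (min 1 x)

lemma clamp_cont : Continuous clamp := by unfold clamp; fun_prop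
lemma clamp_mono : Monotone clamp := fun x y h => max_le_max le_rfl (min_le_min le_rfl h)
lemma clamp_of_le {x : ℝ} (h : x ≤ 0) : clamp x = 0 := by
  unfold clamp; rw [min_eq_right (by linarith), max_eq_left h]
lemma clamp_of_ge {x : ℝ} (h : 1 ≤ x) : clamp x = 1 := by
  unfold clamp; rw [min_eq_left h]; simp
lemma clamp_of_mem {x : ℝ} (h0 : 0 ≤ x) (h : x ≤ 1) : clamp x = x := by
  unfold clamp; rw [min_eq_right h, max_eq_right h0]

lemma clamp_nonneg (x : ℝ) : 0 ≤ clamp x := le_max_left _ _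
lemma clamp_le_one (x : ℝ) : clamp x ≤ 1 := max_le (by norm_num) (min_le_left _ _)

variable (n : ℕ)

/-- bump -/
noncomputable def bz (z : Fin (n + 1) → ℝ) : ℝ :=
  ∏ j : Fin (n + 1), if j = 0 ∨ j = Fin.last n then 1 else max 0 (1 - n * |(n + 1) * z j - 1|)

/-- ramp -/
noncomputable def wz (z : Fin (n + 1) → ℝ) : ℝ := clamp ((n * (n + 1) * z 0 - (n - 1)) / 2)

/-- amplitude -/
noncomputable def am (z : Fin (n + 1) → ℝ) (s : ℝ) : ℝ := bz n z * ((1 + Real.cos s) / 2)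

/-- raw coordinates -/
noncomputable def yy (z : Fin (n + 1) → ℝ) (s : ℝ) (j : Fin (n + 1)) : ℝ :=
  if j = Fin.last n then 0 else if j = 0 then am n z s * Real.sin s else am n z s * ((n + 1) * z j - 1)

/-- the basic map -/
noncomputable def Psi (z : Fin (n + 1) → ℝ) (s : ℝ) : Fin (n + 2) → ℝ :=
  Fin.snoc (α := fun _ => ℝ) (fun j : Fin (n + 1) => if j = Fin.last n then - ∑ i, yy n z s i else yy n z s j) (1 - 2 * am n z s)

/-- base point -/
noncomputable def star : Fin (n + 2) → ℝ := Fin.snoc (α := fun _ => ℝ) (fun _ : Fin (n + 1) => (0 : ℝ)) 1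

variable {n}

lemma bz_cont : Continuous (bz n) := by
  unfold bz
  refine continuous_finset_prod _ fun j _ => ?_
  split_ifs
  · exact continuous_const
  · fun_prop

lemma wz_cont : Continuous (wz n) := by
  unfold wz
  exact clamp_cont.comp (by fun_prop)

lemma bz_nonneg (z : Fin (n + 1) → ℝ) : 0 ≤ bz n z :=
  Finset.prod_nonneg fun j _ => by split_ifs <;> simp

lemma am_nonneg (z : Fin (n + 1) → ℝ) (s : ℝ) : 0 ≤ am n z s :=
  mul_nonneg (bz_nonneg z) (by have := Real.neg_one_le_cos s; linarith)

lemma am_cont : Continuous (fun zs : (Fin (n + 1) → ℝ) × ℝ => am n zs.1 zs.2) := by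
  unfold am
  have := (bz_cont (n := n)).comp (continuous_fst : Continuous (fun zs : (Fin (n + 1) → ℝ) × ℝ => zs.1))
  have h2 : Continuous (fun zs : (Fin (n + 1) → ℝ) × ℝ => bz n zs.1) := this
  fun_prop

lemma yy_cont (j : Fin (n + 1)) : Continuous (fun zs : (Fin (n + 1) → ℝ) × ℝ => yy n zs.1 zs.2 j) := by
  have h := am_cont (n := n)
  unfold yy
  split_ifs
  · exact continuous_const
  · fun_prop
  · fun_prop

lemma Psi_cont : Continuous (fun zs : (Fin (n + 1) → ℝ) × ℝ => Psi n zs.1 zs.2) := by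
  refine continuous_pi fun i => ?_
  refine Fin.lastCases ?_ (fun j => ?_) i
  · simp only [Psi, Fin.snoc_last]
    have h := am_cont (n := n)
    fun_prop
  · simp only [Psi, Fin.snoc_castSucc]
    split_ifs
    · exact (continuous_finset_sum _ fun j _ => yy_cont j).neg
    · exact yy_cont j

lemma Psi_zero {z : Fin (n + 1) → ℝ} {s : ℝ} (h : am n z s = 0) : Psi n z s = star n := by
  have hy : ∀ j, yy n z s j = 0 := by intro j; simp [yy, h]
  simp [Psi, star, hy, h]

lemma star_NC : NC (star n) := by
  refine ⟨Fin.last _, 0, ?_⟩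
  have : (0 : Fin (n + 2)) = Fin.castSucc 0 := rfl
  rw [this]
  unfold star
  rw [Fin.snoc_last, Fin.snoc_castSucc]; norm_num

lemma Psi_sum (z : Fin (n + 1) → ℝ) (s : ℝ) : ∑ j : Fin (n + 1), Psi n z s j.castSucc = 0 := by
  simp only [Psi, Fin.snoc_castSucc]
  rw [← Finset.add_sum_erase _ _ (Finset.mem_univ (Fin.last n))]
  rw [if_pos rfl, ← Finset.add_sum_erase (f := fun i => yy n z s i) _ (Finset.mem_univ (Fin.last n))]
  rw [Finset.sum_congr rfl (g := fun i => yy n z s i) (fun i hi => if_neg (Finset.ne_of_mem_erase hi))]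
  simp [yy]

lemma Psi_seg (hn : 1 ≤ n) {z : Fin (n + 1) → ℝ} {s τ C : ℝ} (h0 : 0 ≤ τ) (h1 : τ ≤ 1)
    (hs : τ = 0 ∨ (∑ i, z i = 1 ∧ (1 / ((n : ℝ) + 1) < z 0 → 0 ≤ Real.sin s) ∧ (z 0 < 1 / ((n : ℝ) + 1) → Real.sin s ≤ 0) ∧
      (z 0 = 1 / ((n : ℝ) + 1) → Real.cos s = 1)))
    (hc : ∀ i, (1 - τ) * Psi n z s i + τ * (Fin.snoc (α := fun _ => ℝ) z 0 : Fin (n + 2) → ℝ) i = C) : False := by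
  have hn1 : (0 : ℝ) < (n : ℝ) + 1 := by positivity
  have hsum : ∑ j : Fin (n + 1), ((1 - τ) * Psi n z s j.castSucc + τ * z j) = ∑ j : Fin (n + 1), C := by
    refine Finset.sum_congr rfl fun j _ => ?_
    rw [← hc j.castSucc, Fin.snoc_castSucc]
  rw [Finset.sum_add_distrib, ← Finset.mul_sum, ← Finset.mul_sum, Psi_sum] at hsum
  simp only [Finset.sum_const, Finset.card_univ, Fintype.card_fin, nsmul_eq_mul] at hsum
  push_cast at hsum
  have hC : C = τ / ((n : ℝ) + 1) := by
    rw [eq_div_iff hn1.ne']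
    rcases hs with rfl | hs
    · linarith
    · rw [hs.1] at hsum; linarith
  have hlast := hc (Fin.last _)
  simp only [Psi, Fin.snoc_last] at hlast
  have ham := am_nonneg z s
  have hcs : ∀ j : Fin (n + 1), j ≠ Fin.last n → (1 - τ) * yy n z s j + τ * z j = C := by
    intro j hj
    have := hc j.castSucc
    simpa only [Psi, Fin.snoc_castSucc, if_neg hj] using this
  have hz : ∀ j : Fin (n + 1), j ≠ Fin.last n → j ≠ 0 → (n + 1) * z j - 1 = 0 := by
    intro j hj hj0
    have h2 := hcs j hj
    simp only [yy, if_neg hj, if_neg hj0] at h2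
    have h3 : ((1 - τ) * am n z s * (n + 1) + τ) * ((n + 1) * z j - 1) = 0 := by
      rw [hC] at h2
      field_simp at h2
      linear_combination h2
    rcases mul_eq_zero.1 h3 with h4 | h4
    · exfalso
      have h5 : 0 ≤ (1 - τ) * am n z s := mul_nonneg (by linarith) ham
      have h6 : 0 ≤ (1 - τ) * am n z s * (n + 1) := by positivity
      have h7 : τ = 0 := by linarith
      subst h7
      have h8 : am n z s = 0 := by
        rcases mul_eq_zero.1 (show am n z s * ((n : ℝ) + 1) = 0 by linarith) with h | h
        · exact h
        · linarith
      rw [h8, hC] at hlast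
      simp at hlast
    · exact h4
  have hb : bz n z = 1 := by
    refine Finset.prod_eq_one fun j _ => ?_
    split_ifs with h
    · rfl
    · push Not at h
      rw [hz j h.2 h.1]; simp
  have h0l : (0 : Fin (n + 1)) ≠ Fin.last n := by
    intro h
    have := congrArg Fin.val h
    simp at this; omega
  have h2 := hcs 0 h0l
  simp only [yy, if_neg h0l, if_true] at h2
  have hamc : am n z s = (1 + Real.cos s) / 2 := by rw [am, hb, one_mul]
  rcases hs with rfl | ⟨-, s1, s2, s3⟩
  · rw [hC, zero_div] at h2 hlast
    have h3 : am n z s = 1 / 2 := by linarith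
    rw [h3] at h2
    have h4 : Real.sin s = 0 := by linarith
    have h5 : Real.cos s = 0 := by linarith
    have := Real.sin_sq_add_cos_sq s
    rw [h4, h5] at this; norm_num at this
  · have h3 : (1 - τ) * am n z s * Real.sin s = τ * (1 / ((n : ℝ) + 1) - z 0) := by
      rw [hC] at h2
      linear_combination h2
    have h5 : 0 ≤ (1 - τ) * am n z s := mul_nonneg (by linarith) ham
    rcases h0.eq_or_lt with rfl | hτ
    · rw [hC, zero_div] at hlast
      have h3' : am n z s = 1 / 2 := by linarith
      have h6 : Real.sin s = 0 := by rw [h3'] at h3; linarith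
      have h7 : Real.cos s = 0 := by linarith
      have := Real.sin_sq_add_cos_sq s
      rw [h6, h7] at this; norm_num at this
    rcases lt_trichotomy (z 0) (1 / ((n : ℝ) + 1)) with h | h | h
    · have := mul_nonneg h5 (neg_nonneg.2 (s2 h))
      have h6 : 0 < τ * (1 / ((n : ℝ) + 1) - z 0) := mul_pos hτ (by linarith)
      linarith
    · have h6 := s3 h
      rw [h6] at hamc
      rw [hamc, hC] at hlast
      have : 0 < τ / ((n : ℝ) + 1) := by positivity
      linarith
    · have := mul_nonneg h5 (s1 h)
      have h6 : 0 < τ * (z 0 - 1 / ((n : ℝ) + 1)) := mul_pos hτ (by linarith)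
      linarith

lemma Psi_NC (hn : 1 ≤ n) (z : Fin (n + 1) → ℝ) (s : ℝ) : NC (Psi n z s) := by
  by_contra h
  unfold NC at h
  push Not at h
  exact Psi_seg hn le_rfl zero_le_one (Or.inl rfl) (C := Psi n z s 0) (fun i => by rw [h i 0]; ring)

/-- phase form -/
noncomputable def PS (n : ℕ) (z : Fin (n + 1) → ℝ) (x : ℝ) : Fin (n + 2) → ℝ := Psi n z (-Real.pi + 2 * Real.pi * x)

lemma PS_cont : Continuous (fun zs : (Fin (n + 1) → ℝ) × ℝ => PS n zs.1 zs.2) := by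
  unfold PS
  exact Psi_cont.comp (by fun_prop : Continuous (fun zs : (Fin (n + 1) → ℝ) × ℝ => (zs.1, -Real.pi + 2 * Real.pi * zs.2)))

lemma PS_add_int (z : Fin (n + 1) → ℝ) (x : ℝ) (k : ℤ) : PS n z (x + k) = PS n z x := by
  have h1 : Real.cos (-Real.pi + 2 * Real.pi * (x + k)) = Real.cos (-Real.pi + 2 * Real.pi * x) := by
    rw [← Real.cos_add_int_mul_two_pi (-Real.pi + 2 * Real.pi * x) k]; congr 1; ring
  have h2 : Real.sin (-Real.pi + 2 * Real.pi * (x + k)) = Real.sin (-Real.pi + 2 * Real.pi * x) := by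
    rw [← Real.sin_add_int_mul_two_pi (-Real.pi + 2 * Real.pi * x) k]; congr 1; ring
  have h3 : am n z (-Real.pi + 2 * Real.pi * (x + k)) = am n z (-Real.pi + 2 * Real.pi * x) := by
    simp only [am, h1]
  have h4 : ∀ j, yy n z (-Real.pi + 2 * Real.pi * (x + k)) j = yy n z (-Real.pi + 2 * Real.pi * x) j := by
    intro j; simp only [yy, h3, h2]
  simp only [PS, Psi, h3, h4]

lemma PS_int (z : Fin (n + 1) → ℝ) (k : ℤ) : PS n z k = star n := by
  rw [← zero_add (k : ℝ), PS_add_int]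
  apply Psi_zero
  simp [am]

lemma PS_NC (hn : 1 ≤ n) (z : Fin (n + 1) → ℝ) (x : ℝ) : NC (PS n z x) := Psi_NC hn _ _

lemma PS_bz {z : Fin (n + 1) → ℝ} (h : bz n z = 0) (x : ℝ) : PS n z x = star n :=
  Psi_zero (by simp [am, h])

/-- boundary behaviour -/
lemma bdry (hn : 1 ≤ n) {z : Fin (n + 1) → ℝ} (hz : z ∈ stdSimplex ℝ (Fin (n + 1))) {i : Fin (n + 1)} (hi : z i = 0) :
    bz n z = 0 ∨ wz n z = 0 ∨ wz n z = 1 := by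
  have hn' : (1 : ℝ) ≤ n := by exact_mod_cast hn
  by_cases h0 : i = 0
  · right; left
    subst h0
    unfold wz
    rw [hi]
    apply clamp_of_le; linarith
  by_cases hl : i = Fin.last n
  · by_cases hb : bz n z = 0
    · left; exact hb
    right; right
    subst hl
    have h1 : ∀ j : Fin (n + 1), j ≠ 0 → j ≠ Fin.last n → n * ((n + 1) * z j - 1) ≤ 1 := by
      intro j hj0 hjl
      by_contra h
      apply hb
      refine Finset.prod_eq_zero (Finset.mem_univ j) ?_
      rw [if_neg (by tauto)]
      apply max_eq_left
      have := le_abs_self ((n + 1) * z j - 1)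
      have : (n : ℝ) * ((n + 1) * z j - 1) ≤ n * |(n + 1) * z j - 1| := mul_le_mul_of_nonneg_left this (by linarith)
      linarith
    unfold wz
    apply clamp_of_ge
    have h2 : ∑ j, (n * ((n + 1) * z j - 1)) ≤ ∑ j : Fin (n + 1), (if j = 0 then (n * ((n + 1) * z 0 - 1)) else if j = Fin.last n then - (n : ℝ) else 1) := by
      refine Finset.sum_le_sum fun j _ => ?_
      split_ifs with a b
      · rw [a]
      · rw [b, hi]; linarith
      · exact h1 j a b
    have h3 : ∑ j : Fin (n + 1), (if j = 0 then (n * ((n + 1) * z 0 - 1)) else if j = Fin.last n then - (n : ℝ) else 1)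
        = (n * ((n + 1) * z 0 - 1)) - n + (n - 1) := by
      have e1 : ∀ j : Fin (n + 1), (if j = 0 then ((n : ℝ) * ((n + 1) * z 0 - 1)) else if j = Fin.last n then - (n : ℝ) else 1)
        = (if j = 0 then ((n : ℝ) * ((n + 1) * z 0 - 1)) - 1 else 0) + (if j = Fin.last n then -(n : ℝ) - 1 else 0) + 1 := by
        intro j
        split_ifs with a b
        · exact absurd (a.symm.trans b) (Ne.symm (fun h => h0 h))
        · ring
        · ring
        · ring
      rw [Finset.sum_congr rfl (fun j _ => e1 j)]
      rw [Finset.sum_add_distrib, Finset.sum_add_distrib]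
      simp
      ring
    rw [h3, ← Finset.mul_sum, Finset.sum_sub_distrib, ← Finset.mul_sum, hz.2] at h2
    simp at h2
    linarith
  · left
    refine Finset.prod_eq_zero (Finset.mem_univ i) ?_
    rw [if_neg (by tauto), hi]
    apply max_eq_left
    simp; exact hn

lemma PS_bdry (hn : 1 ≤ n) {z : Fin (n + 1) → ℝ} (hz : z ∈ stdSimplex ℝ (Fin (n + 1))) {i : Fin (n + 1)} (hi : z i = 0)
    (θ : ℝ → ℝ) (h0 : ∃ k : ℤ, θ 0 = k) (h1 : ∃ k : ℤ, θ 1 = k) : PS n z (θ (wz n z)) = star n := by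
  rcases bdry hn hz hi with h | h | h
  · exact PS_bz h _
  · obtain ⟨k, hk⟩ := h0
    rw [h, hk, PS_int]
  · obtain ⟨k, hk⟩ := h1
    rw [h, hk, PS_int]

end geo
end MDP

namespace MDP
section filler

/-- relative gluing -/
lemma glueOn {X Y ι : Type*} [TopologicalSpace X] [TopologicalSpace Y] [Inhabited Y] [Finite ι] (S : Set X) (C : ι → Set X) (f : ι → X → Y)
    (hC : ∀ i, IsClosed (C i)) (hcov : ∀ x ∈ S, ∃ i, x ∈ C i) (hf : ∀ i, ContinuousOn (f i) (C i ∩ S))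
    (hag : ∀ i j, ∀ x ∈ S, x ∈ C i → x ∈ C j → f i x = f j x) :
    ∃ g : X → Y, ContinuousOn g S ∧ ∀ i, ∀ x ∈ S, x ∈ C i → g x = f i x := by
  classical
  obtain ⟨g, hg, hg2⟩ := glue (X := S) (Y := Y) (fun i => Subtype.val ⁻¹' C i) (fun i x => f i x)
    (fun i => (hC i).preimage continuous_subtype_val) (fun x => hcov x x.2)
    (fun i => (hf i).comp continuous_subtype_val.continuousOn (fun x hx => ⟨hx, x.2⟩))
    (fun i j x => hag i j x x.2)
  refine ⟨fun x => if h : x ∈ S then g ⟨x, h⟩ else default, ?_, ?_⟩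
  · rw [continuousOn_iff_continuous_restrict]
    convert hg using 1
    ext x; simp [Set.restrict]
  · intro i x hx hc
    simp only [dif_pos hx]
    exact hg2 i ⟨x, hx⟩ hc

variable {n : ℕ}

/-- ramps -/
noncomputable def rho (n : ℕ) (i : Fin (n + 1)) (w : ℝ) : ℝ := clamp ((n + 1) * w - i)

lemma rho_cont (i : Fin (n + 1)) : Continuous (rho n i) := clamp_cont.comp (by fun_prop)
lemma rho_mono (i : Fin (n + 1)) : Monotone (rho n i) := fun x y h => clamp_mono (by
  have : (0 : ℝ) ≤ n + 1 := by positivity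
  nlinarith)
lemma rho_le_one (i : Fin (n + 1)) (w : ℝ) : rho n i w ≤ 1 := clamp_le_one _
lemma rho_zero (i : Fin (n + 1)) : rho n i 0 = 0 := clamp_of_le (by simp)
lemma rho_one (i : Fin (n + 1)) : rho n i 1 = 1 := clamp_of_ge (by
  have : (i : ℕ) ≤ n := by omega
  have : ((i : ℕ) : ℝ) ≤ n := by exact_mod_cast this
  linarith)

lemma rho_ex {w : ℝ} (h0 : 0 ≤ w) : ∃ i0 : Fin (n + 1), ∀ i, (i < i0 → rho n i w = 1) ∧ (i0 < i → rho n i w = 0) := by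
  have hp : 0 ≤ ((n : ℝ) + 1) * w := by positivity
  refine ⟨⟨min (Nat.floor (((n : ℝ) + 1) * w)) n, by omega⟩, fun i => ⟨fun h => ?_, fun h => ?_⟩⟩
  · apply clamp_of_ge
    have h1 : (i : ℕ) + 1 ≤ Nat.floor (((n : ℝ) + 1) * w) := by
      have : (i : ℕ) < min (Nat.floor (((n : ℝ) + 1) * w)) n := h
      omega
    have := Nat.floor_le hp
    have h2 : (((i : ℕ) + 1 : ℕ) : ℝ) ≤ (Nat.floor (((n : ℝ) + 1) * w) : ℝ) := by exact_mod_cast h1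
    push_cast at h2
    linarith
  · apply clamp_of_le
    have h1 : Nat.floor (((n : ℝ) + 1) * w) + 1 ≤ (i : ℕ) := by
      have : min (Nat.floor (((n : ℝ) + 1) * w)) n < (i : ℕ) := h
      have := i.2
      omega
    have := Nat.lt_floor_add_one (((n : ℝ) + 1) * w)
    have h2 : ((Nat.floor (((n : ℝ) + 1) * w) + 1 : ℕ) : ℝ) ≤ (i : ℕ) := by exact_mod_cast h1
    push_cast at h2
    linarith

/-- degeneracy -/
noncomputable def sg (i : Fin (n + 1)) (t : Fin (n + 2) → ℝ) (j : Fin (n + 1)) : ℝ :=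
  ∑ m, if i.predAbove m = j then t m else 0

lemma sg_cont (i : Fin (n + 1)) : Continuous (sg i) := by
  unfold sg
  refine continuous_pi fun j => continuous_finset_sum _ fun m _ => ?_
  split_ifs <;> fun_prop

lemma push_simplex {a b : ℕ} (f : Fin a → Fin b) {t : Fin a → ℝ} (ht : t ∈ stdSimplex ℝ (Fin a)) :
    (fun j => ∑ m, if f m = j then t m else 0) ∈ stdSimplex ℝ (Fin b) := by
  refine ⟨fun j => Finset.sum_nonneg fun m _ => ?_, ?_⟩
  · split_ifs
    · exact ht.1 m
    · exact le_rfl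
  · rw [Finset.sum_comm, ← ht.2]
    exact Finset.sum_congr rfl fun m _ => by simp

lemma sg_simplex (i : Fin (n + 1)) {t : Fin (n + 2) → ℝ} (ht : t ∈ stdSimplex ℝ (Fin (n + 2))) : sg i t ∈ stdSimplex ℝ (Fin (n + 1)) :=
  push_simplex _ ht

lemma predAbove_val (i : Fin (n + 1)) (m : Fin (n + 2)) : (i.predAbove m : ℕ) = if (i : ℕ) < m then (m : ℕ) - 1 else m := by
  unfold Fin.predAbove
  split_ifs with h1 h2 h2
  · rfl
  · exact absurd h1 h2
  · exact absurd h2 h1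
  · rfl

lemma succAbove_val (l : Fin (n + 2)) (m : Fin (n + 1)) : (l.succAbove m : ℕ) = if (m : ℕ) < l then (m : ℕ) else m + 1 := by
  unfold Fin.succAbove
  split_ifs with h1 h2 h2
  · rfl
  · exact absurd h1 h2
  · exact absurd h2 h1
  · rfl

lemma sg_adj {i : Fin (n + 1)} {l : Fin (n + 2)} (h : l = i.castSucc ∨ l = i.succ) {t : Fin (n + 2) → ℝ} (ht : t l = 0) :
    sg i t = fun j => t (l.succAbove j) := by
  funext j
  unfold sg
  rw [Fin.sum_univ_succAbove _ l, ht, ite_self, zero_add]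
  have : ∀ m : Fin (n + 1), i.predAbove (l.succAbove m) = m := by
    intro m
    apply Fin.ext
    rw [predAbove_val, succAbove_val]
    rcases h with rfl | rfl
    · simp only [Fin.val_castSucc]; split_ifs <;> omega
    · simp only [Fin.val_succ]; split_ifs <;> omega
  simp [this]

lemma sg_nadj {i : Fin (n + 1)} {l : Fin (n + 2)} (h : ¬ (l = i.castSucc ∨ l = i.succ)) {t : Fin (n + 2) → ℝ} (ht : t l = 0) :
    sg i t (i.predAbove l) = 0 := by
  unfold sg
  refine Finset.sum_eq_zero fun m _ => ?_
  split_ifs with h2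
  · have : m = l := by
      apply Fin.ext
      have h3 := congrArg Fin.val h2
      rw [predAbove_val, predAbove_val] at h3
      simp only [Fin.ext_iff, Fin.val_castSucc, Fin.val_succ] at h
      split_ifs at h3 <;> omega
    rw [this, ht]
  · rfl

lemma sg_z {i : Fin (n + 1)} (hi : i ≠ 0) (t : Fin (n + 2) → ℝ) : sg i t 0 = t 0 := by
  unfold sg
  have hi' : (i : ℕ) ≠ 0 := fun h => hi (Fin.ext h)
  have : ∀ m : Fin (n + 2), (i.predAbove m = 0) ↔ m = 0 := by
    intro m
    rw [Fin.ext_iff, Fin.ext_iff, predAbove_val]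
    simp only [Fin.val_zero]
    split_ifs <;> omega
  simp [this]

lemma sg_z0 {t : Fin (n + 2) → ℝ} (ht : t ∈ stdSimplex ℝ (Fin (n + 2))) : t 0 ≤ sg (0 : Fin (n + 1)) t 0 := by
  unfold sg
  have h := Finset.single_le_sum (f := fun m => if (0 : Fin (n + 1)).predAbove m = 0 then t m else 0) (s := Finset.univ)
    (fun m _ => by
      split_ifs
      · exact ht.1 m
      · exact le_rfl) (Finset.mem_univ 0)
  have : (0 : Fin (n + 1)).predAbove (0 : Fin (n + 2)) = 0 := by
    apply Fin.ext; rw [predAbove_val]; simp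
  simpa [this] using h

lemma PS_cont' {X : Type*} [TopologicalSpace X] {f : X → Fin (n + 1) → ℝ} {g : X → ℝ} (hf : Continuous f) (hg : Continuous g) :
    Continuous (fun x => PS n (f x) (g x)) := by
  have h := PS_cont (n := n)
  generalize PS n = P at h ⊢
  exact h.comp (hf.prodMk hg)

/-- rough filler -/
noncomputable def F0 (M : ℕ → ℤ) (t : Fin (n + 2) → ℝ) : Fin (n + 2) → ℝ :=
  star n + ∑ i : Fin (n + 1), (PS n (sg i t) (M (i + 1) * rho n i (wz n (sg i t))) - star n)

lemma F0_cont (M : ℕ → ℤ) : Continuous (F0 (n := n) M) := by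
  have key : ∀ i : Fin (n + 1), Continuous (fun t : Fin (n + 2) → ℝ => PS n (sg i t) (M (i + 1) * rho n i (wz n (sg i t)))) := by
    intro i
    exact PS_cont' (sg_cont i) (continuous_const.mul ((rho_cont i).comp (wz_cont.comp (sg_cont i))))
  exact continuous_const.add (continuous_finset_sum _ fun i _ => (key i).sub continuous_const)

lemma PS_mul01 (z : Fin (n + 1) → ℝ) (N : ℤ) {r : ℝ} (h : r = 0 ∨ r = 1) : PS n z (N * r) = star n := by
  rcases h with rfl | rfl
  · simpa using PS_int z 0
  · simpa using PS_int z N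

lemma wz_nonneg (z : Fin (n + 1) → ℝ) : 0 ≤ wz n z := clamp_nonneg _

lemma F0_NC (hn : 1 ≤ n) (M : ℕ → ℤ) {t : Fin (n + 2) → ℝ} (ht : t ∈ stdSimplex ℝ (Fin (n + 2))) : NC (F0 M t) := by
  obtain ⟨i0, h0⟩ := rho_ex (n := n) (w := clamp ((n * (n + 1) * t 0 - (n - 1)) / 2)) (clamp_nonneg _)
  have key : ∀ i, i ≠ i0 → rho n i (wz n (sg i t)) = 0 ∨ rho n i (wz n (sg i t)) = 1 := by
    intro i hi
    by_cases hz : i = 0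
    · subst hz
      right
      have h1 : (0 : Fin (n + 1)) < i0 := lt_of_le_of_ne (Fin.zero_le _) hi
      refine le_antisymm (rho_le_one _ _) ?_
      rw [← (h0 0).1 h1]
      apply rho_mono
      apply clamp_mono
      have := sg_z0 ht
      have h3 : (0 : ℝ) ≤ n * (n + 1) := by positivity
      have := mul_le_mul_of_nonneg_left this h3
      linarith
    · have : wz n (sg i t) = clamp ((n * (n + 1) * t 0 - (n - 1)) / 2) := by rw [wz, sg_z hz]
      rw [this]
      rcases lt_or_gt_of_ne hi with h | h
      · right; exact (h0 i).1 h
      · left; exact (h0 i).2 h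
  have : F0 M t = PS n (sg i0 t) (M (i0 + 1) * rho n i0 (wz n (sg i0 t))) := by
    unfold F0
    rw [Finset.sum_eq_single i0]
    · simp
    · intro i _ hi
      rw [PS_mul01 _ _ (key i hi), sub_self]
    · simp
  rw [this]
  exact PS_NC hn _ _

/-- phases -/
noncomputable def th (M : ℕ → ℤ) (l : Fin (n + 2)) (w : ℝ) : ℝ :=
  ∑ i : Fin (n + 1), ((if l = i.castSucc ∨ l = i.succ then M (i + 1) else 0 : ℤ) : ℝ) * rho n i w

lemma th_cont (M : ℕ → ℤ) (l : Fin (n + 2)) : Continuous (th M l) :=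
  continuous_finset_sum _ fun i _ => continuous_const.mul (rho_cont i)

lemma th_zero (M : ℕ → ℤ) (l : Fin (n + 2)) : th M l 0 = 0 := by simp [th, rho_zero]

lemma th_one (M : ℕ → ℤ) (h0 : M 0 = 0) (h1 : M (n + 2) = 0) (l : Fin (n + 2)) : th M l 1 = ((M (l + 1) + M l : ℤ) : ℝ) := by
  simp only [th, rho_one, mul_one]
  norm_cast
  have e : ∀ i : Fin (n + 1), (if l = i.castSucc ∨ l = i.succ then M (i + 1) else 0)
      = (if l = i.castSucc then M (i + 1) else 0) + (if l = i.succ then M (i + 1) else 0) := by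
    intro i
    by_cases a : l = i.castSucc
    · have : l ≠ i.succ := by rw [a]; exact (Fin.castSucc_lt_succ).ne
      rw [if_pos (Or.inl a), if_pos a, if_neg this, add_zero]
    · by_cases b : l = i.succ
      · rw [if_pos (Or.inr b), if_neg a, if_pos b, zero_add]
      · rw [if_neg (by tauto), if_neg a, if_neg b, zero_add]
  rw [Finset.sum_congr rfl fun i _ => e i, Finset.sum_add_distrib]
  congr 1
  · refine Fin.lastCases ?_ (fun j => ?_) l
    · rw [Finset.sum_eq_zero]
      · simp [h1]
      · intro i _
        rw [if_neg (Fin.castSucc_lt_last i).ne']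
    · simp [Fin.castSucc_inj]
  · refine Fin.cases ?_ (fun j => ?_) l
    · rw [Finset.sum_eq_zero]
      · simp [h0]
      · intro i _
        rw [if_neg (Fin.succ_ne_zero i).symm]
    · simp [Fin.succ_inj]

lemma PS_sum (z : Fin (n + 1) → ℝ) (N : Fin (n + 1) → ℤ) {w : ℝ} (hw : 0 ≤ w) :
    star n + ∑ i, (PS n z (N i * rho n i w) - star n) = PS n z (∑ i, N i * rho n i w) := by
  obtain ⟨i0, h0⟩ := rho_ex (n := n) hw
  have key : ∀ i, i ≠ i0 → rho n i w = 0 ∨ rho n i w = 1 := by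
    intro i hi
    rcases lt_or_gt_of_ne hi with h | h
    · right; exact (h0 i).1 h
    · left; exact (h0 i).2 h
  rw [Finset.sum_eq_single i0]
  · have h1 : ∃ k : ℤ, ∑ i ∈ Finset.univ.erase i0, (N i : ℝ) * rho n i w = k := by
      refine ⟨∑ i ∈ Finset.univ.erase i0, if rho n i w = 0 then 0 else N i, ?_⟩
      push_cast
      refine Finset.sum_congr rfl fun i hi => ?_
      rcases key i (Finset.ne_of_mem_erase hi) with h | h
      · simp [h]
      · simp [h]
    obtain ⟨k, hk⟩ := h1
    rw [← Finset.add_sum_erase _ _ (Finset.mem_univ i0), hk, PS_add_int]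
    simp
  · intro i _ hi
    rw [PS_mul01 _ _ (key i hi), sub_self]
  · simp

lemma F0_face (hn : 1 ≤ n) (M : ℕ → ℤ) {t : Fin (n + 2) → ℝ} (ht : t ∈ stdSimplex ℝ (Fin (n + 2))) {l : Fin (n + 2)} (hl : t l = 0) :
    F0 M t = PS n (fun j => t (l.succAbove j)) (th M l (wz n (fun j => t (l.succAbove j)))) := by
  unfold F0 th
  rw [← PS_sum _ _ (wz_nonneg _)]
  congr 1
  refine Finset.sum_congr rfl fun i _ => ?_
  congr 1
  by_cases h : l = i.castSucc ∨ l = i.succ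
  · rw [if_pos h, sg_adj h hl]
  · rw [if_neg h, PS_bdry hn (sg_simplex i ht) (sg_nadj h hl) (fun x => M (i + 1) * rho n i x) ⟨0, by simp [rho_zero]⟩ ⟨M (i + 1), by simp [rho_one]⟩]
    have := PS_int (fun j => t (l.succAbove j)) 0
    simp at this ⊢
    exact this.symm

/-- normalized face coordinate -/
noncomputable def zl (l : Fin (n + 2)) (t : Fin (n + 2) → ℝ) (j : Fin (n + 1)) : ℝ :=
  (t (l.succAbove j) - t l) / (1 - (n + 2) * t l)

lemma zl_simplex {l : Fin (n + 2)} {t : Fin (n + 2) → ℝ} (ht : t ∈ stdSimplex ℝ (Fin (n + 2))) (h1 : ∀ i, t l ≤ t i) (h2 : 0 < 1 - (n + 2) * t l) :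
    zl l t ∈ stdSimplex ℝ (Fin (n + 1)) := by
  refine ⟨fun j => div_nonneg (sub_nonneg.2 (h1 _)) h2.le, ?_⟩
  unfold zl
  rw [← Finset.sum_div, div_eq_one_iff_eq h2.ne', Finset.sum_sub_distrib]
  have := ht.2
  rw [Fin.sum_univ_succAbove _ l] at this
  simp
  linarith

lemma filler (hn : 1 ≤ n) (k : Fin (n + 2) → ℤ) (hk : ∑ l : Fin (n + 2), (-1) ^ (l : ℕ) * k l = 0) :
    ∃ Φ : (Fin (n + 2) → ℝ) → (Fin (n + 2) → ℝ), ContinuousOn Φ (stdSimplex ℝ (Fin (n + 2))) ∧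
      (∀ t ∈ stdSimplex ℝ (Fin (n + 2)), NC (Φ t)) ∧
      ∀ t ∈ stdSimplex ℝ (Fin (n + 2)), ∀ l, t l = 0 → Φ t = PS n (fun j => t (l.succAbove j)) (k l * wz n (fun j => t (l.succAbove j))) := by
  obtain ⟨M, hM0, hM1, hM⟩ : ∃ M : ℕ → ℤ, M 0 = 0 ∧ M (n + 2) = 0 ∧ ∀ l : Fin (n + 2), M (l + 1) + M l = k l := by
    let K : ℕ → ℤ := fun j => if h : j < n + 2 then k ⟨j, h⟩ else 0
    refine ⟨fun i => (-1) ^ (i + 1) * ∑ j ∈ Finset.range i, (-1) ^ j * K j, by simp, ?_, ?_⟩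
    · have : ∑ j ∈ Finset.range (n + 2), (-1) ^ j * K j = 0 := by
        rw [Finset.sum_range, ← hk]
        refine Finset.sum_congr rfl fun l _ => ?_
        simp [K]
      simp only [this, mul_zero]
    · intro l
      simp only
      rw [Finset.sum_range_succ]
      have h1 : K l = k l := by simp [K]
      have h2 : ((-1 : ℤ) ^ (l : ℕ)) * (-1) ^ (l : ℕ) = 1 := by rw [← mul_pow]; simp
      rw [h1, pow_succ, pow_succ]
      linear_combination (k l) * h2
  have hk' : ∀ l, th M l 1 = (k l : ℝ) := fun l => by rw [th_one M hM0 hM1, hM]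
  have hN : (0 : ℝ) < n + 2 := by positivity
  set r0 : ℝ := 1 / (2 * (n + 2)) with hr0
  have hr0p : 0 < r0 := by positivity
  have hrN : (n + 2) * r0 = 1 / 2 := by rw [hr0]; field_simp
  let S := stdSimplex ℝ (Fin (n + 2))
  let C : Option (Fin (n + 2)) → Set (Fin (n + 2) → ℝ) := fun o =>
    o.elim {t | ∀ i, r0 ≤ t i} (fun l => {t | (∀ i, t l ≤ t i) ∧ t l ≤ r0})
  let f : Option (Fin (n + 2)) → (Fin (n + 2) → ℝ) → (Fin (n + 2) → ℝ) := fun o =>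
    o.elim (fun t => F0 M (fun i => 2 * t i - 2 * r0))
      (fun l t => PS n (zl l t) ((t l / r0) * th M l (wz n (zl l t)) + (1 - t l / r0) * (k l * wz n (zl l t))))
  have hden : ∀ l : Fin (n + 2), ∀ t : Fin (n + 2) → ℝ, t l ≤ r0 → 0 < 1 - (n + 2) * t l := by
    intro l t h
    have := mul_le_mul_of_nonneg_left h hN.le
    linarith
  have hS2 : ∀ t ∈ S, (∀ i, r0 ≤ t i) → (fun i => 2 * t i - 2 * r0) ∈ S := by
    intro t ht h
    refine ⟨fun i => by have := h i; linarith, ?_⟩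
    rw [Finset.sum_sub_distrib, ← Finset.mul_sum, ht.2]
    simp
    linarith
  have hbd : ∀ (l l' : Fin (n + 2)) (t : Fin (n + 2) → ℝ), t ∈ S → t ∈ C (some l) → l' ≠ l → t l' = t l → f (some l) t = star n := by
    intro l l' t ht hc hne he
    obtain ⟨j, rfl⟩ := Fin.exists_succAbove_eq hne
    have hz : zl l t j = 0 := by simp [zl, he]
    exact PS_bdry hn (zl_simplex ht hc.1 (hden l t hc.2)) hz (fun w => (t l / r0) * th M l w + (1 - t l / r0) * (k l * w))
      ⟨0, by simp [th_zero]⟩ ⟨k l, by simp only [hk']; ring⟩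
  have hcomp : ∀ (l : Fin (n + 2)) (t : Fin (n + 2) → ℝ), t ∈ S → t ∈ C (some l) → t ∈ C none → f (some l) t = f none t := by
    intro l t ht hc hc'
    have h1 : t l = r0 := le_antisymm hc.2 (hc' l)
    show PS n (zl l t) ((t l / r0) * th M l (wz n (zl l t)) + (1 - t l / r0) * (k l * wz n (zl l t))) = F0 M (fun i => 2 * t i - 2 * r0)
    rw [F0_face hn M (hS2 t ht hc') (l := l) (by simp [h1])]
    have hz : (fun j => 2 * t (l.succAbove j) - 2 * r0) = zl l t := by
      funext j
      unfold zl
      rw [h1, hrN]; ring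
    rw [hz, h1, div_self hr0p.ne']
    simp
  obtain ⟨Φ, hΦ, hΦ2⟩ := glueOn S C f (by
      rintro (_ | l)
      · show IsClosed {t : Fin (n + 2) → ℝ | ∀ i, r0 ≤ t i}
        rw [setOf_forall]
        exact isClosed_iInter fun i => isClosed_le continuous_const (continuous_apply i)
      · show IsClosed {t : Fin (n + 2) → ℝ | (∀ i, t l ≤ t i) ∧ t l ≤ r0}
        refine IsClosed.inter ?_ (isClosed_le (continuous_apply l) continuous_const)
        show IsClosed {t : Fin (n + 2) → ℝ | (∀ i, t l ≤ t i)}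
        rw [setOf_forall]
        exact isClosed_iInter fun i => isClosed_le (continuous_apply l) (continuous_apply i)) (by
      intro t _
      obtain ⟨l, hl⟩ := Finite.exists_min t
      by_cases h : t l ≤ r0
      · exact ⟨some l, hl, h⟩
      · exact ⟨none, fun i => (le_of_not_ge h).trans (hl i)⟩) (by
      rintro (_ | l)
      · exact ((F0_cont M).comp (by fun_prop : Continuous (fun t : Fin (n + 2) → ℝ => (fun i => 2 * t i - 2 * r0)))).continuousOn
      · have hz : ContinuousOn (zl l) (C (some l) ∩ S) := by
          refine continuousOn_pi.2 fun j => ?_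
          unfold zl
          refine ContinuousOn.div (by fun_prop) (by fun_prop) fun t ht => (hden l t ht.1.2).ne'
        have hw : ContinuousOn (fun t => wz n (zl l t)) (C (some l) ∩ S) := wz_cont.comp_continuousOn hz
        have ht : ContinuousOn (fun t => th M l (wz n (zl l t))) (C (some l) ∩ S) := (th_cont M l).comp_continuousOn hw
        refine PS_cont.comp_continuousOn (f := fun t => (zl l t, ((t l / r0) * th M l (wz n (zl l t)) + (1 - t l / r0) * (k l * wz n (zl l t))))) (hz.prodMk ?_)
        fun_prop) (by
      rintro (_ | l) (_ | l') t ht h h'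
      · rfl
      · exact (hcomp l' t ht h' h).symm
      · exact hcomp l t ht h h'
      · by_cases hll : l = l'
        · rw [hll]
        · have he : t l = t l' := le_antisymm (h.1 _) (h'.1 _)
          rw [hbd l l' t ht h (Ne.symm hll) he.symm, hbd l' l t ht h' hll he])
  refine ⟨Φ, hΦ, ?_, ?_⟩
  · intro t ht
    obtain ⟨l, hl⟩ := Finite.exists_min t
    by_cases h : t l ≤ r0
    · rw [hΦ2 (some l) t ht ⟨hl, h⟩]
      exact PS_NC hn _ _
    · have h' : t ∈ C none := fun i => (le_of_not_ge h).trans (hl i)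
      rw [hΦ2 none t ht h']
      exact F0_NC hn M (hS2 t ht h')
  · intro t ht l hl
    rw [hΦ2 (some l) t ht ⟨fun i => by rw [hl]; exact ht.1 i, by rw [hl]; exact hr0p.le⟩]
    have hz : zl l t = fun j => t (l.succAbove j) := by funext j; simp [zl, hl]
    show PS n (zl l t) ((t l / r0) * th M l (wz n (zl l t)) + (1 - t l / r0) * (k l * wz n (zl l t))) = _
    rw [hz, hl]; simp

end filler
end MDP

namespace MDP
section kap

/-- simplicial pushforward -/
noncomputable def Gm {a b : ℕ} (f : Fin a → Fin b) (t : Fin a → ℝ) (j : Fin b) : ℝ := ∑ m, if f m = j then t m else 0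

lemma Gm_cont {a b : ℕ} (f : Fin a → Fin b) : Continuous (Gm f) := by
  unfold Gm
  refine continuous_pi fun j => continuous_finsetSum _ fun m _ => ?_
  split_ifs <;> fun_prop

lemma Gm_simplex {a b : ℕ} (f : Fin a → Fin b) {t : Fin a → ℝ} (ht : t ∈ stdSimplex ℝ (Fin a)) : Gm f t ∈ stdSimplex ℝ (Fin b) :=
  push_simplex _ ht

lemma Gm_zero {a b : ℕ} {f : Fin a → Fin b} {t : Fin a → ℝ} {j : Fin b} (h : ∀ m, f m = j → t m = 0) : Gm f t j = 0 := by
  refine Finset.sum_eq_zero fun m _ => ?_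
  split_ifs with h1
  · exact h m h1
  · rfl

lemma Gm_comp {a b c : ℕ} (g : Fin c → Fin a) (hg : Function.Injective g) (f : Fin a → Fin b) {t : Fin a → ℝ}
    (h : ∀ m, m ∉ Set.range g → t m = 0) : Gm (f ∘ g) (t ∘ g) = Gm f t := by
  classical
  funext j
  unfold Gm
  have h1 : ∑ m ∈ Finset.univ.image g, (if f m = j then t m else 0) = ∑ m, if f m = j then t m else 0 := by
    refine Finset.sum_subset (Finset.subset_univ _) fun m _ hm => ?_
    rw [h m, ite_self]
    rintro ⟨x, rfl⟩
    exact hm (Finset.mem_image_of_mem _ (Finset.mem_univ _))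
  rw [← h1, Finset.sum_image (fun x _ y _ h => hg h)]
  rfl

variable {n : ℕ}

lemma seg_last (hn : 1 ≤ n) {z : Fin (n + 1) → ℝ} (hz : z ∈ stdSimplex ℝ (Fin (n + 1))) {τ : ℝ} (h0 : 0 ≤ τ) (h1 : τ ≤ 1) :
    NC (fun i => (1 - τ) * PS n z (wz n z) i + τ * (Fin.snoc (α := fun _ => ℝ) z 0 : Fin (n + 2) → ℝ) i) := by
  by_contra h
  unfold NC at h
  push Not at h
  have hn' : (1 : ℝ) ≤ n := by exact_mod_cast hn
  have hn1 : (0 : ℝ) < (n : ℝ) + 1 := by positivity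
  have hp := Real.pi_pos
  have hw0 : 0 ≤ wz n z := clamp_nonneg _
  have hw1 : wz n z ≤ 1 := clamp_le_one _
  refine Psi_seg hn h0 h1 (z := z) (s := -Real.pi + 2 * Real.pi * wz n z) (Or.inr ⟨hz.2, fun h2 => ?_, fun h2 => ?_, fun h2 => ?_⟩) (fun i => h i 0)
  · have h3 : 1 / 2 ≤ wz n z := by
      unfold wz
      rw [← clamp_of_mem (x := 1 / 2) (by norm_num) (by norm_num)]
      apply clamp_mono
      rw [div_lt_iff₀ hn1] at h2
      nlinarith
    apply Real.sin_nonneg_of_nonneg_of_le_pi <;> nlinarith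
  · have h3 : wz n z ≤ 1 / 2 := by
      unfold wz
      rw [← clamp_of_mem (x := 1 / 2) (by norm_num) (by norm_num)]
      apply clamp_mono
      rw [lt_div_iff₀ hn1] at h2
      nlinarith
    apply Real.sin_nonpos_of_nonpos_of_neg_pi_le <;> nlinarith
  · have h3 : wz n z = 1 / 2 := by
      unfold wz
      rw [← clamp_of_mem (x := 1 / 2) (by norm_num) (by norm_num)]
      congr 1
      rw [h2]; field_simp; ring
    rw [h3]
    rw [show -Real.pi + 2 * Real.pi * (1 / 2) = 0 by ring, Real.cos_zero]

lemma exists_kap (hn : 1 ≤ n) : ∃ κ : (Fin (n + 2) → ℝ) → (Fin (n + 2) → ℝ),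
    ContinuousOn κ {v | v ∈ stdSimplex ℝ (Fin (n + 2)) ∧ ∃ j, v j = 0} ∧
    (∀ v ∈ stdSimplex ℝ (Fin (n + 2)), v (Fin.last _) = 0 → κ v = PS n (fun j => v j.castSucc) (wz n (fun j => v j.castSucc))) ∧
    (∀ v ∈ stdSimplex ℝ (Fin (n + 2)), ∀ j : Fin (n + 1), v j.castSucc = 0 → κ v = star n) ∧
    (∀ v ∈ stdSimplex ℝ (Fin (n + 2)), (∃ j, v j = 0) → ∀ τ : ℝ, 0 ≤ τ → τ ≤ 1 → NC (fun i => (1 - τ) * κ v i + τ * v i)) := by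
  classical
  have hsim : ∀ v ∈ stdSimplex ℝ (Fin (n + 2)), v (Fin.last _) = 0 → (fun j : Fin (n + 1) => v j.castSucc) ∈ stdSimplex ℝ (Fin (n + 1)) := by
    intro v hv hl
    refine ⟨fun j => hv.1 _, ?_⟩
    have := hv.2
    rw [Fin.sum_univ_castSucc, hl, add_zero] at this
    exact this
  let P : (Fin (n + 2) → ℝ) → (Fin (n + 2) → ℝ) := fun v => PS n (fun j => v j.castSucc) (wz n (fun j => v j.castSucc))
  have hPc : Continuous P := by
    have h1 : Continuous (fun v : Fin (n + 2) → ℝ => (fun j : Fin (n + 1) => v j.castSucc)) := by fun_prop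
    exact PS_cont' h1 (wz_cont.comp h1)
  have hP : ∀ v ∈ stdSimplex ℝ (Fin (n + 2)), v (Fin.last _) = 0 → ∀ j : Fin (n + 1), v j.castSucc = 0 → P v = star n := by
    intro v hv hl j hj
    exact PS_bdry hn (hsim v hv hl) (i := j) hj (fun x => x) ⟨0, by simp⟩ ⟨1, by simp⟩
  obtain ⟨κ, hκ, hκ2⟩ := glueOn {v | v ∈ stdSimplex ℝ (Fin (n + 2)) ∧ ∃ j, v j = 0} (fun j : Fin (n + 2) => {v | v j = 0})
    (fun j v => if j = Fin.last _ then P v else star n) (fun j => isClosed_eq (continuous_apply j) continuous_const)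
    (fun v hv => hv.2) (by
      intro j
      split_ifs
      · exact hPc.continuousOn
      · exact continuousOn_const) (by
      intro i j v hv hi hj
      split_ifs with h1 h2 h2
      · rfl
      · obtain ⟨j', rfl⟩ := Fin.exists_castSucc_eq.2 h2
        subst h1
        exact hP v hv.1 hi j' hj
      · obtain ⟨j', rfl⟩ := Fin.exists_castSucc_eq.2 h1
        subst h2
        exact (hP v hv.1 hj j' hi).symm
      · rfl)
  have k1 : ∀ v ∈ stdSimplex ℝ (Fin (n + 2)), v (Fin.last _) = 0 → κ v = PS n (fun j => v j.castSucc) (wz n (fun j => v j.castSucc)) := by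
    intro v hv hl
    rw [hκ2 (Fin.last _) v ⟨hv, _, hl⟩ hl, if_pos rfl]
  have k2 : ∀ v ∈ stdSimplex ℝ (Fin (n + 2)), ∀ j : Fin (n + 1), v j.castSucc = 0 → κ v = star n := by
    intro v hv j hj
    rw [hκ2 j.castSucc v ⟨hv, _, hj⟩ hj, if_neg (Fin.castSucc_lt_last j).ne]
  refine ⟨κ, hκ, k1, k2, ?_⟩
  intro v hv ⟨j, hj⟩ τ h0 h1
  by_cases hl : v (Fin.last _) = 0
  · rw [k1 v hv hl]
    have := seg_last hn (hsim v hv hl) h0 h1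
    have he : (Fin.snoc (α := fun _ => ℝ) (fun j : Fin (n + 1) => v j.castSucc) 0 : Fin (n + 2) → ℝ) = v := by
      rw [← hl]
      funext i
      refine Fin.lastCases ?_ (fun j => ?_) i <;> simp
    rwa [he] at this
  · have hjl : j ≠ Fin.last _ := fun h => hl (h ▸ hj)
    obtain ⟨j', rfl⟩ := Fin.exists_castSucc_eq.2 hjl
    rw [k2 v hv j' hj]
    refine ⟨Fin.last _, j'.castSucc, ?_⟩
    simp only [star, Fin.snoc_last, Fin.snoc_castSucc, hj]
    have h3 : 0 < v (Fin.last _) := lt_of_le_of_ne (hv.1 _) (Ne.symm hl)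
    intro h4
    rcases h0.eq_or_lt with rfl | h0
    · simp at h4
    · have := mul_pos h0 h3
      linarith

/-- labelled faces -/
lemma kap_face (hn : 1 ≤ n) {κ : (Fin (n + 2) → ℝ) → (Fin (n + 2) → ℝ)}
    (k1 : ∀ v ∈ stdSimplex ℝ (Fin (n + 2)), v (Fin.last _) = 0 → κ v = PS n (fun j => v j.castSucc) (wz n (fun j => v j.castSucc)))
    (k2 : ∀ v ∈ stdSimplex ℝ (Fin (n + 2)), ∀ j : Fin (n + 1), v j.castSucc = 0 → κ v = star n)
    (lab : Fin (n + 1) → Fin (n + 2)) (hlab : Monotone lab) {s : Fin (n + 1) → ℝ} (hs : s ∈ stdSimplex ℝ (Fin (n + 1))) :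
    κ (Gm lab s) = PS n s ((if lab = Fin.castSucc then 1 else 0 : ℤ) * wz n s) := by
  classical
  split_ifs with h
  · have hl : Gm lab s (Fin.last _) = 0 := Gm_zero fun m hm => by
      rw [h] at hm; exact absurd hm (Fin.castSucc_lt_last m).ne
    have hc : (fun j : Fin (n + 1) => Gm lab s j.castSucc) = s := by
      funext j
      simp [Gm, h]
    rw [k1 _ (Gm_simplex _ hs) hl, hc]
    simp
  · obtain ⟨j, hj⟩ : ∃ j : Fin (n + 1), ∀ m, lab m ≠ j.castSucc := by
      by_contra hcon
      push Not at hcon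
      apply h
      have hinj : Function.Injective lab := by
        choose g hg using hcon
        have gi : Function.Injective g := fun a b hab => by
          have := hg a
          rw [hab, hg b] at this
          exact (Fin.castSucc_injective _ this).symm
        have gs := Finite.injective_iff_surjective.1 gi
        intro a b hab
        obtain ⟨a', rfl⟩ := gs a
        obtain ⟨b', rfl⟩ := gs b
        rw [hg, hg] at hab
        rw [Fin.castSucc_injective _ hab]
      refine (StrictMono.range_inj (hlab.strictMono_of_injective hinj) (Fin.strictMono_castSucc)).1 ?_
      symm
      refine Set.eq_of_subset_of_ncard_le ?_ ?_ (Set.toFinite _)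
      · rintro _ ⟨j, rfl⟩
        obtain ⟨m, hm⟩ := hcon j
        exact ⟨m, hm⟩
      · rw [← Set.image_univ, ← Set.image_univ, Set.ncard_image_of_injective _ hinj, Set.ncard_image_of_injective _ (Fin.castSucc_injective _)]
    rw [k2 _ (Gm_simplex _ hs) j (Gm_zero fun m hm => absurd hm (hj m))]
    have := PS_int s 0
    simpa using this.symm

lemma simplex_succAbove {t : Fin (n + 2) → ℝ} (ht : t ∈ stdSimplex ℝ (Fin (n + 2))) {l : Fin (n + 2)} (hl : t l = 0) :
    (t ∘ l.succAbove) ∈ stdSimplex ℝ (Fin (n + 1)) := by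
  refine ⟨fun j => ht.1 _, ?_⟩
  have := ht.2
  rw [Fin.sum_univ_succAbove _ l, hl, zero_add] at this
  exact this

/-- measure of nonconstancy -/
noncomputable def ncm {m : ℕ} (v : Fin m → ℝ) : ℝ := ∑ i, ∑ j, |v i - v j|

lemma ncm_cont {m : ℕ} : Continuous (ncm (m := m)) := by unfold ncm; fun_prop

lemma ncm_iff {m : ℕ} (v : Fin m → ℝ) : NC v ↔ ncm v ≠ 0 := by
  unfold ncm NC
  rw [Ne, Finset.sum_eq_zero_iff_of_nonneg (fun i _ => Finset.sum_nonneg fun j _ => abs_nonneg _)]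
  constructor
  · rintro ⟨i, j, h⟩ h2
    have := h2 i (Finset.mem_univ _)
    rw [Finset.sum_eq_zero_iff_of_nonneg (fun j _ => abs_nonneg _)] at this
    have := this j (Finset.mem_univ _)
    rw [abs_eq_zero, sub_eq_zero] at this
    exact h this
  · intro h
    by_contra hc
    push Not at hc
    exact h fun i _ => Finset.sum_eq_zero fun j _ => by rw [hc i j]; simp

/-- straight-line extension -/
lemma hep {X : Type*} [TopologicalSpace X] [NormalSpace X] {m : ℕ} {F g : X → Fin m → ℝ} (hF : Continuous F) (hg : Continuous g)
    (hFN : ∀ x, NC (F x)) {A : Set X} (hA : IsClosed A)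
    (hs : ∀ x ∈ A, ∀ τ : ℝ, 0 ≤ τ → τ ≤ 1 → NC (fun i => (1 - τ) * F x i + τ * g x i)) :
    ∃ F' : X → Fin m → ℝ, Continuous F' ∧ (∀ x, NC (F' x)) ∧ ∀ x ∈ A, F' x = g x := by
  let Z : Set (X × Icc (0 : ℝ) 1) := {p | ncm (fun i => (1 - (p.2 : ℝ)) * F p.1 i + p.2 * g p.1 i) = 0}
  have hZ : IsClosed Z := by
    refine isClosed_eq (ncm_cont.comp ?_) continuous_const
    fun_prop
  have hB : IsClosed (Prod.fst '' Z) := isClosedMap_fst_of_compactSpace _ hZ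
  have hd : Disjoint (Prod.fst '' Z) A := by
    rw [Set.disjoint_left]
    rintro x ⟨⟨x', τ⟩, hp, rfl⟩ hxA
    exact (ncm_iff _).1 (hs x' hxA τ τ.2.1 τ.2.2) hp
  obtain ⟨φ, h0, h1, h01⟩ := exists_continuous_zero_one_of_isClosed hB hA hd
  refine ⟨fun x i => (1 - φ x) * F x i + φ x * g x i, by fun_prop, fun x => ?_, fun x hx => ?_⟩
  · by_cases hx : x ∈ Prod.fst '' Z
    · have : φ x = 0 := h0 hx
      simp only [this]
      simpa using hFN x
    · rw [ncm_iff]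
      intro h
      exact hx ⟨(x, ⟨φ x, h01 x⟩), h, rfl⟩
  · have : φ x = 1 := h1 hx
    funext i
    simp [this]

lemma ext_bdl_ofFn {X : Type*} {M : Type*} [AddCommGroup M] (c : List X → M) {m : ℕ} (g : Fin (m + 1) → X) :
    ext ℤ c (bdl ℤ (List.ofFn g)) = ∑ l : Fin (m + 1), ((-1) ^ (l : ℕ) : ℤ) • c (List.ofFn (g ∘ l.succAbove)) := by
  induction m generalizing c with
  | zero =>
    simp [bdl_cons]
  | succ m ih =>
    rw [List.ofFn_succ, bdl_cons, map_sub, ext_e]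
    have h2 : ext ℤ c ∘ₗ cone ℤ (g 0) = ext ℤ (fun l => c (g 0 :: l)) := lin_ext (by simp)
    have h3 := LinearMap.congr_fun h2 (bdl ℤ (List.ofFn fun i : Fin (m + 1) => g i.succ))
    simp only [LinearMap.comp_apply] at h3
    rw [h3, ih]
    conv_rhs => rw [Fin.sum_univ_succ]
    simp only [Fin.val_zero, pow_zero, one_smul, Fin.val_succ, pow_succ, mul_neg, mul_one, neg_smul, Finset.sum_neg_distrib]
    have h4 : ∀ l : Fin (m + 1), List.ofFn (g ∘ l.succ.succAbove) = g 0 :: List.ofFn ((fun i : Fin (m + 1) => g i.succ) ∘ l.succAbove) := by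
      intro l
      rw [List.ofFn_succ]
      simp [Function.comp_def]
    simp only [h4, sub_eq_add_neg]
    rfl

end kap
end MDP

namespace MDP
section hopf1

variable {n : ℕ}

lemma alt_lab (g : Fin (n + 2) → Fin (n + 2)) (hg : Monotone g) :
    ∑ l : Fin (n + 2), (-1 : ℤ) ^ (l : ℕ) * (if g ∘ l.succAbove = Fin.castSucc then 1 else 0) = (-1) ^ (n + 1) * if g = id then 1 else 0 := by
  classical
  by_cases hinj : Function.Injective g
  · have hid : g = id := by
      refine (StrictMono.range_inj (hg.strictMono_of_injective hinj) strictMono_id).1 ?_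
      rw [(Finite.injective_iff_surjective.1 hinj).range_eq]; simp
    subst hid
    rw [Finset.sum_eq_single (Fin.last _)]
    · have : (id ∘ (Fin.last (n + 1)).succAbove : Fin (n + 1) → Fin (n + 2)) = Fin.castSucc := by
        funext j; simp [Fin.succAbove_last]
      rw [if_pos this, if_pos rfl]; simp
    · intro l _ hl
      rw [if_neg, mul_zero]
      intro h
      obtain ⟨i, rfl⟩ := Fin.exists_castSucc_eq.2 hl
      have h1 := congrFun h i
      simp at h1
      exact absurd h1 (Fin.castSucc_lt_succ).ne'
    · simp
  · have hid : g ≠ id := fun h => hinj (h ▸ Function.injective_id)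
    rw [if_neg hid, mul_zero]
    have hns : ¬ StrictMono g := fun h => hinj h.injective
    rw [Fin.strictMono_iff_lt_succ] at hns
    push Not at hns
    obtain ⟨i, hi⟩ := hns
    have he : g i.castSucc = g i.succ := le_antisymm (hg (Fin.castSucc_lt_succ).le) hi
    have hne : i.castSucc ≠ i.succ := (Fin.castSucc_lt_succ).ne
    rw [Finset.sum_eq_add i.castSucc i.succ hne]
    · have : g ∘ i.castSucc.succAbove = g ∘ i.succ.succAbove := by
        funext m
        simp only [Function.comp]
        rcases lt_trichotomy m i with h | h | h
        · congr 1
          apply Fin.ext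
          have h' : (m : ℕ) < i := h
          rw [succAbove_val, succAbove_val, Fin.val_castSucc, Fin.val_succ, if_pos h', if_pos (by omega)]
        · subst h
          have h1 : m.castSucc.succAbove m = m.succ := by simp
          have h2 : m.succ.succAbove m = m.castSucc := by simp
          rw [h1, h2, he]
        · congr 1
          apply Fin.ext
          have h' : (i : ℕ) < m := h
          rw [succAbove_val, succAbove_val, Fin.val_castSucc, Fin.val_succ, if_neg (by omega), if_neg (by omega)]
      rw [this, Fin.val_castSucc, Fin.val_succ]
      split_ifs <;> ring
    · intro l _ hl
      rw [if_neg, mul_zero]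
      intro h
      obtain ⟨a, ha⟩ := Fin.exists_succAbove_eq (Ne.symm hl.1)
      obtain ⟨b, hb⟩ := Fin.exists_succAbove_eq (Ne.symm hl.2)
      have h1 := congrFun h a
      have h2 := congrFun h b
      simp only [Function.comp, ha, hb] at h1 h2
      rw [← he, h1] at h2
      have := Fin.castSucc_injective _ h2
      rw [this] at ha
      exact hne (ha.symm.trans hb)
    · simp
    · simp

lemma sorted_or_deg {V : Type*} [LinearOrder V] (l : List V) (h : l.Pairwise (· ≤ ·)) : l.Pairwise (· < ·) ∨ Deg l := by
  induction l with
  | nil => left; simp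
  | cons a l ih =>
    obtain ⟨h1, h2⟩ := List.pairwise_cons.1 h
    rcases ih h2 with h3 | ⟨l1, b, l2, rfl⟩
    · cases l with
      | nil => left; simp
      | cons b l =>
        rcases (h1 b (by simp)).eq_or_lt with rfl | hab
        · right; exact ⟨[], a, l, rfl⟩
        · left
          refine List.pairwise_cons.2 ⟨fun x hx => ?_, h3⟩
          rcases List.mem_cons.1 hx with rfl | hx
          · exact hab
          · exact hab.trans ((List.pairwise_cons.1 h3).1 x hx)
    · right; exact ⟨a :: l1, b, l2, rfl⟩

lemma srt_mono {m N : ℕ} {lab : Fin m → Fin N} (hl : Monotone lab) {f : Fin m → Fin N} (hf : StrictMono f) :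
    srt ℤ (List.ofFn lab) (List.ofFn f) = if lab = f then 1 else 0 := by
  classical
  have hp : (List.ofFn lab).Pairwise (· ≤ ·) := List.pairwise_ofFn.2 fun i j h => hl h.le
  rcases sorted_or_deg _ hp with h | h
  · rw [srt_sorted h, e, Finsupp.single_apply]
    simp [List.ofFn_inj]
  · rw [srt_deg h, if_neg]
    · rfl
    · rintro rfl
      have hs : (List.ofFn lab).Pairwise (· < ·) := List.pairwise_ofFn.2 fun i j h => hf h
      obtain ⟨l1, a, l2, he⟩ := h
      rw [he, List.pairwise_append] at hs
      have := (List.pairwise_cons.1 hs.2.1).1 a (by simp)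
      exact lt_irrefl _ this

lemma restr_simplex {a N : ℕ} {f : Fin a → Fin N} (hf : Function.Injective f) {s : Fin N → ℝ} (hs : s ∈ stdSimplex ℝ (Fin N))
    (h : ∀ w, w ∉ Set.range f → s w = 0) : s ∘ f ∈ stdSimplex ℝ (Fin a) :=
  ⟨fun j => hs.1 _, by rw [← hs.2]; exact Fintype.sum_of_injective f hf _ _ h fun _ => rfl⟩

lemma exists_not_mem {a N : ℕ} {f g : Fin a → Fin N} (hf : StrictMono f) (hg : StrictMono g) (h : f ≠ g) : ∃ j, f j ∉ Set.range g := by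
  by_contra hc
  push Not at hc
  apply h
  refine (StrictMono.range_inj hf hg).1 ?_
  refine Set.eq_of_subset_of_ncard_le (by rintro _ ⟨j, rfl⟩; exact hc j) ?_ (Set.toFinite _)
  rw [← Set.image_univ, ← Set.image_univ, Set.ncard_image_of_injective _ hf.injective, Set.ncard_image_of_injective _ hg.injective]

lemma exists_not_mem' {a b N : ℕ} {f : Fin a → Fin N} {g : Fin b → Fin N} (hf : StrictMono f) (hab : b < a) : ∃ j, f j ∉ Set.range g := by
  by_contra hc
  push Not at hc
  choose p hp using hc
  have : Function.Injective p := fun x y h => hf.injective (by rw [← hp x, ← hp y, h])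
  have := Fintype.card_le_of_injective p this
  simp at this
  omega

lemma glueF (hn : 1 ≤ n) {X : Type*} [TopologicalSpace X] {N : ℕ} (hN : n + 1 ≤ N) {s : X → Fin N → ℝ} (hs : Continuous s)
    (hsS : ∀ x, s x ∈ stdSimplex ℝ (Fin N)) (Y : Set X)
    (hcard : ∀ x, (Finset.univ.filter fun w => s x w ≠ 0).card ≤ n + 2)
    (k : (Fin (n + 1) → Fin N) → ℤ) (Φ : (Fin (n + 2) → Fin N) → (Fin (n + 2) → ℝ) → (Fin (n + 2) → ℝ))
    (good : (Fin (n + 2) → Fin N) → Prop)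
    (hgood : ∀ f, StrictMono f → ∀ x ∈ Y, (∀ j, s x (f j) ≠ 0) → good f)
    (hΦc : ∀ f, StrictMono f → good f → ContinuousOn (Φ f) (stdSimplex ℝ (Fin (n + 2))))
    (hΦN : ∀ f, StrictMono f → good f → ∀ t ∈ stdSimplex ℝ (Fin (n + 2)), NC (Φ f t))
    (hΦf : ∀ f, StrictMono f → good f → ∀ t ∈ stdSimplex ℝ (Fin (n + 2)), ∀ l, t l = 0 →
      Φ f t = PS n (t ∘ l.succAbove) (k (f ∘ l.succAbove) * wz n (t ∘ l.succAbove))) :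
    ∃ F : X → Fin (n + 2) → ℝ, ContinuousOn F Y ∧ (∀ x ∈ Y, NC (F x)) ∧
      (∀ f, StrictMono f → good f → ∀ x ∈ Y, (∀ w, w ∉ Set.range f → s x w = 0) → F x = Φ f (s x ∘ f)) ∧
      (∀ τ : Fin (n + 1) → Fin N, StrictMono τ → ∀ x ∈ Y, (∀ w, w ∉ Set.range τ → s x w = 0) →
        F x = PS n (s x ∘ τ) (k τ * wz n (s x ∘ τ))) := by
  classical
  let I := {f : Fin (n + 2) → Fin N // StrictMono f ∧ good f} ⊕ {τ : Fin (n + 1) → Fin N // StrictMono τ}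
  let C : I → Set X := Sum.elim (fun f => {x | ∀ w, w ∉ Set.range f.1 → s x w = 0}) (fun τ => {x | ∀ w, w ∉ Set.range τ.1 → s x w = 0})
  let V : I → X → (Fin (n + 2) → ℝ) := Sum.elim (fun f x => Φ f.1 (s x ∘ f.1)) (fun τ x => PS n (s x ∘ τ.1) (k τ.1 * wz n (s x ∘ τ.1)))
  have hclosed : ∀ T : Set (Fin N), IsClosed {x | ∀ w, w ∉ T → s x w = 0} := by
    intro T
    simp only [Set.ofPred_forall]
    exact isClosed_iInter fun w => isClosed_iInter fun _ => isClosed_eq ((continuous_apply w).comp hs) continuous_const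
  have h2 : ∀ (τ τ' : {τ : Fin (n + 1) → Fin N // StrictMono τ}) x, x ∈ C (Sum.inr τ) → x ∈ C (Sum.inr τ') → V (Sum.inr τ) x = V (Sum.inr τ') x := by
    have star1 : ∀ (τ τ' : {τ : Fin (n + 1) → Fin N // StrictMono τ}) x, τ ≠ τ' → x ∈ C (Sum.inr τ) → x ∈ C (Sum.inr τ') → V (Sum.inr τ) x = star n := by
      intro τ τ' x hne h h'
      obtain ⟨j, hj⟩ := exists_not_mem τ.2 τ'.2 (fun h => hne (Subtype.ext h))
      exact PS_bdry hn (restr_simplex τ.2.injective (hsS x) h) (i := j) (h' _ hj) (fun w => k τ.1 * w) ⟨0, by simp⟩ ⟨k τ.1, by simp⟩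
    intro τ τ' x h h'
    by_cases hne : τ = τ'
    · rw [hne]
    · rw [star1 τ τ' x hne h h', star1 τ' τ x (Ne.symm hne) h' h]
  have h3 : ∀ (f : {f : Fin (n + 2) → Fin N // StrictMono f ∧ good f}) x, x ∈ C (Sum.inl f) → ∀ l, s x (f.1 l) = 0 →
      x ∈ C (Sum.inr ⟨f.1 ∘ l.succAbove, f.2.1.comp (Fin.strictMono_succAbove l)⟩) ∧
      V (Sum.inl f) x = V (Sum.inr ⟨f.1 ∘ l.succAbove, f.2.1.comp (Fin.strictMono_succAbove l)⟩) x := by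
    intro f x hx l hl
    refine ⟨fun w hw => ?_, ?_⟩
    · by_cases hwf : w ∈ Set.range f.1
      · obtain ⟨j, rfl⟩ := hwf
        by_cases hjl : j = l
        · rw [hjl, hl]
        · obtain ⟨i, rfl⟩ := Fin.exists_succAbove_eq hjl
          exact absurd ⟨i, rfl⟩ hw
      · exact hx w hwf
    · exact hΦf f.1 f.2.1 f.2.2 _ (restr_simplex f.2.1.injective (hsS x) hx) l hl
  have h1 : ∀ (f : {f : Fin (n + 2) → Fin N // StrictMono f ∧ good f}) (τ : {τ : Fin (n + 1) → Fin N // StrictMono τ}) x,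
      x ∈ C (Sum.inl f) → x ∈ C (Sum.inr τ) → V (Sum.inl f) x = V (Sum.inr τ) x := by
    intro f τ x h h'
    obtain ⟨l, hl⟩ := exists_not_mem' (g := τ.1) f.2.1 (by omega)
    obtain ⟨h4, h5⟩ := h3 f x h l (h' _ hl)
    rw [h5]
    exact h2 _ _ x h4 h'
  have h0 : ∀ (f f' : {f : Fin (n + 2) → Fin N // StrictMono f ∧ good f}) x,
      x ∈ C (Sum.inl f) → x ∈ C (Sum.inl f') → V (Sum.inl f) x = V (Sum.inl f') x := by
    intro f f' x h h'
    by_cases hne : f = f'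
    · rw [hne]
    obtain ⟨l, hl⟩ := exists_not_mem f.2.1 f'.2.1 (fun h => hne (Subtype.ext h))
    obtain ⟨h4, h5⟩ := h3 f x h l (h' _ hl)
    rw [h5]
    exact (h1 _ _ x h' h4).symm
  have hcov : ∀ x ∈ Y, ∃ i, x ∈ C i := by
    intro x hx
    rcases (hcard x).eq_or_lt with h | h
    · have hm := (Finset.univ.filter fun w => s x w ≠ 0).range_orderEmbOfFin h
      have hmem : ∀ w, w ∈ Set.range ((Finset.univ.filter fun w => s x w ≠ 0).orderEmbOfFin h) ↔ s x w ≠ 0 := by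
        intro w; rw [hm]; simp
      refine ⟨Sum.inl ⟨(Finset.univ.filter fun w => s x w ≠ 0).orderEmbOfFin h, OrderEmbedding.strictMono _,
        hgood _ (OrderEmbedding.strictMono _) x hx fun j => (hmem _).1 ⟨j, rfl⟩⟩, fun w hw => ?_⟩
      by_contra h0
      exact hw ((hmem w).2 h0)
    · obtain ⟨T, hT, hTc⟩ := Finset.exists_superset_card_eq (Nat.lt_succ_iff.1 h) (by simpa using hN)
      have hm := T.range_orderEmbOfFin hTc
      refine ⟨Sum.inr ⟨T.orderEmbOfFin hTc, OrderEmbedding.strictMono _⟩, fun w hw => ?_⟩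
      by_contra h0
      apply hw
      show w ∈ Set.range (T.orderEmbOfFin hTc)
      rw [hm]
      exact hT (by simpa using h0)
  obtain ⟨F, hF, hF2⟩ := glueOn Y C V (by
      rintro (f | τ)
      · exact hclosed _
      · exact hclosed _) hcov (by
      rintro (f | τ)
      · refine (hΦc f.1 f.2.1 f.2.2).comp (f := fun x => s x ∘ f.1) ?_ fun x hx => restr_simplex f.2.1.injective (hsS x) hx.1
        exact Continuous.continuousOn (by fun_prop)
      · have h1 : Continuous (fun x => s x ∘ τ.1) := by fun_prop
        exact (PS_cont' h1 (continuous_const.mul (wz_cont.comp h1))).continuousOn) (by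
      rintro (f | τ) (f' | τ') x _ h h'
      · exact h0 f f' x h h'
      · exact h1 f τ' x h h'
      · exact (h1 f' τ x h' h).symm
      · exact h2 τ τ' x h h')
  refine ⟨F, hF, ?_, fun f hf hg x hx h => hF2 (Sum.inl ⟨f, hf, hg⟩) x hx h, fun τ hτ x hx h => hF2 (Sum.inr ⟨τ, hτ⟩) x hx h⟩
  intro x hx
  obtain ⟨i, hi⟩ := hcov x hx
  rw [hF2 i x hx hi]
  rcases i with f | τ
  · exact hΦN f.1 f.2.1 f.2.2 _ (restr_simplex f.2.1.injective (hsS x) hi)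
  · exact PS_NC hn _ _

end hopf1
end MDP

namespace MDP
section hopf2

variable {n : ℕ} {X : Type*} [MetricSpace X]

lemma supp_cases {N : ℕ} (hN : n + 1 ≤ N) (s : Fin N → ℝ) (hcard : (Finset.univ.filter fun w => s w ≠ 0).card ≤ n + 2) :
    (∃ f : Fin (n + 2) → Fin N, StrictMono f ∧ ∀ w, w ∈ Set.range f ↔ s w ≠ 0) ∨
    (∃ τ : Fin (n + 1) → Fin N, StrictMono τ ∧ ∀ w, w ∉ Set.range τ → s w = 0) := by
  classical
  rcases hcard.eq_or_lt with h | h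
  · left
    refine ⟨(Finset.univ.filter fun w => s w ≠ 0).orderEmbOfFin h, OrderEmbedding.strictMono _, fun w => ?_⟩
    rw [Finset.range_orderEmbOfFin]; simp
  · right
    obtain ⟨T, hT, hTc⟩ := Finset.exists_superset_card_eq (Nat.lt_succ_iff.1 h) (by simpa using hN)
    refine ⟨T.orderEmbOfFin hTc, OrderEmbedding.strictMono _, fun w hw => ?_⟩
    by_contra h0
    apply hw
    rw [Finset.range_orderEmbOfFin]
    exact hT (by simpa using h0)

lemma exists_pou [CompactSpace X] {N : ℕ} {U : Fin N → Set X} (ho : ∀ i, IsOpen (U i)) (hc : ∀ x, ∃ i, x ∈ U i) :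
    ∃ s : X → Fin N → ℝ, Continuous s ∧ (∀ x, s x ∈ stdSimplex ℝ (Fin N)) ∧ ∀ x w, s x w ≠ 0 → x ∈ U w := by
  obtain ⟨f, hf⟩ := PartitionOfUnity.exists_isSubordinate (isClosed_univ : IsClosed (univ : Set X)) U ho
    (fun x _ => mem_iUnion.2 (hc x))
  refine ⟨fun x w => f w x, by fun_prop, fun x => ⟨fun w => f.nonneg w x, ?_⟩, fun x w h => hf w (subset_tsupport _ h)⟩
  rw [← finsum_eq_sum_of_fintype]
  exact f.sum_eq_one (mem_univ x)

lemma cov_prep [Nonempty X] {k M : ℕ} {δ : ℝ} (h : Cov X k δ) (lam : X → Fin M) (m : ℕ) :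
    ∃ (N : ℕ) (U : Fin N → Set X) (p : Fin N → X), m ≤ N ∧ (∀ i, IsOpen (U i)) ∧ (∀ x, ∃ i, x ∈ U i) ∧
      (∀ i, ∀ x ∈ U i, dist x (p i) < δ) ∧ (∀ s : Finset (Fin N), (∃ x, ∀ i ∈ s, x ∈ U i) → s.card ≤ k) ∧ Monotone (lam ∘ p) := by
  classical
  obtain ⟨N, U, h1, h2, h3, h4⟩ := h
  let U1 : Fin (N + m) → Set X := Fin.append U (fun _ => ∅)
  let p1 : Fin (N + m) → X := fun i => if h : (U1 i).Nonempty then h.choose else Classical.arbitrary X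
  let σ := Tuple.sort (lam ∘ p1)
  have hU1 : ∀ i, (∃ j, i = Fin.castAdd m j ∧ U1 i = U j) ∨ U1 i = ∅ := by
    intro i
    refine Fin.addCases (fun j => ?_) (fun j => ?_) i
    · left; exact ⟨j, rfl, by simp [U1]⟩
    · right; simp [U1]
  have hcard : ∀ s : Finset (Fin (N + m)), (∃ x, ∀ i ∈ s, x ∈ U1 i) → s.card ≤ k := by
    rintro s ⟨x, hx⟩
    have hsub : s ⊆ (Finset.univ.filter fun j => Fin.castAdd m j ∈ s).image (Fin.castAdd m) := by
      intro i hi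
      rcases hU1 i with ⟨j, rfl, -⟩ | h0
      · exact Finset.mem_image_of_mem _ (by simpa using hi)
      · have := hx i hi; rw [h0] at this; exact absurd this (by simp)
    refine (Finset.card_le_card hsub).trans (Finset.card_image_le.trans (h4 _ ⟨x, fun j hj => ?_⟩))
    have := hx _ (Finset.mem_filter.1 hj).2
    simpa [U1] using this
  refine ⟨N + m, U1 ∘ σ, p1 ∘ σ, by omega, fun i => ?_, fun x => ?_, fun i x hx => ?_, fun s hs => ?_, Tuple.monotone_sort (lam ∘ p1)⟩
  · rcases hU1 (σ i) with ⟨j, -, h0⟩ | h0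
    · simp only [Function.comp, h0, h1]
    · simp only [Function.comp, h0, isOpen_empty]
  · obtain ⟨j, hj⟩ := h2 x
    exact ⟨σ.symm (Fin.castAdd m j), by simpa [U1] using hj⟩
  · have hne : (U1 (σ i)).Nonempty := ⟨x, hx⟩
    have hp : p1 (σ i) ∈ U1 (σ i) := by
      simp only [p1, dif_pos hne]; exact hne.choose_spec
    rcases hU1 (σ i) with ⟨j, -, h0⟩ | h0
    · simp only [Function.comp] at hx ⊢
      rw [h0] at hx hp
      exact h3 j _ hx _ hp
    · rw [h0] at hp; exact absurd hp (by simp)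
  · obtain ⟨x, hx⟩ := hs
    rw [← Finset.card_map σ.toEmbedding]
    refine hcard _ ⟨x, fun i hi => ?_⟩
    obtain ⟨j, hj, rfl⟩ := Finset.mem_map.1 hi
    exact hx j hj

lemma Zl {f : X → Fin (n + 2) → ℝ} {η ε : ℝ} (hη : 6 * ((n : ℝ) + 2) * η = 1)
    (hε : ∀ x y, dist x y < ε → ∀ j, |f x j - f y j| < η / 2) {lam : X → Fin (n + 2)} (hlam : ∀ x j, f x j ≤ f x (lam x))
    {x y : X} (hxy : dist x y < ε) (hy : ∑ i, f y i = 1) : 5 * η ≤ f y (lam x) := by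
  have hn2 : (0 : ℝ) < (n : ℝ) + 2 := by positivity
  obtain ⟨i, hi⟩ : ∃ i, 6 * η ≤ f y i := by
    by_contra hc
    push Not at hc
    have := Finset.sum_lt_sum_of_nonempty (s := Finset.univ) ⟨0, Finset.mem_univ _⟩ (fun i _ => hc i)
    rw [hy] at this
    simp at this
    nlinarith
  have h1 := abs_lt.1 (hε x y hxy i)
  have h2 := abs_lt.1 (hε x y hxy (lam x))
  have h3 := hlam x i
  have : 0 < η := by
    by_contra h
    nlinarith
  linarith

lemma core1 [CompactSpace X] [Nonempty X] (hn : 1 ≤ n) (hd : DimLE X (n + 1)) (hv : Van X ℤ (n + 1))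
    {f : X → Fin (n + 2) → ℝ} {μ : X → ℝ} (hμ1 : ∀ x i, μ x ≤ f x i) (hμ2 : ∀ x, ∃ i, μ x = f x i)
    (hf1 : ∀ x, 0 < μ x → ∑ i, f x i = 1) {η ε : ℝ} (hη : 6 * ((n : ℝ) + 2) * η = 1) (hε0 : 0 < ε)
    (hε : ∀ x y, dist x y < ε → ∀ j, |f x j - f y j| < η / 2) {lam : X → Fin (n + 2)} (hlam : ∀ x j, f x j ≤ f x (lam x))
    {κ : (Fin (n + 2) → ℝ) → (Fin (n + 2) → ℝ)} (k0 : ContinuousOn κ {v | v ∈ stdSimplex ℝ (Fin (n + 2)) ∧ ∃ j, v j = 0})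
    (k1 : ∀ v ∈ stdSimplex ℝ (Fin (n + 2)), v (Fin.last _) = 0 → κ v = PS n (fun j => v j.castSucc) (wz n (fun j => v j.castSucc)))
    (k2 : ∀ v ∈ stdSimplex ℝ (Fin (n + 2)), ∀ j : Fin (n + 1), v j.castSucc = 0 → κ v = star n)
    (k3 : ∀ v ∈ stdSimplex ℝ (Fin (n + 2)), (∃ j, v j = 0) → ∀ τ : ℝ, 0 ≤ τ → τ ≤ 1 → NC (fun i => (1 - τ) * κ v i + τ * v i)) :
    ∃ (N : ℕ) (s : X → Fin N → ℝ) (p : Fin N → X), Continuous s ∧ (∀ x, s x ∈ stdSimplex ℝ (Fin N)) ∧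
      (∀ x w, s x w ≠ 0 → dist x (p w) < ε) ∧ ∃ F : X → Fin (n + 2) → ℝ, ContinuousOn F {x | η ≤ μ x} ∧
      (∀ x, η ≤ μ x → NC (F x)) ∧ ∀ x, μ x = η → F x = κ (Gm (lam ∘ p) (s x)) := by
  classical
  have hηp : 0 < η := by
    have hn2 : (0 : ℝ) < (n : ℝ) + 2 := by positivity
    by_contra h
    nlinarith
  have hμε : ∀ x y, dist x y < ε → μ x < μ y + η / 2 := by
    intro x y h
    obtain ⟨i, hi⟩ := hμ2 y
    have := abs_lt.1 (hε x y h i)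
    have := hμ1 x i
    linarith
  -- lists with all labels
  have hZ : ∀ y, 0 < μ y → (∀ i, ∃ x, dist x y < ε ∧ lam x = i) → 5 * η ≤ μ y := by
    intro y hy h
    obtain ⟨i, hi⟩ := hμ2 y
    obtain ⟨x, hx, rfl⟩ := h i
    rw [hi]
    exact Zl hη hε hlam hx (hf1 y hy)
  let u : List X → ℤ := fun l => if ∀ x ∈ l, 3 * η ≤ μ x then om ℤ lam (id : Fin (n + 2) → Fin (n + 2)) l else 0
  have hu5 : ∀ l, Small ε l → u l ≠ 0 → l.length = n + 2 ∧ ∀ y ∈ l, 5 * η ≤ μ y := by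
    intro l hl hu
    simp only [u] at hu
    split_ifs at hu with h3
    · obtain ⟨a, b⟩ := om_mem hu
      refine ⟨a, fun y hy => hZ y (by have := h3 y hy; linarith) fun i => ?_⟩
      obtain ⟨x, hx, hxi⟩ := b i
      exact ⟨x, hl x hx y hy, hxi⟩
    · exact absurd rfl hu
  obtain ⟨ε1, hε1, c, hc1, hc2⟩ := hv {x | μ x ≤ 3 * η} u ε hε0 (by
      intro l hl hlen
      by_cases h3 : ∀ x ∈ l, 3 * η ≤ μ x
      · rw [ext_bdl_congr (u' := om ℤ lam (id : Fin (n + 2) → Fin (n + 2)))]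
        · refine om_cocycle (q := n + 1) (p := fun _ => Classical.arbitrary X) (ε := ε) ?_ id l hl hlen
          intro l _ _ s hs _
          have hnd : s.Nodup := hs.imp (fun h => h.ne)
          simpa using hnd.length_le_card
        · intro l' _ hl'
          simp only [u]
          rw [if_pos fun x hx => h3 x (hl' x hx)]
      · rw [ext_bdl_congr (u' := fun _ => (0 : ℤ))]
        · simp [ext, Finsupp.linearCombination_apply, Finsupp.sum]
        · intro l' hlen' hl'
          by_contra hu
          have hs' : Small ε l' := fun x hx y hy => hl x (hl' x hx) y (hl' y hy)
          obtain ⟨a, b⟩ := hu5 l' hs' hu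
          obtain ⟨y, hy⟩ : ∃ y, y ∈ l' := List.exists_mem_of_length_pos (by omega)
          refine h3 fun x hx => ?_
          have h5 := b y hy
          have h6 := hμε y x (hl y (hl' y hy) x hx)
          linarith) (by
      rintro l hl hlen ⟨a, ha, hal⟩
      by_contra hu
      obtain ⟨h1, h2⟩ := hu5 l hl hu
      obtain ⟨y, hy⟩ : ∃ y, y ∈ l := List.exists_mem_of_length_pos (by omega)
      have h5 := h2 y hy
      have h6 := hμε y a (by rw [dist_comm]; exact hal y hy)
      have h7 : μ a ≤ 3 * η := ha
      linarith)
  set ε2 := min ε ε1 with hε2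
  have hε2p : 0 < ε2 := lt_min hε0 hε1
  obtain ⟨N, U, p, hN, hUo, hUc, hUd, hUk, hmono⟩ := cov_prep (hd (ε2 / 2) (by linarith)) lam (n + 1)
  obtain ⟨s, hs, hsS, hsU⟩ := exists_pou hUo hUc
  have hsp : ∀ x w, s x w ≠ 0 → dist x (p w) < ε2 / 2 := fun x w h => hUd w x (hsU x w h)
  have hcard : ∀ x, (Finset.univ.filter fun w => s x w ≠ 0).card ≤ n + 2 := fun x =>
    hUk _ ⟨x, fun i hi => hsU x i (Finset.mem_filter.1 hi).2⟩
  have hsmall : ∀ {m : ℕ} (g : Fin m → Fin N) (x : X), (∀ j, s x (g j) ≠ 0) → Small ε2 (List.ofFn (p ∘ g)) := by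
    intro m g x h a ha b hb
    obtain ⟨i, rfl⟩ := (List.mem_ofFn' _ _).1 ha
    obtain ⟨j, rfl⟩ := (List.mem_ofFn' _ _).1 hb
    have h1 := hsp x _ (h i)
    have h2 := hsp x _ (h j)
    have h3 := dist_triangle_left (p (g i)) (p (g j)) x
    simp only [Function.comp]
    linarith
  have hc0 : ∀ (τ : Fin (n + 1) → Fin N) (x : X), (∀ j, s x (τ j) ≠ 0) → μ x ≤ 3 * η → c (List.ofFn (p ∘ τ)) = 0 := by
    intro τ x h hx
    refine hc2 _ (fun a ha b hb => (hsmall τ x h a ha b hb).trans_le (min_le_right _ _)) (by simp) ⟨x, hx, fun y hy => ?_⟩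
    obtain ⟨i, rfl⟩ := (List.mem_ofFn' _ _).1 hy
    have h1 := hsp x _ (h i)
    have h2 : ε2 ≤ ε1 := min_le_right _ _
    simp only [Function.comp]
    linarith
  let k : (Fin (n + 1) → Fin N) → ℤ := fun τ => (if lam ∘ p ∘ τ = Fin.castSucc then 1 else 0) - (-1) ^ (n + 1) * c (List.ofFn (p ∘ τ))
  let good : (Fin (n + 2) → Fin N) → Prop := fun g => ∃ x, η ≤ μ x ∧ ∀ j, s x (g j) ≠ 0
  have hksum : ∀ g, StrictMono g → good g → ∑ l : Fin (n + 2), (-1) ^ (l : ℕ) * k (g ∘ l.succAbove) = 0 := by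
    rintro g hg ⟨x, hx, hxg⟩
    have hgm : Monotone (lam ∘ p ∘ g) := fun a b h => hmono (hg.monotone h)
    have e1 := alt_lab (lam ∘ p ∘ g) hgm
    have hsm := hsmall g x hxg
    have e2 := hc1 (List.ofFn (p ∘ g)) (fun a ha b hb => (hsm a ha b hb).trans_le (min_le_right _ _)) (by simp)
    rw [ext_bdl_ofFn] at e2
    have e3 : u (List.ofFn (p ∘ g)) = if lam ∘ p ∘ g = id then 1 else 0 := by
      have e4 : om ℤ lam (id : Fin (n + 2) → Fin (n + 2)) (List.ofFn (p ∘ g)) = if lam ∘ p ∘ g = id then 1 else 0 := by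
        unfold om
        rw [List.map_ofFn, srt_mono hgm strictMono_id]
      simp only [u]
      split_ifs with h1 h2 h2
      · rw [e4, if_pos h2]
      · rw [e4, if_neg h2]
      · exfalso
        apply h1
        intro y hy
        obtain ⟨i, rfl⟩ := (List.mem_ofFn' _ _).1 hy
        have hxy : dist x ((p ∘ g) i) < ε := by
          have h1 := hsp x _ (hxg i)
          have h2 : ε2 ≤ ε := min_le_left _ _
          simp only [Function.comp]
          linarith
        have h4 := hμε _ _ hxy
        have := hZ ((p ∘ g) i) (by linarith) (fun j => ⟨(p ∘ g) j, (hsm _ ((List.mem_ofFn' _ _).2 ⟨j, rfl⟩) _ hy).trans_le (min_le_left _ _), congrFun h2 j⟩)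
        linarith
      · rfl
    rw [e3] at e2
    simp only [k, mul_sub, Finset.sum_sub_distrib]
    have e5 : ∑ l : Fin (n + 2), (-1 : ℤ) ^ (l : ℕ) * ((-1) ^ (n + 1) * c (List.ofFn (p ∘ g ∘ l.succAbove)))
        = (-1) ^ (n + 1) * if lam ∘ p ∘ g = id then 1 else 0 := by
      rw [← e2, Finset.mul_sum]
      refine Finset.sum_congr rfl fun l _ => ?_
      rw [smul_eq_mul, Function.comp_assoc]; ring
    have e6 : ∑ l : Fin (n + 2), (-1 : ℤ) ^ (l : ℕ) * (if lam ∘ p ∘ g ∘ l.succAbove = Fin.castSucc then 1 else 0) = (-1) ^ (n + 1) * if lam ∘ p ∘ g = id then 1 else 0 := e1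
    rw [e5, e6, sub_self]
  have hnonsurj : ∀ x, 0 < μ x → μ x ≤ 2 * η → ∃ j, ∀ w, s x w ≠ 0 → lam (p w) ≠ j := by
    intro x hx0 hx2
    by_contra hcon
    push Not at hcon
    have := hZ x hx0 (fun i => by
      obtain ⟨w, hw, hwi⟩ := hcon i
      refine ⟨p w, ?_, hwi⟩
      have h1 := hsp x w hw
      have h2 : ε2 ≤ ε := min_le_left _ _
      rw [dist_comm]; linarith)
    linarith
  have hΦ : ∀ g : Fin (n + 2) → Fin N, ∃ Φ : (Fin (n + 2) → ℝ) → (Fin (n + 2) → ℝ), StrictMono g → good g →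
      (ContinuousOn Φ (stdSimplex ℝ (Fin (n + 2))) ∧ (∀ t ∈ stdSimplex ℝ (Fin (n + 2)), NC (Φ t)) ∧
      (∀ t ∈ stdSimplex ℝ (Fin (n + 2)), ∀ l, t l = 0 → Φ t = PS n (t ∘ l.succAbove) (k (g ∘ l.succAbove) * wz n (t ∘ l.succAbove))) ∧
      ((∃ x, η ≤ μ x ∧ μ x ≤ 2 * η ∧ ∀ j, s x (g j) ≠ 0) → ∀ t ∈ stdSimplex ℝ (Fin (n + 2)), Φ t = κ (Gm (lam ∘ p ∘ g) t))) := by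
    intro g
    by_cases hg : StrictMono g ∧ good g
    swap
    · exact ⟨fun t => t, fun a b => absurd ⟨a, b⟩ hg⟩
    by_cases hnear : ∃ x, η ≤ μ x ∧ μ x ≤ 2 * η ∧ ∀ j, s x (g j) ≠ 0
    · obtain ⟨x, hx1, hx2, hxg⟩ := hnear
      obtain ⟨j0, hj0⟩ := hnonsurj x (by linarith) hx2
      have hz : ∀ t, Gm (lam ∘ p ∘ g) t j0 = 0 := fun t => Gm_zero fun m hm => absurd hm (hj0 _ (hxg m))
      refine ⟨fun t => κ (Gm (lam ∘ p ∘ g) t), fun _ _ => ⟨?_, ?_, ?_, fun _ _ _ => rfl⟩⟩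
      · exact k0.comp (Gm_cont _).continuousOn fun t ht => ⟨Gm_simplex _ ht, j0, hz t⟩
      · intro t ht
        have := k3 _ (Gm_simplex (lam ∘ p ∘ g) ht) ⟨j0, hz t⟩ 0 le_rfl zero_le_one
        simpa using this
      · intro t ht l hl
        have h1 : Gm ((lam ∘ p ∘ g) ∘ l.succAbove) (t ∘ l.succAbove) = Gm (lam ∘ p ∘ g) t := by
          refine Gm_comp _ Fin.succAbove_right_injective _ fun m hm => ?_
          rw [Fin.range_succAbove] at hm
          have : m = l := by simpa using hm
          rw [this, hl]
        have h2 : Monotone ((lam ∘ p ∘ g) ∘ l.succAbove) := fun a b h => hmono (hg.1.monotone ((Fin.strictMono_succAbove l).monotone h))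
        show κ (Gm (lam ∘ p ∘ g) t) = _
        rw [← h1, kap_face hn k1 k2 _ h2 (simplex_succAbove ht hl)]
        congr 2
        have h3 := hc0 (g ∘ l.succAbove) x (fun j => hxg _) (by linarith)
        simp only [k, h3, mul_zero, sub_zero]
        rfl
    · obtain ⟨Φ, h1, h2, h3⟩ := filler hn (fun l => k (g ∘ l.succAbove)) (hksum g hg.1 hg.2)
      exact ⟨Φ, fun _ _ => ⟨h1, h2, h3, fun h => absurd h hnear⟩⟩
  choose Φ hΦ using hΦ
  obtain ⟨F, hFc, hFN, hFf, hFτ⟩ := glueF hn hN hs hsS {x | η ≤ μ x} hcard k Φ good (fun g hg x hx h => ⟨x, hx, h⟩)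
    (fun g h h' => (hΦ g h h').1) (fun g h h' => (hΦ g h h').2.1) (fun g h h' => (hΦ g h h').2.2.1)
  refine ⟨N, s, p, hs, hsS, fun x w h => (hsp x w h).trans_le ?_, F, hFc, hFN, ?_⟩
  · have h2 : ε2 ≤ ε := min_le_left _ _
    linarith
  · intro x hx
    rcases supp_cases hN (s x) (hcard x) with ⟨g, hg, hgs⟩ | ⟨τ, hτ, hτs⟩
    · have hxg : ∀ j, s x (g j) ≠ 0 := fun j => (hgs _).1 ⟨j, rfl⟩
      have hoff : ∀ w, w ∉ Set.range g → s x w = 0 := fun w hw => by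
        by_contra h; exact hw ((hgs w).2 h)
      have hgood : good g := ⟨x, hx.ge, hxg⟩
      rw [hFf g hg hgood x hx.ge hoff, (hΦ g hg hgood).2.2.2 ⟨x, hx.ge, by linarith, hxg⟩ _ (restr_simplex hg.injective (hsS x) hoff)]
      rw [← Gm_comp g hg.injective (lam ∘ p) hoff]
      rfl
    · have hm : Monotone ((lam ∘ p) ∘ τ) := fun a b h => hmono (hτ.monotone h)
      rw [hFτ τ hτ x hx.ge hτs, ← Gm_comp τ hτ.injective (lam ∘ p) hτs, kap_face hn k1 k2 _ hm (restr_simplex hτ.injective (hsS x) hτs)]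
      by_cases hall : ∀ j, s x (τ j) ≠ 0
      · congr 2
        have h3 := hc0 τ x hall (by linarith)
        simp only [k, h3, mul_zero, sub_zero]
        rfl
      · push Not at hall
        obtain ⟨j, hj⟩ := hall
        have hss := restr_simplex hτ.injective (hsS x) hτs
        rw [PS_bdry hn hss (i := j) hj (fun w => k τ * w) ⟨0, by simp⟩ ⟨k τ, by simp⟩]
        exact (PS_bdry hn hss (i := j) hj (fun w => ((if (lam ∘ p) ∘ τ = Fin.castSucc then 1 else 0 : ℤ) : ℝ) * w) ⟨0, by simp⟩ ⟨_, mul_one _⟩).symm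

end hopf2
end MDP

namespace MDP
section hopf3

variable {n : ℕ} {X : Type*} [MetricSpace X]

noncomputable def mn (v : Fin (n + 2) → ℝ) : ℝ := Finset.univ.inf' Finset.univ_nonempty v

lemma mn_cont : Continuous (mn (n := n)) := by
  unfold mn
  exact Continuous.finset_inf'_apply _ (fun i _ => continuous_apply i)

lemma mn_le (v : Fin (n + 2) → ℝ) (i) : mn v ≤ v i := Finset.inf'_le _ (Finset.mem_univ i)

lemma mn_ex (v : Fin (n + 2) → ℝ) : ∃ i, mn v = v i := by
  obtain ⟨i, -, hi⟩ := Finset.exists_mem_eq_inf' Finset.univ_nonempty v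
  exact ⟨i, hi⟩

lemma core2 [CompactSpace X] [Nonempty X] (hn : 1 ≤ n) (hd : DimLE X (n + 1)) (hv : Van X ℤ (n + 1))
    {f : X → Fin (n + 2) → ℝ} (hf : Continuous f)
    (hf1 : ∀ x, 0 < mn (f x) → ∑ i, f x i = 1) {η : ℝ} (hη : 6 * ((n : ℝ) + 2) * η = 1) :
    ∃ h : X → Fin (n + 2) → ℝ, ContinuousOn h {x | η ≤ mn (f x)} ∧ (∀ x, η ≤ mn (f x) → NC (h x)) ∧
      ∀ x, mn (f x) = η → h x = f x := by
  classical
  have hn2 : (0 : ℝ) < (n : ℝ) + 2 := by positivity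
  have hηp : 0 < η := by
    by_contra h
    nlinarith
  obtain ⟨ε, hε0, hε⟩ : ∃ ε > 0, ∀ x y, dist x y < ε → ∀ j, |f x j - f y j| < η / 2 := by
    have hu := CompactSpace.uniformContinuous_of_continuous hf
    obtain ⟨ε, h0, h1⟩ := Metric.uniformContinuous_iff.1 hu (η / 2) (by linarith)
    refine ⟨ε, h0, fun x y hxy j => ?_⟩
    rw [← Real.dist_eq]
    exact (dist_le_pi_dist _ _ j).trans_lt (h1 hxy)
  have hlam : ∀ x, ∃ i, ∀ j, f x j ≤ f x i := fun x => Finite.exists_max (f x)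
  choose lam hlam using hlam
  obtain ⟨κ, k0, k1, k2, k3⟩ := exists_kap hn
  obtain ⟨N, s, p, hs, hsS, hsp, F, hFc, hFN, hFκ⟩ := core1 hn hd hv (μ := fun x => mn (f x)) (fun x => mn_le _) (fun x => mn_ex _) hf1 hη hε0 hε hlam k0 k1 k2 k3
  let Y := {x : X // η ≤ mn (f x)}
  have hcl : IsClosed {x : X | η ≤ mn (f x)} := isClosed_le continuous_const (mn_cont.comp hf)
  let A : Set Y := {y | mn (f y.1) = η}
  have hA : IsClosed A := isClosed_eq (mn_cont.comp (hf.comp continuous_subtype_val)) continuous_const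
  let G : X → Fin (n + 2) → ℝ := fun x => Gm (lam ∘ p) (s x)
  have hG : Continuous G := (Gm_cont _).comp hs
  have hGS : ∀ x, G x ∈ stdSimplex ℝ (Fin (n + 2)) := fun x => Gm_simplex _ (hsS x)
  -- key: G_j ≠ 0 forces f_j ≥ 5η
  have hkey : ∀ x, 0 < mn (f x) → ∀ j, G x j ≠ 0 → 5 * η ≤ f x j := by
    intro x hx j hj
    by_contra hlt
    apply hj
    refine Gm_zero fun w hw => ?_
    by_contra h0
    apply hlt
    have := Zl hη hε hlam (x := p w) (y := x) (by rw [dist_comm]; exact hsp x w h0) (hf1 x hx)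
    rw [← hw]; exact this
  have hz : ∀ x, mn (f x) = η → ∃ j, f x j = η ∧ G x j = 0 := by
    intro x hx
    obtain ⟨j, hj⟩ := mn_ex (f x)
    refine ⟨j, by rw [← hj, hx], ?_⟩
    by_contra h
    have := hkey x (by rw [hx]; exact hηp) j h
    rw [← hj, hx] at this
    linarith
  obtain ⟨F1, hF1c, hF1N, hF1A⟩ := hep (X := Y) (F := fun y => F y.1) (g := fun y => G y.1)
    (continuousOn_iff_continuous_restrict.1 hFc) (hG.comp continuous_subtype_val) (fun y => hFN y.1 y.2) hA (by
      intro y hy τ h0 h1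
      have hy' : mn (f y.1) = η := hy
      obtain ⟨j, -, hj⟩ := hz y.1 hy'
      have := k3 (G y.1) (hGS _) ⟨j, hj⟩ τ h0 h1
      simp only [hFκ y.1 hy']
      exact this)
  obtain ⟨F2, hF2c, hF2N, hF2A⟩ := hep (X := Y) (F := F1) (g := fun y => f y.1) hF1c (hf.comp continuous_subtype_val) hF1N hA (by
      intro y hy τ h0 h1
      have hy' : mn (f y.1) = η := hy
      obtain ⟨j, hj1, hj2⟩ := hz y.1 hy'
      rw [hF1A y hy]
      by_contra hc
      unfold NC at hc
      push Not at hc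
      have hsum : ∑ i, ((1 - τ) * G y.1 i + τ * f y.1 i) = 1 := by
        rw [Finset.sum_add_distrib, ← Finset.mul_sum, ← Finset.mul_sum, (hGS y.1).2, hf1 y.1 (by rw [hy']; exact hηp)]; ring
      rw [Finset.sum_congr rfl (fun i _ => hc i j), Finset.sum_const, hj1, hj2] at hsum
      simp at hsum
      nlinarith)
  refine ⟨fun x => if hx : η ≤ mn (f x) then F2 ⟨x, hx⟩ else 0, ?_, ?_, ?_⟩
  · rw [continuousOn_iff_continuous_restrict]
    refine hF2c.congr fun y => ?_
    show F2 y = if hx : η ≤ mn (f y.1) then F2 ⟨y.1, hx⟩ else 0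
    rw [dif_pos y.2]
  · intro x hx
    simp only [dif_pos hx]
    exact hF2N _
  · intro x hx
    simp only [dif_pos hx.ge]
    exact hF2A ⟨x, hx.ge⟩ hx

lemma stepf [CompactSpace X] [Nonempty X] (hn : 1 ≤ n) (hd : DimLE X (n + 1)) (hv : Van X ℤ (n + 1))
    {f : X → Fin (n + 2) → ℝ} (hf : Continuous f) (hpos : ∀ x i, 0 ≤ f x i)
    (hf1 : ∀ x, 0 < mn (f x) → ∑ i, f x i = 1) :
    ∃ r : X → Fin (n + 2) → ℝ, Continuous r ∧ (∀ x i, 0 ≤ r x i) ∧ (∀ x, ∑ i, r x i = ∑ i, f x i) ∧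
      (∀ x i, f x i = 0 → r x i = 0) ∧ ∀ x, ∃ i, r x i = 0 := by
  classical
  have hn2 : (0 : ℝ) < (n : ℝ) + 2 := by positivity
  set η : ℝ := 1 / (6 * ((n : ℝ) + 2)) with hηd
  have hη : 6 * ((n : ℝ) + 2) * η = 1 := by rw [hηd]; field_simp
  have hηp : 0 < η := by positivity
  obtain ⟨h, hc, hN, hA⟩ := core2 hn hd hv hf hf1 hη
  have hmn0 : ∀ x, 0 ≤ mn (f x) := fun x => by
    obtain ⟨i, hi⟩ := mn_ex (f x); rw [hi]; exact hpos x i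
  let D : (Fin (n + 2) → ℝ) → ℝ := fun v => ∑ i, (v i - mn v)
  have hDc : Continuous D := by
    have := mn_cont (n := n)
    show Continuous fun v : Fin (n + 2) → ℝ => ∑ i, (v i - mn v)
    fun_prop
  have hDp : ∀ v, NC v → 0 < D v := by
    rintro v ⟨i, j, hij⟩
    have : ∃ i, mn v < v i := by
      by_contra hcon
      push Not at hcon
      exact hij (((hcon i).antisymm (mn_le v i)).trans ((hcon j).antisymm (mn_le v j)).symm)
    obtain ⟨i, hi⟩ := this
    exact Finset.sum_pos' (fun i _ => sub_nonneg.2 (mn_le v i)) ⟨i, Finset.mem_univ _, sub_pos.2 hi⟩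
  have hD : ∀ v, D v = ∑ i, v i - ((n : ℝ) + 2) * mn v := by
    intro v
    simp [D, Finset.sum_sub_distrib]
  let C : Bool → Set X := fun b => if b then {x | η ≤ mn (f x)} else {x | mn (f x) ≤ η}
  let r0 : Bool → X → Fin (n + 2) → ℝ := fun b => if b then (fun x i => (h x i - mn (h x)) / D (h x)) else (fun x i => (f x i - mn (f x)) / (1 - ((n : ℝ) + 2) * mn (f x)))
  have hden : ∀ x, mn (f x) ≤ η → 0 < 1 - ((n : ℝ) + 2) * mn (f x) := by
    intro x hx
    nlinarith
  obtain ⟨r, hrc, hr⟩ := glue C r0 (by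
      rintro (_ | _)
      · exact isClosed_le (mn_cont.comp hf) continuous_const
      · exact isClosed_le continuous_const (mn_cont.comp hf)) (by
      intro x
      rcases le_total η (mn (f x)) with h | h
      · exact ⟨true, h⟩
      · exact ⟨false, h⟩) (by
      rintro (_ | _)
      · show ContinuousOn (fun x i => (f x i - mn (f x)) / (1 - ((n : ℝ) + 2) * mn (f x))) {x | mn (f x) ≤ η}
        have hm : Continuous fun x => mn (f x) := mn_cont.comp hf
        refine continuousOn_pi.2 fun i => ContinuousOn.div (Continuous.continuousOn (by fun_prop)) (Continuous.continuousOn (by fun_prop)) fun x hx => (hden x hx).ne'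
      · show ContinuousOn (fun x i => (h x i - mn (h x)) / D (h x)) {x | η ≤ mn (f x)}
        have hm : ContinuousOn (fun x => mn (h x)) {x | η ≤ mn (f x)} := mn_cont.comp_continuousOn hc
        have hD : ContinuousOn (fun x => D (h x)) {x | η ≤ mn (f x)} := hDc.comp_continuousOn hc
        refine continuousOn_pi.2 fun i => ContinuousOn.div (ContinuousOn.sub ((continuous_apply i).comp_continuousOn hc) hm) hD fun x hx => (hDp _ (hN x hx)).ne') (by
      have key : ∀ x, mn (f x) = η → r0 true x = r0 false x := by
        intro x hx
        show (fun i => (h x i - mn (h x)) / D (h x)) = (fun i => (f x i - mn (f x)) / (1 - ((n : ℝ) + 2) * mn (f x)))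
        rw [hA x hx, hD, hf1 x (by rw [hx]; exact hηp)]
      rintro (_ | _) (_ | _) x h1 h2
      · rfl
      · exact (key x (le_antisymm h1 h2)).symm
      · exact key x (le_antisymm h2 h1)
      · rfl)
  have hrt : ∀ x, η ≤ mn (f x) → ∀ i, r x i = (h x i - mn (h x)) / D (h x) := fun x hx i => congrFun (hr true x hx) i
  have hrf : ∀ x, mn (f x) ≤ η → ∀ i, r x i = (f x i - mn (f x)) / (1 - ((n : ℝ) + 2) * mn (f x)) := fun x hx i => congrFun (hr false x hx) i
  refine ⟨r, hrc, fun x i => ?_, fun x => ?_, fun x i h0 => ?_, fun x => ?_⟩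
  · rcases le_total η (mn (f x)) with hx | hx
    · rw [hrt x hx]
      exact div_nonneg (sub_nonneg.2 (mn_le _ i)) (hDp _ (hN x hx)).le
    · rw [hrf x hx]
      exact div_nonneg (sub_nonneg.2 (mn_le _ i)) (hden x hx).le
  · rcases le_total η (mn (f x)) with hx | hx
    · simp only [hrt x hx]
      rw [← Finset.sum_div, hf1 x (by linarith)]
      exact div_self (hDp _ (hN x hx)).ne'
    · simp only [hrf x hx]
      rw [← Finset.sum_div]
      have e : ∑ i, (f x i - mn (f x)) = ∑ i, f x i - ((n : ℝ) + 2) * mn (f x) := hD (f x)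
      rw [e]
      rcases (hmn0 x).eq_or_lt with h0 | h0
      · rw [← h0]; simp
      · rw [hf1 x h0]; exact div_self (hden x hx).ne'
  · have hm : mn (f x) = 0 := le_antisymm (h0 ▸ mn_le (f x) i) (hmn0 x)
    rw [hrf x (by rw [hm]; exact hηp.le), hm, h0]; simp
  · rcases le_total η (mn (f x)) with hx | hx
    · obtain ⟨i, hi⟩ := mn_ex (h x)
      exact ⟨i, by rw [hrt x hx, ← hi]; simp⟩
    · obtain ⟨i, hi⟩ := mn_ex (f x)
      exact ⟨i, by rw [hrf x hx, ← hi]; simp⟩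

lemma step [CompactSpace X] [Nonempty X] (hn : 1 ≤ n) (hd : DimLE X (n + 1)) (hv : Van X ℤ (n + 1)) {N : ℕ}
    {t : X → Fin N → ℝ} (ht : Continuous t) (hS : ∀ x, t x ∈ stdSimplex ℝ (Fin N))
    (hcard : ∀ x, (Finset.univ.filter fun w => t x w ≠ 0).card ≤ n + 2) (Δ : Finset (Fin N)) (hΔ : Δ.card = n + 2) :
    ∃ t' : X → Fin N → ℝ, Continuous t' ∧ (∀ x, t' x ∈ stdSimplex ℝ (Fin N)) ∧ (∀ x w, t x w = 0 → t' x w = 0) ∧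
      ∀ x, ∃ w ∈ Δ, t' x w = 0 := by
  classical
  let e := Δ.orderEmbOfFin hΔ
  have hei : Function.Injective e := e.injective
  have heΔ : ∀ i, e i ∈ Δ := fun i => Finset.orderEmbOfFin_mem _ _ i
  obtain ⟨r, hrc, hr0, hrs, hrz, hre⟩ := stepf (f := fun x i => t x (e i)) hn hd hv (by fun_prop) (fun x i => (hS x).1 _) (by
    intro x hx
    have hne : ∀ i, t x (e i) ≠ 0 := fun i => (hx.trans_le (mn_le (fun i => t x (e i)) i)).ne'
    have hsub : Δ ⊆ Finset.univ.filter fun w => t x w ≠ 0 := by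
      intro w hw
      have : w ∈ Set.range e := by rw [Finset.range_orderEmbOfFin]; exact hw
      obtain ⟨i, rfl⟩ := this
      simpa using hne i
    have heq := Finset.eq_of_subset_of_card_le hsub (by rw [hΔ]; exact hcard x)
    have h1 : ∑ i, t x (e i) = ∑ w ∈ Δ, t x w := by
      rw [← Finset.sum_image (f := fun w => t x w) (s := Finset.univ) (g := e) (fun a _ b _ h => hei h)]
      congr 1
      ext w
      have : w ∈ Set.range e ↔ w ∈ (Δ : Set (Fin N)) := by rw [Finset.range_orderEmbOfFin]
      simpa using this
    rw [h1, ← (hS x).2]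
    refine Finset.sum_subset (Finset.subset_univ _) fun w _ hw => ?_
    rw [heq] at hw
    simpa using hw)
  let t' : X → Fin N → ℝ := fun x w => t x w + ∑ i, if e i = w then r x i - t x (e i) else 0
  have h1 : ∀ x i, t' x (e i) = r x i := by
    intro x i
    simp only [t']
    rw [Finset.sum_eq_single i]
    · simp
    · intro j _ hj
      rw [if_neg fun h => hj (hei h)]
    · simp
  have h2 : ∀ x w, (∀ i, e i ≠ w) → t' x w = t x w := by
    intro x w hw
    simp only [t']
    rw [Finset.sum_eq_zero fun i _ => if_neg (hw i), add_zero]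
  refine ⟨t', ?_, fun x => ⟨fun w => ?_, ?_⟩, fun x w hw => ?_, fun x => ?_⟩
  · refine continuous_pi fun w => Continuous.add (by fun_prop) (continuous_finsetSum _ fun i _ => ?_)
    split_ifs
    · fun_prop
    · exact continuous_const
  · by_cases hw : ∃ i, e i = w
    · obtain ⟨i, rfl⟩ := hw
      rw [h1]; exact hr0 x i
    · push Not at hw
      rw [h2 x w hw]; exact (hS x).1 w
  · simp only [t']
    rw [Finset.sum_add_distrib, (hS x).2, Finset.sum_comm]
    simp only [Finset.sum_ite_eq, Finset.mem_univ, if_true, Finset.sum_sub_distrib]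
    rw [hrs]; ring
  · by_cases hw' : ∃ i, e i = w
    · obtain ⟨i, rfl⟩ := hw'
      rw [h1]; exact hrz x i hw
    · push Not at hw'
      rw [h2 x w hw']; exact hw
  · obtain ⟨i, hi⟩ := hre x
    exact ⟨e i, heΔ i, by rw [h1]; exact hi⟩

theorem hopf [CompactSpace X] [Nonempty X] (hn : 1 ≤ n) (hd : DimLE X (n + 1)) (hv : Van X ℤ (n + 1)) : DimLE X n := by
  classical
  intro δ hδ
  obtain ⟨N, U, hUo, hUc, hUd, hUk⟩ := hd δ hδ
  obtain ⟨s, hs, hsS, hsU⟩ := exists_pou hUo hUc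
  have key : ∀ T : Finset (Finset (Fin N)), (∀ Δ ∈ T, Δ.card = n + 2) → ∃ t : X → Fin N → ℝ, Continuous t ∧
      (∀ x, t x ∈ stdSimplex ℝ (Fin N)) ∧ (∀ x w, t x w ≠ 0 → x ∈ U w) ∧ ∀ Δ ∈ T, ∀ x, ∃ w ∈ Δ, t x w = 0 := by
    intro T
    induction T using Finset.induction_on with
    | empty => intro _; exact ⟨s, hs, hsS, hsU, by simp⟩
    | insert Δ T _ ih =>
      intro hT
      obtain ⟨t, h1, h2, h3, h4⟩ := ih fun Δ h => hT Δ (Finset.mem_insert_of_mem h)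
      obtain ⟨t', a1, a2, a3, a4⟩ := step hn hd hv h1 h2 (fun x => hUk _ ⟨x, fun i hi => h3 x i (Finset.mem_filter.1 hi).2⟩) Δ (hT Δ (Finset.mem_insert_self _ _))
      refine ⟨t', a1, a2, fun x w hw => h3 x w fun h => hw (a3 x w h), fun Δ' hΔ' x => ?_⟩
      rcases Finset.mem_insert.1 hΔ' with rfl | h
      · exact a4 x
      · obtain ⟨w, hw, hw0⟩ := h4 Δ' h x
        exact ⟨w, hw, a3 x w hw0⟩
  obtain ⟨t, h1, h2, h3, h4⟩ := key (Finset.univ.filter fun Δ => Δ.card = n + 2) (by simp)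
  refine ⟨N, fun w => {x | t x w ≠ 0}, fun w => ?_, fun x => ?_, fun i x hx y hy => hUd i x (h3 x i hx) y (h3 y i hy), ?_⟩
  · exact isOpen_ne_fun ((continuous_apply w).comp h1) continuous_const
  · by_contra hc
    push Not at hc
    have := (h2 x).2
    rw [Finset.sum_eq_zero fun w _ => by simpa using hc w] at this
    simp at this
  · rintro S ⟨x, hx⟩
    by_contra hlt
    push Not at hlt
    obtain ⟨Δ, hΔ, hΔc⟩ := Finset.exists_subset_card_eq (s := S) (n := n + 2) (by omega)
    obtain ⟨w, hw, hw0⟩ := h4 Δ (by simpa using hΔc) x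
    exact hx w (hΔ hw) hw0

end hopf3
end MDP

namespace MDP
section prodthm

/-- partial sums -/
noncomputable def cum {N : ℕ} (s : Fin N → ℝ) (k : ℕ) : ℝ := ∑ i : Fin N, if (i : ℕ) < k then s i else 0

lemma cum_zero {N : ℕ} (s : Fin N → ℝ) : cum s 0 = 0 := by simp [cum]

lemma cum_top {N : ℕ} (s : Fin N → ℝ) : cum s N = ∑ i, s i := by
  unfold cum
  exact Finset.sum_congr rfl fun i _ => if_pos i.2

lemma cum_succ {N : ℕ} (s : Fin N → ℝ) (v : Fin N) : cum s (v + 1) = cum s v + s v := by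
  unfold cum
  have : s v = ∑ i : Fin N, if i = v then s i else 0 := by simp
  conv_rhs => rw [this]
  rw [← Finset.sum_add_distrib]
  refine Finset.sum_congr rfl fun i _ => ?_
  by_cases h : i = v
  · subst h; simp
  · have h' : (i : ℕ) ≠ v := fun e => h (Fin.ext e)
    by_cases h2 : (i : ℕ) < v
    · rw [if_pos (by omega), if_pos h2, if_neg h, add_zero]
    · rw [if_neg (by omega), if_neg h2, if_neg h, add_zero]

lemma cum_mono {N : ℕ} {s : Fin N → ℝ} (hs : ∀ i, 0 ≤ s i) : Monotone (cum s) := by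
  intro a b hab
  refine Finset.sum_le_sum fun i _ => ?_
  by_cases h : (i : ℕ) < a
  · rw [if_pos h, if_pos (by omega)]
  · rw [if_neg h]
    split_ifs
    · exact hs i
    · exact le_rfl

lemma cum_cont {N : ℕ} (k : ℕ) : Continuous fun s : Fin N → ℝ => cum s k := by
  unfold cum
  refine continuous_finsetSum _ fun i _ => ?_
  split_ifs
  · exact continuous_apply i
  · exact continuous_const

lemma cum_find {N : ℕ} {s : Fin N → ℝ} (hs : s ∈ stdSimplex ℝ (Fin N)) {r : ℝ} (h0 : 0 < r) (h1 : r < 1)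
    (hr : ∀ v : Fin N, r ≠ cum s v) : ∃ v : Fin N, cum s v < r ∧ r < cum s (v + 1) := by
  classical
  have hex : ∃ k, r < cum s k := ⟨N, by rw [cum_top, hs.2]; exact h1⟩
  have hk := Nat.find_spec hex
  have hmin : ∀ m, m < Nat.find hex → ¬ r < cum s m := fun m hm => Nat.find_min hex hm
  generalize Nat.find hex = k at hk hmin
  rcases k with _ | k
  · rw [cum_zero] at hk; linarith
  · have hkN : k < N := by
      by_contra h
      have := hmin N (by omega)
      rw [cum_top, hs.2] at this
      exact this h1
    refine ⟨⟨k, hkN⟩, ?_, hk⟩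
    have h2 := not_lt.1 (hmin k (by omega))
    exact lt_of_le_of_ne h2 (hr ⟨k, hkN⟩).symm

lemma chain_card {N M : ℕ} (P : Finset (Fin N × Fin M)) (A : Finset (Fin N)) (B : Finset (Fin M)) {a b : ℕ}
    (hA : A.card ≤ a) (hB : B.card ≤ b) (hPA : ∀ x ∈ P, x.1 ∈ A) (hPB : ∀ x ∈ P, x.2 ∈ B)
    (hch : ∀ x ∈ P, ∀ y ∈ P, (x.1 ≤ y.1 ∧ x.2 ≤ y.2) ∨ (y.1 ≤ x.1 ∧ y.2 ≤ x.2)) : P.card ≤ a + b - 1 := by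
  classical
  let ra : Fin N → ℕ := fun v => (A.filter (· < v)).card
  let rb : Fin M → ℕ := fun v => (B.filter (· < v)).card
  have ham : Monotone ra := fun v w h => Finset.card_le_card fun i hi => by
    simp only [Finset.mem_filter] at hi ⊢
    exact ⟨hi.1, hi.2.trans_le h⟩
  have hbm : Monotone rb := fun v w h => Finset.card_le_card fun i hi => by
    simp only [Finset.mem_filter] at hi ⊢
    exact ⟨hi.1, hi.2.trans_le h⟩
  have has : ∀ v ∈ A, ∀ w, v < w → ra v < ra w := fun v hv w h => Finset.card_lt_card (by
    rw [Finset.ssubset_iff_of_subset]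
    · exact ⟨v, by simp [hv, h], by simp⟩
    · intro i hi
      simp only [Finset.mem_filter] at hi ⊢
      exact ⟨hi.1, hi.2.trans h⟩)
  have hbs : ∀ v ∈ B, ∀ w, v < w → rb v < rb w := fun v hv w h => Finset.card_lt_card (by
    rw [Finset.ssubset_iff_of_subset]
    · exact ⟨v, by simp [hv, h], by simp⟩
    · intro i hi
      simp only [Finset.mem_filter] at hi ⊢
      exact ⟨hi.1, hi.2.trans h⟩)
  have hal : ∀ v ∈ A, ra v < a := fun v hv => (Finset.card_lt_card (by
    rw [Finset.ssubset_iff_of_subset (Finset.filter_subset _ _)]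
    exact ⟨v, hv, by simp⟩)).trans_le hA
  have hbl : ∀ v ∈ B, rb v < b := fun v hv => (Finset.card_lt_card (by
    rw [Finset.ssubset_iff_of_subset (Finset.filter_subset _ _)]
    exact ⟨v, hv, by simp⟩)).trans_le hB
  have key : ∀ x ∈ P, ∀ y ∈ P, x.1 ≤ y.1 ∧ x.2 ≤ y.2 → ra x.1 + rb x.2 = ra y.1 + rb y.2 → x = y := by
    intro x hx y hy h e
    have h1 := ham h.1
    have h2 := hbm h.2
    rcases h.1.eq_or_lt with h3 | h3
    · rcases h.2.eq_or_lt with h4 | h4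
      · exact Prod.ext h3 h4
      · have := hbs _ (hPB x hx) _ h4; omega
    · have := has _ (hPA x hx) _ h3; omega
  have hinj : Set.InjOn (fun x : Fin N × Fin M => ra x.1 + rb x.2) P := by
    intro x hx y hy e
    rcases hch x hx y hy with h | h
    · exact key x hx y hy h e
    · exact (key y hy x hx h e.symm).symm
  have := Finset.card_le_card_of_injOn (s := P) (t := Finset.range (a + b - 1)) _ (by
    intro x hx
    have h1 := hal _ (hPA x hx)
    have h2 := hbl _ (hPB x hx)
    simp only [Finset.coe_range, Set.mem_Iio]
    omega) hinj
  simpa using this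

lemma cov_of_fintype {X : Type*} [MetricSpace X] {ι : Type*} [Fintype ι] {k : ℕ} {δ : ℝ} (U : ι → Set X)
    (h1 : ∀ i, IsOpen (U i)) (h2 : ∀ x, ∃ i, x ∈ U i) (h3 : ∀ i, ∀ x ∈ U i, ∀ y ∈ U i, dist x y < δ)
    (h4 : ∀ s : Finset ι, (∃ x, ∀ i ∈ s, x ∈ U i) → s.card ≤ k) : Cov X k δ := by
  classical
  let e := (Fintype.equivFin ι).symm
  refine ⟨Fintype.card ι, fun i => U (e i), fun i => h1 _, fun x => ?_, fun i => h3 _, fun s hs => ?_⟩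
  · obtain ⟨i, hi⟩ := h2 x
    exact ⟨e.symm i, by simpa using hi⟩
  · rw [← Finset.card_map e.toEmbedding]
    obtain ⟨x, hx⟩ := hs
    refine h4 _ ⟨x, fun i hi => ?_⟩
    obtain ⟨j, hj, rfl⟩ := Finset.mem_map.1 hi
    exact hx j hj

theorem dim_prod {X Y : Type*} [MetricSpace X] [MetricSpace Y] [CompactSpace X] [CompactSpace Y] {p q : ℕ}
    (hX : DimLE X p) (hY : DimLE Y q) : DimLE (X × Y) (p + q) := by
  classical
  intro δ hδ
  obtain ⟨N, U, hUo, hUc, hUd, hUk⟩ := hX δ hδ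
  obtain ⟨M, V, hVo, hVc, hVd, hVk⟩ := hY δ hδ
  obtain ⟨s, hs, hsS, hsU⟩ := exists_pou hUo hUc
  obtain ⟨t, ht, htS, htV⟩ := exists_pou hVo hVc
  let W : Fin N × Fin M → Set (X × Y) := fun i => {z | max (cum (s z.1) i.1) (cum (t z.2) i.2) < min (cum (s z.1) (i.1 + 1)) (cum (t z.2) (i.2 + 1))}
  have hW : ∀ i z, z ∈ W i → cum (s z.1) i.1 < cum (s z.1) (i.1 + 1) ∧ cum (t z.2) i.2 < cum (t z.2) (i.2 + 1) ∧
      cum (s z.1) i.1 < cum (t z.2) (i.2 + 1) ∧ cum (t z.2) i.2 < cum (s z.1) (i.1 + 1) := by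
    intro i z hz
    have hz' : max (cum (s z.1) i.1) (cum (t z.2) i.2) < min (cum (s z.1) (i.1 + 1)) (cum (t z.2) (i.2 + 1)) := hz
    rw [max_lt_iff, lt_min_iff, lt_min_iff] at hz'
    exact ⟨hz'.1.1, hz'.2.2, hz'.1.2, hz'.2.1⟩
  have hWU : ∀ i z, z ∈ W i → s z.1 i.1 ≠ 0 ∧ t z.2 i.2 ≠ 0 := by
    intro i z hz
    obtain ⟨h1, h2, -, -⟩ := hW i z hz
    rw [cum_succ] at h1 h2
    exact ⟨fun h => by rw [h] at h1; simp at h1, fun h => by rw [h] at h2; simp at h2⟩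
  refine cov_of_fintype W (fun i => ?_) (fun z => ?_) (fun i z hz z' hz' => ?_) (fun P hP => ?_)
  · have c1 : ∀ k, Continuous fun z : X × Y => cum (s z.1) k := fun k => (cum_cont k).comp (hs.comp continuous_fst)
    have c2 : ∀ k, Continuous fun z : X × Y => cum (t z.2) k := fun k => (cum_cont k).comp (ht.comp continuous_snd)
    exact isOpen_lt ((c1 _).max (c2 _)) ((c1 _).min (c2 _))
  · obtain ⟨r, hr, hrn⟩ : ∃ r ∈ Ioo (0 : ℝ) 1, r ∉ (Set.range fun v : Fin N => cum (s z.1) v) ∪ (Set.range fun v : Fin M => cum (t z.2) v) := by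
      have hfin : ((Set.range fun v : Fin N => cum (s z.1) v) ∪ (Set.range fun v : Fin M => cum (t z.2) v)).Finite :=
        (Set.finite_range _).union (Set.finite_range _)
      obtain ⟨r, hr, hr'⟩ := (Set.Ioo_infinite (zero_lt_one (α := ℝ))).exists_notMem_finite hfin
      exact ⟨r, hr, hr'⟩
    obtain ⟨v, hv1, hv2⟩ := cum_find (hsS z.1) hr.1 hr.2 (fun v h => hrn (Or.inl ⟨v, h.symm⟩))
    obtain ⟨w, hw1, hw2⟩ := cum_find (htS z.2) hr.1 hr.2 (fun v h => hrn (Or.inr ⟨v, h.symm⟩))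
    exact ⟨(v, w), (max_lt hv1 hw1).trans (lt_min hv2 hw2)⟩
  · obtain ⟨a, b⟩ := hWU i z hz
    obtain ⟨a', b'⟩ := hWU i z' hz'
    rw [Prod.dist_eq]
    exact max_lt (hUd _ _ (hsU _ _ a) _ (hsU _ _ a')) (hVd _ _ (htV _ _ b) _ (htV _ _ b'))
  · obtain ⟨z, hz⟩ := hP
    have h1 : (Finset.univ.filter fun w => s z.1 w ≠ 0).card ≤ p + 1 := hUk _ ⟨z.1, fun i hi => hsU _ _ (Finset.mem_filter.1 hi).2⟩
    have h2 : (Finset.univ.filter fun w => t z.2 w ≠ 0).card ≤ q + 1 := hVk _ ⟨z.2, fun i hi => htV _ _ (Finset.mem_filter.1 hi).2⟩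
    have := chain_card P _ _ h1 h2 (fun x hx => by simpa using (hWU x z (hz x hx)).1) (fun x hx => by simpa using (hWU x z (hz x hx)).2) (by
      intro x hx y hy
      obtain ⟨a1, a2, a3, a4⟩ := hW x z (hz x hx)
      obtain ⟨b1, b2, b3, b4⟩ := hW y z (hz y hy)
      have ms := cum_mono (hsS z.1).1
      have mt := cum_mono (htS z.2).1
      by_contra hc
      rw [not_or, not_and_or, not_and_or] at hc
      simp only [not_le] at hc
      obtain ⟨h | h, h' | h'⟩ := hc
      · exact absurd (h.trans h') (lt_irrefl _)
      · have e1 : cum (s z.1) (y.1 + 1) ≤ cum (s z.1) x.1 := ms h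
        have e2 : cum (t z.2) (x.2 + 1) ≤ cum (t z.2) y.2 := mt h'
        linarith
      · have e1 : cum (s z.1) (x.1 + 1) ≤ cum (s z.1) y.1 := ms h'
        have e2 : cum (t z.2) (y.2 + 1) ≤ cum (t z.2) x.2 := mt h
        linarith
      · exact absurd (h.trans h') (lt_irrefl _))
    omega

end prodthm
end MDP

namespace MDP
section trans
open MeanDimPaper

variable {Z : Type*} [TopologicalSpace Z]

lemma covD_le {α : Set (Set Z)} {q N : ℕ} (U : Fin N → Set Z) (h1 : ∀ i, IsOpen (U i)) (h2 : ∀ x, ∃ i, x ∈ U i)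
    (h3 : ∀ i, ∃ V ∈ α, U i ⊆ V) (h4 : ∀ s : Finset (Fin N), (∃ x, ∀ i ∈ s, x ∈ U i) → s.card ≤ q + 1) : covD α ≤ q := by
  classical
  have hm : Set.range U ∈ {β : Set (Set Z) | IsOpenCover β ∧ Refines β α} := by
    refine ⟨⟨?_, ?_⟩, ?_⟩
    · rintro _ ⟨i, rfl⟩; exact h1 i
    · rw [Set.sUnion_range]; exact iUnion_eq_univ_iff.2 h2
    · rintro _ ⟨i, rfl⟩; exact h3 i
  refine (iInf₂_le (Set.range U) hm).trans ?_
  · refine iSup₂_le fun m hm' => ?_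
    obtain ⟨f, hf, hfU, x, hx⟩ := hm'
    choose i hi using hfU
    have hinj : Function.Injective i := fun a b h => hf (by rw [← hi a, ← hi b, h])
    have := h4 (Finset.univ.map ⟨i, hinj⟩) ⟨x, fun j hj => by
      obtain ⟨a, -, rfl⟩ := Finset.mem_map.1 hj
      have := Set.mem_iInter.1 hx a
      rw [← hi a] at this
      exact this⟩
    simp at this
    exact_mod_cast this

lemma of_covD [CompactSpace Z] {α : Set (Set Z)} {q : ℕ} (h : covD α ≤ q) :
    ∃ (N : ℕ) (U : Fin N → Set Z), (∀ i, IsOpen (U i)) ∧ (∀ x, ∃ i, x ∈ U i) ∧ (∀ i, ∃ V ∈ α, U i ⊆ V) ∧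
      ∀ s : Finset (Fin N), (∃ x, ∀ i ∈ s, x ∈ U i) → s.card ≤ q + 1 := by
  classical
  have h' : covD α < ((q + 1 : ℕ) : ℕ∞) := h.trans_lt (by exact_mod_cast Nat.lt_succ_self q)
  unfold covD at h'
  simp only [iInf_lt_iff] at h'
  obtain ⟨β, ⟨⟨hβo, hβc⟩, hβr⟩, hβ⟩ := h'
  obtain ⟨T, hT, hTf, hTc⟩ : ∃ T ⊆ β, T.Finite ∧ (univ : Set Z) ⊆ ⋃₀ T := by
    obtain ⟨t, ht⟩ := isCompact_univ.elim_finite_subcover (fun b : β => b.1) (fun b => hβo _ b.2) (by rw [← Set.sUnion_eq_iUnion, hβc])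
    refine ⟨Subtype.val '' (t : Set β), ?_, t.finite_toSet.image _, fun x hx => ?_⟩
    · rintro _ ⟨b, -, rfl⟩; exact b.2
    · obtain ⟨b, hb, hxb⟩ := Set.mem_iUnion₂.1 (ht hx)
      exact ⟨b.1, ⟨b, hb, rfl⟩, hxb⟩
  obtain ⟨N, U, hU, hr⟩ := hTf.fin_param
  have hUT : ∀ i, U i ∈ T := fun i => by rw [← hr]; exact ⟨i, rfl⟩
  refine ⟨N, U, fun i => hβo _ (hT (hUT i)), fun x => ?_, fun i => hβr _ (hT (hUT i)), ?_⟩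
  · obtain ⟨V, hV, hx⟩ := hTc (mem_univ x)
    rw [← hr] at hV
    obtain ⟨i, rfl⟩ := hV
    exact ⟨i, hx⟩
  · rintro s ⟨x, hx⟩
    rcases hk : s.card with _ | m
    · omega
    · have hm : (m : ℕ∞) ≤ ord β := by
        refine le_iSup₂_of_le m ?_ le_rfl
        refine ⟨fun i => U (s.orderEmbOfFin hk i), ?_, fun i => hT (hUT _), x, ?_⟩
        · exact hU.comp (s.orderEmbOfFin hk).injective
        · exact Set.mem_iInter.2 fun i => hx _ (Finset.orderEmbOfFin_mem _ _ _)
      have := hm.trans_lt hβ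
      have : m < q + 1 := by exact_mod_cast this
      omega

lemma dimLE_of_topDim {X : Type*} [MetricSpace X] [CompactSpace X] {q : ℕ} (h : topDim X ≤ q) : DimLE X q := by
  intro δ hδ
  have hα : IsOpenCover (Set.range fun x : X => Metric.ball x (δ / 2)) := by
    refine ⟨?_, ?_⟩
    · rintro _ ⟨x, rfl⟩; exact Metric.isOpen_ball
    · rw [Set.sUnion_range]
      exact iUnion_eq_univ_iff.2 fun x => ⟨x, Metric.mem_ball_self (by linarith)⟩
  have h1 : covD (Set.range fun x : X => Metric.ball x (δ / 2)) ≤ q := (le_iSup₂_of_le (f := fun α (_ : α ∈ {α : Set (Set X) | IsOpenCover α}) => covD α) _ hα le_rfl).trans h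
  obtain ⟨N, U, a1, a2, a3, a4⟩ := of_covD h1
  refine ⟨N, U, a1, a2, fun i x hx y hy => ?_, a4⟩
  obtain ⟨_, ⟨c, rfl⟩, hc⟩ := a3 i
  have e1 := Metric.mem_ball.1 (hc hx)
  have e2 := Metric.mem_ball.1 (hc hy)
  have := dist_triangle_right x y c
  linarith

lemma topDim_le {X : Type*} [MetricSpace X] [CompactSpace X] [Nonempty X] {q : ℕ} (h : DimLE X q) : topDim X ≤ q := by
  refine iSup₂_le fun α hα => ?_
  obtain ⟨δ, hδ, hL⟩ := lebesgue_number_lemma_of_metric_sUnion isCompact_univ hα.1 (by rw [hα.2])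
  obtain ⟨N, U, a1, a2, a3, a4⟩ := h δ hδ
  refine covD_le U a1 a2 (fun i => ?_) a4
  by_cases hne : (U i).Nonempty
  · obtain ⟨x, hx⟩ := hne
    obtain ⟨t, ht, hb⟩ := hL x (mem_univ x)
    exact ⟨t, ht, fun y hy => hb (Metric.mem_ball.2 (a3 i y hy x hx))⟩
  · obtain ⟨t, ht, hb⟩ := hL (Classical.arbitrary X) (mem_univ _)
    refine ⟨t, ht, fun y hy => absurd ⟨y, hy⟩ hne⟩

end trans

section inv

universe w
variable {K : Type w} [MetricSpace K] [CompactSpace K] [Nonempty K]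

/-- dimension bound together with cohomological vanishing -/
def Inv (Y : Type*) [MetricSpace Y] (q : ℕ) : Prop :=
  DimLE Y q ∧ Van Y ℚ q ∧ ∀ p : ℕ, p.Prime → Van Y (ZMod p) q

lemma Inv.sq {Y : Type*} [MetricSpace Y] [CompactSpace Y] [Nonempty Y] {q : ℕ} (hq : 1 ≤ q) (h : Inv Y q) : Inv (Y × Y) (2 * q - 1) := by
  obtain ⟨h1, h2, h3⟩ := h
  refine ⟨?_, van_sq hq h1 h2, fun p hp => van_sq hq h1 (h3 p hp)⟩
  have e : 2 * q - 1 + 1 = 2 * q := by omega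
  refine hopf (by omega) ?_ ?_
  · rw [e, two_mul]; exact dim_prod h1 h1
  · rw [e]; exact van_sq_int hq h1 h2 h3

lemma Inv.base {q : ℕ} (hq : 1 ≤ q) (h1 : DimLE K q) (h2 : DimLE (K × K) (2 * q - 1)) : Inv K q :=
  ⟨h1, van_of_sq hq h2 ℚ, fun p hp => by
    have := Fact.mk hp
    exact van_of_sq hq h2 (ZMod p)⟩

lemma upper_tower {q : ℕ} (hq : 1 ≤ q) (h : Inv K q) (m : ℕ) :
    ∃ (Y : Type w) (_ : MetricSpace Y) (_ : CompactSpace Y) (_ : Nonempty Y) (φ : (ℤ → K) → Y), Continuous φ ∧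
      Inv Y (2 ^ m * (q - 1) + 1) ∧ ∀ x y : ℤ → K, ∀ i : ℤ, 0 ≤ i → i < 2 ^ m → dist (x i) (y i) ≤ dist (φ x) (φ y) := by
  induction m with
  | zero =>
    refine ⟨K, inferInstance, inferInstance, inferInstance, fun x => x 0, continuous_apply 0, ?_, ?_⟩
    · have : 2 ^ 0 * (q - 1) + 1 = q := by omega
      rw [this]; exact h
    · intro x y i h0 h1
      have : i = 0 := by simp at h1; omega
      rw [this]
  | succ m ih =>
    obtain ⟨Y, i1, i2, i3, φ, hφ, hI, hd⟩ := ih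
    refine ⟨Y × Y, inferInstance, inferInstance, inferInstance, fun x => (φ x, φ fun i => x (i + 2 ^ m)), ?_, ?_, ?_⟩
    · refine hφ.prodMk (hφ.comp ?_)
      exact continuous_pi fun i => continuous_apply _
    · have := hI.sq (by omega)
      have e : 2 * (2 ^ m * (q - 1) + 1) - 1 = 2 ^ (m + 1) * (q - 1) + 1 := by
        rw [pow_succ]
        have : 2 ^ m * 2 * (q - 1) = 2 * (2 ^ m * (q - 1)) := by ring
        omega
      rw [← e]; exact this
    · intro x y i h0 h1
      rw [Prod.dist_eq]
      by_cases hi : i < 2 ^ m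
      · exact (hd x y i h0 hi).trans (le_max_left _ _)
      · refine le_trans ?_ (le_max_right _ _)
        have := hd (fun i => x (i + 2 ^ m)) (fun i => y (i + 2 ^ m)) (i - 2 ^ m) (by omega) (by rw [pow_succ] at h1; omega)
        simpa using this

lemma lower_tower {F : Type*} [Field F] {j : ℕ} {ε : ℝ} {u : List K → F} {B : Set K} (h : Coc F j ε u B) (n : ℕ) :
    ∃ (Y : Type w) (_ : MetricSpace Y) (_ : CompactSpace Y) (_ : Nonempty Y) (ψ : Y → (ℤ → K)), Continuous ψ ∧
      (∃ (u : List Y → F) (B : Set Y), Coc F ((n + 1) * j) ε u B) ∧ 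
      ∀ y y' : Y, ∀ r : ℝ, (∀ i : ℕ, i < n + 1 → dist (ψ y i) (ψ y' i) < r) → dist y y' < r := by
  induction n with
  | zero =>
    refine ⟨K, inferInstance, inferInstance, inferInstance, fun y _ => y, by fun_prop, ⟨u, B, ?_⟩, ?_⟩
    · simpa using h
    · intro y y' r h; exact h 0 (by omega)
  | succ n ih =>
    obtain ⟨Y, i1, i2, i3, ψ, hψ, ⟨u', B', hc⟩, hd⟩ := ih
    refine ⟨K × Y, inferInstance, inferInstance, inferInstance, fun y i => if i = 0 then y.1 else ψ y.2 (i - 1), ?_, ?_, ?_⟩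
    · refine continuous_pi fun i => ?_
      split_ifs
      · exact continuous_fst
      · exact (continuous_apply (i - 1)).comp (hψ.comp continuous_snd)
    · have := h.prod hc
      have e : (n + 1 + 1) * j = j + (n + 1) * j := by ring
      rw [e]; exact ⟨_, _, this⟩
    · intro y y' r hr
      rw [Prod.dist_eq]
      refine max_lt ?_ (hd _ _ r fun i hi => ?_)
      · simpa using hr 0 (by omega)
      · have := hr (i + 1) (by omega)
        have hne : ((i : ℤ) + 1) ≠ 0 := by omega
        push_cast at this
        simp only [hne, if_false] at this
        simpa using this

end inv
end MDP

namespace MDP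
section dyn
open MeanDimPaper

section gen
variable {Z : Type*} [TopologicalSpace Z] {d : Z → Z → ℝ}

lemma compat_cont (hd : IsCompatMetric d) : Continuous fun p : Z × Z => d p.1 p.2 := by
  letI : MetricSpace Z := MetricSpace.ofDistTopology d hd.refl hd.symm hd.triangle hd.isOpen_iff hd.eq_of
  exact continuous_dist

lemma compat_bdd [CompactSpace Z] (hd : IsCompatMetric d) : ∃ C, ∀ x y, d x y ≤ C := by
  obtain ⟨C, hC⟩ := (isCompact_range (compat_cont hd)).bddAbove
  exact ⟨C, fun x y => hC ⟨(x, y), rfl⟩⟩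

lemma compat_unif [CompactSpace Z] (hd : IsCompatMetric d) {W : Type*} [MetricSpace W] {g : Z → W} (hg : Continuous g) {δ : ℝ} (hδ : 0 < δ) :
    ∃ ε > 0, ∀ x y, d x y < ε → dist (g x) (g y) < δ := by
  letI : MetricSpace Z := MetricSpace.ofDistTopology d hd.refl hd.symm hd.triangle hd.isOpen_iff hd.eq_of
  obtain ⟨ε, h0, h1⟩ := Metric.uniformContinuous_iff.1 (CompactSpace.uniformContinuous_of_continuous hg) δ hδ
  exact ⟨ε, h0, fun x y h => h1 h⟩

lemma dyn_le (T : Z → Z) (n : ℕ) {x y : Z} {r : ℝ} (hr : 0 ≤ r) (h : ∀ i < n, d (T^[i] x) (T^[i] y) ≤ r) : dynDist d T n x y ≤ r := by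
  refine Real.sSup_le ?_ hr
  rintro _ ⟨i, hi, rfl⟩
  exact h i hi

lemma le_dyn {C : ℝ} (hC : ∀ x y, d x y ≤ C) (T : Z → Z) {n i : ℕ} (hi : i < n) (x y : Z) : d (T^[i] x) (T^[i] y) ≤ dynDist d T n x y := by
  refine le_csSup ⟨C, ?_⟩ ⟨i, hi, rfl⟩
  rintro _ ⟨i, hi, rfl⟩
  exact hC _ _

lemma mesh_le {α : Set (Set Z)} {r : ℝ} (hr : 0 ≤ r) (h : ∀ U ∈ α, ∀ x ∈ U, ∀ y ∈ U, d x y ≤ r) : mesh d α ≤ r := by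
  refine Real.sSup_le ?_ hr
  rintro _ ⟨U, hU, rfl⟩
  refine Real.sSup_le ?_ hr
  rintro _ ⟨x, hx, y, hy, rfl⟩
  exact h U hU x hx y hy

lemma le_mesh {C : ℝ} (hC0 : 0 ≤ C) (hC : ∀ x y, d x y ≤ C) {α : Set (Set Z)} {U : Set Z} (hU : U ∈ α) {x y : Z} (hx : x ∈ U) (hy : y ∈ U) :
    d x y ≤ mesh d α := by
  have h1 : d x y ≤ diamD d U := by
    refine le_csSup ⟨C, ?_⟩ ⟨x, hx, y, hy, rfl⟩
    rintro _ ⟨x, hx, y, hy, rfl⟩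
    exact hC _ _
  refine h1.trans (le_csSup ⟨C, ?_⟩ ⟨U, hU, rfl⟩)
  rintro _ ⟨V, hV, rfl⟩
  refine Real.sSup_le ?_ hC0
  rintro _ ⟨x, hx, y, hy, rfl⟩
  exact hC _ _

end gen

universe w
variable {K : Type w} [MetricSpace K] [CompactSpace K] [Nonempty K] {d : (ℤ → K) → (ℤ → K) → ℝ}

lemma shift_iter (i : ℕ) (x : ℤ → K) (k : ℤ) : (shift K)^[i] x k = x (k + i) := by
  induction i generalizing x with
  | zero => simp
  | succ i ih =>
    rw [Function.iterate_succ_apply, ih]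
    simp only [shift]
    congr 1
    push_cast
    ring

lemma ctrl (hd : IsCompatMetric d) {ε : ℝ} (hε : 0 < ε) :
    ∃ M : ℕ, ∃ δ > 0, ∀ x y : ℤ → K, (∀ i : ℤ, -M ≤ i → i ≤ M → dist (x i) (y i) < δ) → d x y < ε := by
  classical
  have ho : IsOpen {p : (ℤ → K) × (ℤ → K) | d p.1 p.2 < ε} := isOpen_lt (compat_cont hd) continuous_const
  have hu : {p : (ℤ → K) × (ℤ → K) | d p.1 p.2 < ε} ∈ uniformity (ℤ → K) := by
    rw [← nhdsSet_diagonal_eq_uniformity, ho.mem_nhdsSet]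
    rintro ⟨x, y⟩ hxy
    have : x = y := hxy
    subst this
    show d x x < ε
    rw [hd.refl]; exact hε
  rw [Pi.uniformity, Filter.mem_iInf] at hu
  obtain ⟨I, hI, V, hV, hVe⟩ := hu
  have hV' : ∀ i : I, ∃ δ > 0, ∀ p : (ℤ → K) × (ℤ → K), dist (p.1 i) (p.2 i) < δ → p ∈ V i := by
    intro i
    obtain ⟨t, ht, hs⟩ := Filter.mem_comap.1 (hV i)
    obtain ⟨δ, h0, h1⟩ := Metric.mem_uniformity_dist.1 ht
    exact ⟨δ, h0, fun p hp => hs (h1 hp)⟩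
  choose δ hδ hδV using hV'
  have := hI.fintype
  obtain ⟨δ0, hδ0, hle⟩ : ∃ δ0 > 0, ∀ i, δ0 ≤ δ i := by
    rcases isEmpty_or_nonempty I with h | h
    · exact ⟨1, one_pos, fun i => (h.false i).elim⟩
    · obtain ⟨i, hi⟩ := Finite.exists_min δ
      exact ⟨δ i, hδ i, hi⟩
  refine ⟨∑ i : I, (i : ℤ).natAbs, δ0, hδ0, fun x y h => ?_⟩
  have : (x, y) ∈ {p : (ℤ → K) × (ℤ → K) | d p.1 p.2 < ε} := by
    rw [hVe]
    refine Set.mem_iInter.2 fun i => hδV i _ ((h i ?_ ?_).trans_le (hle i))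
    · have := Finset.single_le_sum (f := fun i : I => (i : ℤ).natAbs) (fun _ _ => Nat.zero_le _) (Finset.mem_univ i)
      omega
    · have := Finset.single_le_sum (f := fun i : I => (i : ℤ).natAbs) (fun _ _ => Nat.zero_le _) (Finset.mem_univ i)
      omega
  exact this

lemma widim_upper (hd : IsCompatMetric d) {q : ℕ} (hq : 1 ≤ q) (h : Inv K q) {ε : ℝ} (hε : 0 < ε) :
    ∃ M : ℕ, ∀ n m : ℕ, n + 2 * M ≤ 2 ^ m → widim ε (dynDist d (shift K) n) ≤ ((2 ^ m * (q - 1) + 1 : ℕ) : ℕ∞) := by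
  obtain ⟨M, δ, hδ, hM⟩ := ctrl hd (half_pos hε)
  refine ⟨M, fun n m hnm => ?_⟩
  obtain ⟨Y, i1, i2, i3, φ, hφ, hI, hdist⟩ := upper_tower hq h m
  obtain ⟨N, U, a1, a2, a3, a4⟩ := hI.1 δ hδ
  let θ : (ℤ → K) → Y := fun x => φ fun i => x (i - M)
  have hθ : Continuous θ := hφ.comp (continuous_pi fun i => continuous_apply _)
  let V : Fin N → Set (ℤ → K) := fun i => θ ⁻¹' U i
  have hVo : ∀ i, IsOpen (V i) := fun i => (a1 i).preimage hθ
  have hVc : ∀ x, ∃ i, x ∈ V i := fun x => a2 (θ x)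
  have hα : Set.range V ∈ {α : Set (Set (ℤ → K)) | IsOpenCover α ∧ mesh (dynDist d (shift K) n) α < ε} := by
    refine ⟨⟨?_, ?_⟩, ?_⟩
    · rintro _ ⟨i, rfl⟩; exact hVo i
    · rw [Set.sUnion_range]; exact iUnion_eq_univ_iff.2 hVc
    · refine (mesh_le (half_pos hε).le ?_).trans_lt (half_lt_self hε)
      rintro _ ⟨i, rfl⟩ x hx y hy
      refine dyn_le _ _ (half_pos hε).le fun k hk => (hM _ _ fun l hl1 hl2 => ?_).le
      rw [shift_iter, shift_iter]
      have h1 := a3 i _ hx _ hy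
      have hm : ((2 : ℤ) ^ m) = ((2 ^ m : ℕ) : ℤ) := by push_cast; rfl
      have h2 := hdist (fun i => x (i - M)) (fun i => y (i - M)) (l + k + M) (by omega) (by rw [hm]; omega)
      simp only [add_sub_cancel_right] at h2
      exact h2.trans_lt h1
  refine (iInf₂_le _ hα).trans (covD_le V hVo hVc (fun i => ⟨V i, ⟨i, rfl⟩, subset_rfl⟩) ?_)
  rintro s ⟨x, hx⟩
  exact a4 s ⟨θ x, hx⟩

lemma widim_lower (hd : IsCompatMetric d) {F : Type*} [Field F] {j : ℕ} {ε : ℝ} {u : List K → F} {B : Set K} (h : Coc F j ε u B) :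
    ∃ ε1 > 0, ∀ n : ℕ, (((n + 1) * j : ℕ) : ℕ∞) ≤ widim ε1 (dynDist d (shift K) (n + 1)) := by
  have hε3 : 0 < ε / 3 := by have := h.pos; linarith
  obtain ⟨ε1, hε1, hu⟩ := compat_unif hd (continuous_apply (0 : ℤ)) hε3
  obtain ⟨C0, hC0⟩ := compat_bdd hd
  have hC : ∀ x y, d x y ≤ max 0 C0 := fun x y => (hC0 x y).trans (le_max_right _ _)
  have hCp : (0 : ℝ) ≤ max 0 C0 := le_max_left _ _
  refine ⟨ε1, hε1, fun n => le_iInf₂ fun α hα => ?_⟩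
  by_contra hlt
  push Not at hlt
  rcases hk : (n + 1) * j with _ | k
  · rw [hk] at hlt; simp at hlt
  rw [hk] at hlt
  have hle : covD α ≤ (k : ℕ∞) := by
    have : ((k + 1 : ℕ) : ℕ∞) = (k : ℕ∞) + 1 := by push_cast; rfl
    rw [this] at hlt
    exact Order.le_of_lt_add_one hlt
  obtain ⟨N, U, a1, a2, a3, a4⟩ := of_covD hle
  obtain ⟨Y, i1, i2, i3, ψ, hψ, ⟨u', B', hc⟩, hdist⟩ := lower_tower h n
  refine hc.not_cov (k := k + 1) hε3 (by linarith) (by omega) ⟨N, fun i => ψ ⁻¹' U i, fun i => (a1 i).preimage hψ, fun y => a2 _, fun i y hy y' hy' => ?_, ?_⟩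
  · refine hdist y y' _ fun l hl => ?_
    obtain ⟨A, hA, hUA⟩ := a3 i
    have e1 := le_mesh (d := dynDist d (shift K) (n + 1)) hCp (fun x y => dyn_le _ _ hCp fun i _ => hC _ _) hA (hUA hy) (hUA hy')
    have e2 := le_dyn hC (shift K) hl (ψ y) (ψ y')
    have e3 := hu _ _ ((e2.trans e1).trans_lt hα.2)
    simpa [shift_iter] using e3
  · rintro s ⟨y, hy⟩
    exact a4 s ⟨ψ y, hy⟩

lemma mdim_upper (hd : IsCompatMetric d) {q : ℕ} (hq : 1 ≤ q) (h : Inv K q) : mdim (shift K) d ≤ ((q - 1 : ℕ) : ℝ≥0∞) := by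
  refine iSup₂_le fun ε hε => ?_
  obtain ⟨M, hM⟩ := widim_upper hd hq h hε
  refine le_of_forall_gt fun c hc => ?_
  set E : ℝ≥0∞ := ((2 * M * (q - 1) + 1 : ℕ) : ℝ≥0∞) with hE
  have ht : Tendsto (fun n : ℕ => ((q - 1 : ℕ) : ℝ≥0∞) + E / (n : ℝ≥0∞)) atTop (nhds ((q - 1 : ℕ) : ℝ≥0∞)) := by
    have h0 : Tendsto (fun n : ℕ => E / (n : ℝ≥0∞)) atTop (nhds 0) := by
      have := ENNReal.Tendsto.const_mul (a := E) ENNReal.tendsto_inv_nat_nhds_zero (Or.inr (by rw [hE]; exact ENNReal.natCast_ne_top _))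
      simpa [div_eq_mul_inv] using this
    have := h0.const_add ((q - 1 : ℕ) : ℝ≥0∞)
    simpa using this
  obtain ⟨c', hc1, hc2⟩ := exists_between hc
  refine lt_of_le_of_lt ?_ hc2
  refine Filter.liminf_le_of_frequently_le' ?_
  have hev := ht.eventually (gt_mem_nhds hc1)
  refine Filter.Frequently.mono (p := fun n : ℕ => 0 < n ∧ (((q - 1 : ℕ) : ℝ≥0∞) + E / (n : ℝ≥0∞) < c') ∧ ∃ m, n + 2 * M = 2 ^ m) ?_ ?_
  · obtain ⟨n0, hn0⟩ := Filter.eventually_atTop.1 hev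
    rw [Filter.frequently_atTop]
    intro a
    have hlt : a + n0 + 1 + 2 * M < 2 ^ (a + n0 + 1 + 2 * M) := Nat.lt_two_pow_self
    refine ⟨2 ^ (a + n0 + 1 + 2 * M) - 2 * M, by omega, by omega, hn0 _ (by omega), _, Nat.sub_add_cancel (by omega)⟩
  · rintro n ⟨hn, hlt, m, hm⟩
    refine le_trans ?_ hlt.le
    have h1 : (widim ε (dynDist d (shift K) n) : ℝ≥0∞) ≤ ((2 ^ m * (q - 1) + 1 : ℕ) : ℝ≥0∞) := by
      have := ENat.toENNReal_le.2 (hM n m hm.le)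
      rwa [ENat.toENNReal_coe] at this
    have h2 : 2 ^ m * (q - 1) + 1 = n * (q - 1) + (2 * M * (q - 1) + 1) := by rw [← hm]; ring
    rw [h2] at h1
    have hn0 : (n : ℝ≥0∞) ≠ 0 := by exact_mod_cast hn.ne'
    calc (widim ε (dynDist d (shift K) n) : ℝ≥0∞) / n ≤ ((n * (q - 1) + (2 * M * (q - 1) + 1) : ℕ) : ℝ≥0∞) / n := ENNReal.div_le_div_right h1 _
      _ = ((q - 1 : ℕ) : ℝ≥0∞) + E / n := by
        rw [Nat.cast_add, ENNReal.add_div, ← hE, Nat.cast_mul, mul_comm, ENNReal.mul_div_cancel_right hn0 (ENNReal.natCast_ne_top n)]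

lemma mdim_lower (hd : IsCompatMetric d) {F : Type*} [Field F] {j : ℕ} {ε : ℝ} {u : List K → F} {B : Set K} (h : Coc F j ε u B) :
    (j : ℝ≥0∞) ≤ mdim (shift K) d := by
  obtain ⟨ε1, hε1, hw⟩ := widim_lower hd h
  refine le_iSup₂_of_le ε1 hε1 ?_
  refine Filter.le_liminf_of_le (by isBoundedDefault) ?_
  filter_upwards [Filter.eventually_gt_atTop 0] with n hn
  obtain ⟨k, rfl⟩ : ∃ k, n = k + 1 := ⟨n - 1, by omega⟩
  have h1 := ENat.toENNReal_le.2 (hw k)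
  rw [ENat.toENNReal_coe, Nat.cast_mul] at h1
  rw [ENNReal.le_div_iff_mul_le (Or.inl (by simp)) (Or.inl (ENNReal.natCast_ne_top _)), mul_comm]
  exact h1

end dyn

section final
open MeanDimPaper

theorem main {K : Type*} [MetricSpace K] [CompactSpace K]
    (hfin : topDim K ≠ ⊤)
    (hexc : topDim (K × K) + 1 = 2 * topDim K)
    (d : (ℤ → K) → (ℤ → K) → ℝ) (hd : IsCompatMetric d) :
    mdim (shift K) d = ((topDim K - 1 : ℕ∞) : ℝ≥0∞) := by
  obtain ⟨D, hD⟩ := ENat.ne_top_iff_exists.1 hfin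
  rw [← hD] at hexc ⊢
  have hfin2 : topDim (K × K) ≠ ⊤ := by
    intro h
    rw [h] at hexc
    simp at hexc
    exact absurd hexc.symm (by exact_mod_cast ENat.natCast_ne_top (2 * D))
  obtain ⟨E, hE⟩ := ENat.ne_top_iff_exists.1 hfin2
  rw [← hE] at hexc
  have hED : E + 1 = 2 * D := by exact_mod_cast hexc
  have hD1 : 1 ≤ D := by omega
  have hne : Nonempty K := by
    by_contra hemp
    rw [not_nonempty_iff] at hemp
    have : topDim K ≤ ((0 : ℕ) : ℕ∞) := iSup₂_le fun α _ => covD_le (N := 0) (fun i => i.elim0) (fun i => i.elim0) (fun x => hemp.elim x) (fun i => i.elim0) (by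
      rintro s ⟨x, -⟩; exact hemp.elim x)
    rw [← hD] at this
    have : D ≤ 0 := by exact_mod_cast this
    omega
  have h1 : DimLE K D := dimLE_of_topDim hD.ge
  have h2 : DimLE (K × K) (2 * D - 1) := dimLE_of_topDim (by rw [← hE]; exact_mod_cast (by omega : E ≤ 2 * D - 1))
  have hI : Inv K D := Inv.base hD1 h1 h2
  have hcast : (((D : ℕ∞) - 1 : ℕ∞) : ℝ≥0∞) = ((D - 1 : ℕ) : ℝ≥0∞) := by
    rw [← ENat.toENNReal_coe]; norm_cast
  rw [hcast]
  refine le_antisymm (mdim_upper hd hD1 hI) ?_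
  rcases Nat.lt_or_ge 1 D with hD2 | hD2
  · obtain ⟨q, rfl⟩ : ∃ q, D = q + 1 := ⟨D - 1, by omega⟩
    have hnv : ¬ Van K ℤ (q + 1) := by
      intro hv
      have h3 : DimLE K q := hopf (by omega) h1 hv
      have h4 := topDim_le h3
      rw [← hD] at h4
      have : q + 1 ≤ q := by exact_mod_cast h4
      omega
    have : ∃ p : ℕ, p.Prime ∧ ¬ Van K (ZMod p) q := by
      by_contra hc
      push Not at hc
      exact hnv (van_int hI.2.1 hc)
    obtain ⟨p, hp, hV⟩ := this
    have := Fact.mk hp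
    obtain ⟨ε, u, B, hc⟩ := exists_Coc hV
    have := mdim_lower hd hc
    simpa using this
  · have : D = 1 := by omega
    subst this
    simp

end final
end MDP

namespace MeanDimPaper

variable {X : Type*} [TopologicalSpace X]

/-- if the finite dimensional compact metric space `K` has exceptional type
(`dim K² = 2 dim K - 1`), then the mean dimension of the full shift on the alphabet `K`
(computed with any metric compatible with the product topology on `K^ℤ`) equals
`dim K - 1`. -/
theorem mdim_fullshift_of_exceptional {K : Type*} [MetricSpace K] [CompactSpace K]
    (hfin : topDim K ≠ ⊤)
    (hexc : topDim (K × K) + 1 = 2 * topDim K)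
    (d : (ℤ → K) → (ℤ → K) → ℝ) (hd : IsCompatMetric d) :
    mdim (shift K) d = ((topDim K - 1 : ℕ∞) : ℝ≥0∞) := by
  exact MDP.main hfin hexc d hd

end MeanDimPaper
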